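/- arXiv:1004.3145 — 2 statements merged into one kernel-verified Lean document; each statement's English description precedes it below -/
import Mathlib

section
/- (Klain's characterization of volume) Let V be an n-dimensional Euclidean vector space and let μ be a continuous, translation invariant, complex-valued valuation on V which is even (μ(-K) = μ(K)) and simple, i.e. μ(K) = 0 for every nonempty compact convex K contained in some affine hyperplane of V. Then there is a constant c ∈ ℂ such that μ(K) = c · vol_n(K) for every nonempty compact convex K ⊆ V, where vol_n is Lebesgue measure on V. -/
open MeasureTheory Metric Set
open scoped Pointwise ENNReal

noncomputable section

variable {V : Type*} [NormedAddCommGroup V] [NormedSpace ℝ V]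

/-- `μ` is a (complex-valued) valuation: additivity on unions of convex bodies whose
union is again convex. -/
def IsValuationC (μ : ConvexBody V → ℂ) : Prop :=
  ∀ K L M N : ConvexBody V,
    (M : Set V) = (K : Set V) ∪ (L : Set V) → (N : Set V) = (K : Set V) ∩ (L : Set V) →
      μ M + μ N = μ K + μ L

/-- `μ` is translation invariant. -/
def IsTranslationInvariantC (μ : ConvexBody V → ℂ) : Prop :=
  ∀ (x : V) (K L : ConvexBody V), (L : Set V) = x +ᵥ (K : Set V) → μ L = μ K

/-- `μ` is homogeneous of degree `k`. -/
def IsHomogeneousValC (k : ℕ) (μ : ConvexBody V → ℂ) : Prop :=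
  ∀ (t : ℝ), 0 ≤ t → ∀ K L : ConvexBody V,
    (L : Set V) = t • (K : Set V) → μ L = (t : ℂ) ^ k * μ K

/-- `μ` is an even valuation. -/
def IsEvenValC (μ : ConvexBody V → ℂ) : Prop :=
  ∀ K L : ConvexBody V, (L : Set V) = -(K : Set V) → μ L = μ K

/-- `μ` is an odd valuation. -/
def IsOddValC (μ : ConvexBody V → ℂ) : Prop :=
  ∀ K L : ConvexBody V, (L : Set V) = -(K : Set V) → μ L = -μ K

/-- `μ` is simple: it vanishes on convex bodies contained in some affine hyperplane
(a translate of a linear subspace of dimension `n - 1`, `n = dim V`). -/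
def IsSimpleValC (n : ℕ) (μ : ConvexBody V → ℂ) : Prop :=
  ∀ K : ConvexBody V,
    (∃ (E : Submodule ℝ V) (x : V),
      Module.finrank ℝ E = n - 1 ∧ (K : Set V) ⊆ x +ᵥ (E : Set V)) → μ K = 0

set_option linter.unusedSectionVars false
namespace Klain

section Basics

variable {E : Type*} [NormedAddCommGroup E] [NormedSpace ℝ E]

/-- compact convex sets (possibly empty) -/
def CC (S : Set E) : Prop := Convex ℝ S ∧ IsCompact S

/-- Hausdorff closeness -/
def Near (δ : ℝ) (S T : Set E) : Prop :=
  (∀ x ∈ S, ∃ y ∈ T, dist x y ≤ δ) ∧ (∀ y ∈ T, ∃ x ∈ S, dist x y ≤ δ)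

/-- set-function version of the hypotheses -/
structure Good (m : Set E → ℂ) : Prop where
  empty : m ∅ = 0
  glue : ∀ A B, CC A → CC B → Convex ℝ (A ∪ B) → ∀ l : E →L[ℝ] ℝ, l ≠ 0 → ∀ c : ℝ,
    A ∩ B ⊆ {x | l x = c} → m (A ∪ B) = m A + m B
  flat : ∀ A, CC A → ∀ l : E →L[ℝ] ℝ, l ≠ 0 → ∀ c : ℝ, A ⊆ {x | l x = c} → m A = 0
  trans : ∀ A, CC A → ∀ x : E, m ({x} + A) = m A
  even : ∀ A, CC A → m (-A) = m A
  cont : ∀ A, CC A → A.Nonempty → ∀ ε > 0, ∃ δ > 0, ∀ B, CC B → B.Nonempty → Near δ A B →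
    ‖m A - m B‖ ≤ ε

lemma CC.add {A B : Set E} (hA : CC A) (hB : CC B) : CC (A + B) :=
  ⟨hA.1.add hB.1, hA.2.add hB.2⟩

lemma CC.neg {A : Set E} (hA : CC A) : CC (-A) := ⟨hA.1.neg, hA.2.neg⟩

lemma CC.smul {A : Set E} (hA : CC A) (t : ℝ) : CC (t • A) := ⟨hA.1.smul t, hA.2.smul t⟩

lemma CC.singleton (x : E) : CC ({x} : Set E) := ⟨convex_singleton x, isCompact_singleton⟩

lemma CC.segment (x y : E) : CC (segment ℝ x y) := by
  refine ⟨convex_segment x y, ?_⟩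
  rw [segment_eq_image']
  exact isCompact_Icc.image (by fun_prop)

lemma CC.inter {A C : Set E} (hA : CC A) (hC : Convex ℝ C) (hC' : IsClosed C) : CC (A ∩ C) :=
  ⟨hA.1.inter hC, hA.2.inter_right hC'⟩

lemma convex_le (l : E →L[ℝ] ℝ) (c : ℝ) : Convex ℝ {x | l x ≤ c} :=
  convex_halfSpace_le l.toLinearMap.isLinear c

lemma convex_ge (l : E →L[ℝ] ℝ) (c : ℝ) : Convex ℝ {x | c ≤ l x} :=
  convex_halfSpace_ge l.toLinearMap.isLinear c

lemma closed_le (l : E →L[ℝ] ℝ) (c : ℝ) : IsClosed {x | l x ≤ c} :=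
  isClosed_le l.continuous continuous_const

lemma closed_ge (l : E →L[ℝ] ℝ) (c : ℝ) : IsClosed {x | c ≤ l x} :=
  isClosed_le continuous_const l.continuous

lemma Near.add_right {δ : ℝ} {A B : Set E} (h : Near δ A B) (C : Set E) :
    Near δ (A + C) (B + C) := by
  constructor
  · rintro _ ⟨a, ha, c, hc, rfl⟩
    obtain ⟨b, hb, hab⟩ := h.1 a ha
    exact ⟨b + c, ⟨b, hb, c, hc, rfl⟩, by simpa using hab⟩
  · rintro _ ⟨b, hb, c, hc, rfl⟩
    obtain ⟨a, ha, hab⟩ := h.2 b hb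
    exact ⟨a + c, ⟨a, ha, c, hc, rfl⟩, by simpa using hab⟩

lemma Near.add_left {δ : ℝ} {A B : Set E} (h : Near δ A B) (C : Set E) :
    Near δ (C + A) (C + B) := by
  rw [add_comm C, add_comm C]; exact h.add_right C

lemma Near.symm {δ : ℝ} {A B : Set E} (h : Near δ A B) : Near δ B A :=
  ⟨fun x hx => by obtain ⟨y, hy, hd⟩ := h.2 x hx; exact ⟨y, hy, by rwa [dist_comm]⟩,
   fun x hx => by obtain ⟨y, hy, hd⟩ := h.1 x hx; exact ⟨y, hy, by rwa [dist_comm]⟩⟩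

lemma Near.mono {δ δ' : ℝ} {A B : Set E} (h : Near δ A B) (hd : δ ≤ δ') : Near δ' A B :=
  ⟨fun x hx => by obtain ⟨y, hy, h⟩ := h.1 x hx; exact ⟨y, hy, h.trans hd⟩,
   fun x hx => by obtain ⟨y, hy, h⟩ := h.2 x hx; exact ⟨y, hy, h.trans hd⟩⟩

variable {m : Set E → ℂ}

lemma Good.cut (hm : Good m) {S : Set E} (hS : CC S) {l : E →L[ℝ] ℝ} (hl : l ≠ 0) (c : ℝ) :
    m S = m (S ∩ {x | l x ≤ c}) + m (S ∩ {x | c ≤ l x}) := by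
  have hU : (S ∩ {x | l x ≤ c}) ∪ (S ∩ {x | c ≤ l x}) = S := by
    rw [← inter_union_distrib_left]
    apply inter_eq_left.2
    intro x _
    exact le_total (l x) c
  rw [← hm.glue _ _ (hS.inter (convex_le l c) (closed_le l c))
    (hS.inter (convex_ge l c) (closed_ge l c)) (by rw [hU]; exact hS.1) l hl c
    (fun x hx => le_antisymm hx.1.2 hx.2.2), hU]

/-- limit principle: equality of two expressions -/
lemma Good.lim_eq (hm : Good m) {A B : Set E} (hA : CC A) (hA' : A.Nonempty) (hB : CC B)
    (hB' : B.Nonempty)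
    (h : ∀ δ > 0, ∃ A' B', CC A' ∧ A'.Nonempty ∧ CC B' ∧ B'.Nonempty ∧ Near δ A A' ∧ Near δ B B' ∧
      m A' = m B') : m A = m B := by
  by_contra hne
  have hpos : 0 < ‖m A - m B‖ := norm_pos_iff.2 (sub_ne_zero.2 hne)
  obtain ⟨d1, h1, H1⟩ := hm.cont A hA hA' (‖m A - m B‖ / 4) (by positivity)
  obtain ⟨d2, h2, H2⟩ := hm.cont B hB hB' (‖m A - m B‖ / 4) (by positivity)
  obtain ⟨A', B', a1, a2, b1, b2, n1, n2, e⟩ := h (min d1 d2) (lt_min h1 h2)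
  have e1 := H1 A' a1 a2 (n1.mono (min_le_left _ _))
  have e2 := H2 B' b1 b2 (n2.mono (min_le_right _ _))
  have : m A - m B = (m A - m A') - (m B - m B') := by rw [e]; ring
  have h3 : ‖m A - m B‖ ≤ ‖m A - m A'‖ + ‖m B - m B'‖ := by
    rw [this]; exact norm_sub_le _ _
  linarith

lemma Good.lim_zero (hm : Good m) {A : Set E} (hA : CC A) (hA' : A.Nonempty)
    (h : ∀ δ > 0, ∃ A', CC A' ∧ A'.Nonempty ∧ Near δ A A' ∧ m A' = 0) : m A = 0 := by
  by_contra hne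
  have hpos : 0 < ‖m A‖ := norm_pos_iff.2 hne
  obtain ⟨d1, h1, H1⟩ := hm.cont A hA hA' (‖m A‖ / 4) (by positivity)
  obtain ⟨A', a1, a2, n1, e⟩ := h d1 h1
  have e1 := H1 A' a1 a2 n1
  rw [e, sub_zero] at e1
  linarith

lemma mem_seg {v x : E} : x ∈ segment ℝ 0 v ↔ ∃ t : ℝ, 0 ≤ t ∧ t ≤ 1 ∧ x = t • v := by
  rw [segment_eq_image']
  constructor
  · rintro ⟨t, ht, rfl⟩; exact ⟨t, ht.1, ht.2, by simp⟩
  · rintro ⟨t, h0, h1, rfl⟩; exact ⟨t, ⟨h0, h1⟩, by simp⟩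

lemma mem_add_seg {S : Set E} {v x : E} :
    x ∈ S + segment ℝ 0 v ↔ ∃ y ∈ S, ∃ t : ℝ, 0 ≤ t ∧ t ≤ 1 ∧ x = y + t • v := by
  constructor
  · rintro ⟨y, hy, z, hz, rfl⟩
    obtain ⟨t, h0, h1, rfl⟩ := mem_seg.1 hz
    exact ⟨y, hy, t, h0, h1, rfl⟩
  · rintro ⟨y, hy, t, h0, h1, rfl⟩
    exact ⟨y, hy, _, mem_seg.2 ⟨t, h0, h1, rfl⟩, rfl⟩

/-- cylinders over flat bases vanish -/
def Cyl (m : Set E → ℂ) : Prop :=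
  ∀ S, CC S → ∀ (l : E →L[ℝ] ℝ) (c : ℝ) (v : E), l v ≠ 0 → S ⊆ {x | l x = c} →
    m (S + segment ℝ 0 v) = 0

/-- `v`-invariant closed convex sets -/
def Inv (v : E) (C : Set E) : Prop :=
  Convex ℝ C ∧ IsClosed C ∧ ∀ x ∈ C, ∀ t : ℝ, x + t • v ∈ C

lemma inv_le {v : E} {C : Set E} (hC : Inv v C) (l : E →L[ℝ] ℝ) (hl : l v = 0) (c : ℝ) :
    Inv v (C ∩ {x | l x ≤ c}) :=
  ⟨hC.1.inter (convex_le l c), hC.2.1.inter (closed_le l c), fun x hx t =>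
    ⟨hC.2.2 x hx.1 t, by have := hx.2; simp only [mem_ofPred_eq] at *; simpa [hl] using this⟩⟩

lemma inv_ge {v : E} {C : Set E} (hC : Inv v C) (l : E →L[ℝ] ℝ) (hl : l v = 0) (c : ℝ) :
    Inv v (C ∩ {x | c ≤ l x}) :=
  ⟨hC.1.inter (convex_ge l c), hC.2.1.inter (closed_ge l c), fun x hx t =>
    ⟨hC.2.2 x hx.1 t, by have := hx.2; simp only [mem_ofPred_eq] at *; simpa [hl] using this⟩⟩

lemma add_seg_inter {S C : Set E} {v : E} (hC : ∀ x ∈ C, ∀ t : ℝ, x + t • v ∈ C) :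
    (S ∩ C) + segment ℝ 0 v = (S + segment ℝ 0 v) ∩ C := by
  ext x
  simp only [mem_inter_iff, mem_add_seg]
  constructor
  · rintro ⟨y, ⟨hy, hy'⟩, t, h0, h1, rfl⟩
    exact ⟨⟨y, hy, t, h0, h1, rfl⟩, hC y hy' t⟩
  · rintro ⟨⟨y, hy, t, h0, h1, rfl⟩, hx⟩
    refine ⟨y, ⟨hy, ?_⟩, t, h0, h1, rfl⟩
    have := hC _ hx (-t)
    simpa using this

/-- additivity of the increment under cuts parallel to `v` -/
lemma Good.delta_cut (hm : Good m) {S : Set E} (hS : CC S) {v : E} {l : E →L[ℝ] ℝ} (hl : l ≠ 0)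
    (hlv : l v = 0) (c : ℝ)
    (h1 : m (S ∩ {x | l x ≤ c} + segment ℝ 0 v) = m (S ∩ {x | l x ≤ c}))
    (h2 : m (S ∩ {x | c ≤ l x} + segment ℝ 0 v) = m (S ∩ {x | c ≤ l x})) :
    m (S + segment ℝ 0 v) = m S := by
  rw [hm.cut (hS.add (CC.segment 0 v)) hl c, hm.cut hS hl c, ← h1, ← h2, add_seg_inter,
    add_seg_inter]
  · intro x hx t; simp only [mem_ofPred_eq] at *; simpa [hlv] using hx
  · intro x hx t; simp only [mem_ofPred_eq] at *; simpa [hlv] using hx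

lemma Good.pieces (hm : Good m) {v : E} {K : Set E} (hK : CC K)
    (L : List ((E →L[ℝ] ℝ) × ℝ)) (hL : ∀ p ∈ L, p.1 v = 0) :
    ∀ C, Inv v C →
    (∀ C', Inv v C' → C' ⊆ C →
      (∀ p ∈ L, (∀ x ∈ C', p.1 x ≤ p.2) ∨ (∀ x ∈ C', p.2 ≤ p.1 x)) →
      m (K ∩ C' + segment ℝ 0 v) = m (K ∩ C')) →
    m (K ∩ C + segment ℝ 0 v) = m (K ∩ C) := by
  induction L with
  | nil => intro C hC h; exact h C hC le_rfl (by simp)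
  | cons p L ih =>
    intro C hC h
    have hpv : p.1 v = 0 := hL p (by simp)
    have hL' : ∀ q ∈ L, q.1 v = 0 := fun q hq => hL q (by simp [hq])
    by_cases hp : p.1 = 0
    · refine ih hL' C hC (fun C' hC' hsub hs => h C' hC' hsub ?_)
      intro q hq
      rcases List.mem_cons.1 hq with rfl | hq
      · rw [hp]
        rcases le_total 0 q.2 with h0 | h0
        · left; intro x _; simpa using h0
        · right; intro x _; simpa using h0
      · exact hs q hq
    · apply hm.delta_cut (hK.inter hC.1 hC.2.1) hp hpv p.2
      · rw [inter_assoc]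
        refine ih hL' _ (inv_le hC _ hpv _) (fun C' hC' hsub hs => h C' hC'
          (hsub.trans inter_subset_left) ?_)
        intro q hq
        rcases List.mem_cons.1 hq with rfl | hq
        · left; intro x hx; exact (hsub hx).2
        · exact hs q hq
      · rw [inter_assoc]
        refine ih hL' _ (inv_ge hC _ hpv _) (fun C' hC' hsub hs => h C' hC'
          (hsub.trans inter_subset_left) ?_)
        intro q hq
        rcases List.mem_cons.1 hq with rfl | hq
        · right; intro x hx; exact (hsub hx).2
        · exact hs q hq

/-- the polyhedron given by a finite set of half-spaces -/
def Poly (s : Finset ((E →L[ℝ] ℝ) × ℝ)) : Set E := {x | ∀ p ∈ s, p.1 x ≤ p.2}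

lemma poly_convex (s : Finset ((E →L[ℝ] ℝ) × ℝ)) : Convex ℝ (Poly s) := by
  have : Poly s = ⋂ p ∈ s, {x | p.1 x ≤ p.2} := by ext; simp [Poly]
  rw [this]
  exact convex_iInter₂ fun p _ => convex_le _ _

lemma poly_closed (s : Finset ((E →L[ℝ] ℝ) × ℝ)) : IsClosed (Poly s) := by
  have : Poly s = ⋂ p ∈ s, {x | p.1 x ≤ p.2} := by ext; simp [Poly]
  rw [this]
  exact isClosed_biInter fun p _ => closed_le _ _

lemma exists_upper {s : Finset ((E →L[ℝ] ℝ) × ℝ)} (hc : IsCompact (Poly s)) (hne : (Poly s).Nonempty)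
    {v : E} (hv : v ≠ 0) : ∃ p ∈ s, 0 < p.1 v := by
  by_contra! h
  obtain ⟨x, hx⟩ := hne
  obtain ⟨R, hR⟩ := hc.isBounded.subset_closedBall x
  have hpos : 0 < ‖v‖ := norm_pos_iff.2 hv
  have : x + ((|R| + 1) / ‖v‖) • v ∈ Poly s := by
    intro p hp
    have h1 := hx p hp
    have h2 := h p hp
    have h3 : 0 ≤ (|R| + 1) / ‖v‖ := by positivity
    simp only [map_add, map_smul, smul_eq_mul]
    nlinarith
  have := hR this
  rw [mem_closedBall, dist_eq_norm, add_sub_cancel_left, norm_smul, Real.norm_eq_abs,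
    abs_of_nonneg (by positivity), div_mul_cancel₀ _ hpos.ne'] at this
  linarith [le_abs_self R]

lemma Good.poly_add_seg (hm : Good m) (hcyl : Cyl m) {s : Finset ((E →L[ℝ] ℝ) × ℝ)}
    (hc : IsCompact (Poly s)) (hne : (Poly s).Nonempty) (v : E) :
    m (Poly s + segment ℝ 0 v) = m (Poly s) := by
  classical
  rcases eq_or_ne v 0 with rfl | hv
  · simp
  set U := s.filter (fun p => 0 < p.1 v) with hU
  have hUne : U.Nonempty := by
    obtain ⟨p, hp, hpv⟩ := exists_upper hc hne hv
    exact ⟨p, by simp [hU, hp, hpv]⟩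
  have hUpos : ∀ p ∈ U, 0 < p.1 v := fun p hp => (Finset.mem_filter.1 hp).2
  set L : List ((E →L[ℝ] ℝ) × ℝ) := (U ×ˢ U).toList.map (fun q =>
    ((q.1.1 v)⁻¹ • q.1.1 - (q.2.1 v)⁻¹ • q.2.1, q.1.2 / q.1.1 v - q.2.2 / q.2.1 v)) with hLdef
  have hL : ∀ p ∈ L, p.1 v = 0 := by
    intro p hp
    rw [hLdef, List.mem_map] at hp
    obtain ⟨q, hq, rfl⟩ := hp
    rw [Finset.mem_toList, Finset.mem_product] at hq
    have h1 := (hUpos _ hq.1).ne'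
    have h2 := (hUpos _ hq.2).ne'
    simp [h1, h2]
  have hCC : CC (Poly s) := ⟨poly_convex s, hc⟩
  have key := hm.pieces hCC L hL univ ⟨convex_univ, isClosed_univ, by simp⟩
  rw [inter_univ] at key
  apply key
  intro C hC _ hs
  -- the height functions
  set f : ((E →L[ℝ] ℝ) × ℝ) → E → ℝ := fun p x => (p.2 - p.1 x) / p.1 v with hf
  have htot : ∀ p ∈ U, ∀ q ∈ U, (∀ x ∈ C, f p x ≤ f q x) ∨ (∀ x ∈ C, f q x ≤ f p x) := by
    intro p hp q hq
    have := hs _ (List.mem_map.2 ⟨(p, q), by simp [hp, hq], rfl⟩)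
    have h1 := (hUpos _ hp).ne'
    have h2 := (hUpos _ hq).ne'
    have e : ∀ x, f p x - f q x = (p.2 / p.1 v - q.2 / q.1 v) -
        ((p.1 v)⁻¹ • p.1 - (q.1 v)⁻¹ • q.1) x := by
      intro x
      simp only [hf, sub_apply, smul_apply, smul_eq_mul]
      field_simp
      ring
    rcases this with h | h
    · right; intro x hx; have := h x hx; have := e x; linarith
    · left; intro x hx; have := h x hx; have := e x; linarith
  have hmin : ∃ p ∈ U, ∀ q ∈ U, ∀ x ∈ C, f p x ≤ f q x := by
    clear key hLdef hL hs hU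
    have : ∀ T : Finset ((E →L[ℝ] ℝ) × ℝ), T.Nonempty → T ⊆ U →
        ∃ p ∈ T, ∀ q ∈ T, ∀ x ∈ C, f p x ≤ f q x := by
      intro T hT
      induction hT using Finset.Nonempty.cons_induction with
      | singleton a => intro _; exact ⟨a, by simp, by simp⟩
      | cons a T ha hT ih =>
        intro hsub
        obtain ⟨p, hp, hp'⟩ := ih (fun x hx => hsub (by simp [hx]))
        rcases htot a (hsub (by simp)) p (hsub (by simp [hp])) with h | h
        · refine ⟨a, by simp, fun q hq x hx => ?_⟩
          rcases Finset.mem_cons.1 hq with rfl | hq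
          · exact le_rfl
          · exact (h x hx).trans (hp' q hq x hx)
        · refine ⟨p, by simp [hp], fun q hq x hx => ?_⟩
          rcases Finset.mem_cons.1 hq with rfl | hq
          · exact h x hx
          · exact hp' q hq x hx
    exact this U hUne le_rfl
  obtain ⟨p, hpU, hpmin⟩ := hmin
  have hps : p ∈ s := (Finset.mem_filter.1 hpU).1
  have hpv := hUpos p hpU
  set K := Poly s ∩ C with hKdef
  have hK : CC K := hCC.inter hC.1 hC.2.1
  set F := K ∩ ({x | p.1 x ≤ p.2} ∩ {x | p.2 ≤ p.1 x}) with hFdef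
  have hF : CC F := hK.inter ((convex_le _ _).inter (convex_ge _ _))
    ((closed_le _ _).inter (closed_ge _ _))
  have hstay : ∀ x ∈ K, ∀ t, 0 ≤ t → t ≤ f p x → x + t • v ∈ K := by
    intro x hx t h0 ht
    refine ⟨fun q hq => ?_, hC.2.2 x hx.2 t⟩
    have hxq := hx.1 q hq
    simp only [map_add, map_smul, smul_eq_mul]
    rcases lt_or_ge 0 (q.1 v) with hqv | hqv
    · have h3 := ht.trans (hpmin q (by simp [hU, hq, hqv]) x hx.2)
      rw [hf] at h3
      simp only at h3
      rw [le_div_iff₀ hqv] at h3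
      linarith
    · nlinarith
  have hunion : K + segment ℝ 0 v = K ∪ (F + segment ℝ 0 v) := by
    ext x
    simp only [mem_union, mem_add_seg]
    constructor
    · rintro ⟨y, hy, t, h0, h1, rfl⟩
      rcases le_or_gt t (f p y) with h | h
      · left; exact hstay y hy t h0 h
      · right
        have hfy : 0 ≤ f p y := by
          have := hy.1 p hps
          exact div_nonneg (by linarith) hpv.le
        have hval : p.1 (y + f p y • v) = p.2 := by
          simp only [map_add, map_smul, smul_eq_mul, hf]
          field_simp
          ring
        refine ⟨y + f p y • v, ⟨hstay y hy _ hfy le_rfl, hval.le, hval.ge⟩, t - f p y,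
          by linarith, by linarith, ?_⟩
        rw [add_assoc, ← add_smul]; congr 2; ring
    · rintro (h | ⟨y, hy, t, h0, h1, rfl⟩)
      · exact ⟨x, h, 0, le_rfl, zero_le_one, by simp⟩
      · exact ⟨y, hy.1, t, h0, h1, rfl⟩
  have hconv : Convex ℝ (K ∪ (F + segment ℝ 0 v)) := by
    rw [← hunion]; exact (hK.add (CC.segment 0 v)).1
  have hl0 : p.1 ≠ 0 := by intro h; rw [h] at hpv; simp at hpv
  rw [hunion, hm.glue K (F + segment ℝ 0 v) hK (hF.add (CC.segment 0 v)) hconv p.1 hl0 p.2 ?_,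
    hcyl F hF p.1 p.2 v hpv.ne' (fun x hx => le_antisymm hx.2.1 hx.2.2), add_zero]
  rintro x ⟨hxK, hxF⟩
  refine le_antisymm (hxK.1 p hps) ?_
  obtain ⟨y, hy, t, h0, h1, rfl⟩ := mem_add_seg.1 hxF
  have := hy.2.2
  simp only [map_add, map_smul, smul_eq_mul, mem_ofPred_eq] at *
  nlinarith

end Basics
end Klain

namespace Klain

section Density

variable {E : Type*} [NormedAddCommGroup E] [NormedSpace ℝ E] [FiniteDimensional ℝ E]

lemma exists_poly {K : Set E} (hK : CC K) (hne : K.Nonempty) {ε : ℝ} (hε : 0 < ε) :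
    ∃ s : Finset ((E →L[ℝ] ℝ) × ℝ), (∀ p ∈ s, p.1 ≠ 0) ∧ K ⊆ Poly s ∧ IsCompact (Poly s) ∧
      ∀ x ∈ Poly s, ∃ y ∈ K, dist x y ≤ ε := by
  classical
  have : ProperSpace E := FiniteDimensional.proper ℝ E
  have hcont : Continuous (fun x => infDist x K) := continuous_infDist_pt K
  set D : Set E := {x | infDist x K = ε} with hD
  have hthick : ∀ x, infDist x K ≤ ε → x ∈ cthickening ε K := by
    intro x hx
    obtain ⟨y, hy, hxy⟩ := hK.2.exists_infDist_eq_dist hne x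
    exact mem_cthickening_of_dist_le x y ε K hy (hxy ▸ hx)
  have hDc : IsCompact D := by
    refine Metric.isCompact_of_isClosed_isBounded (isClosed_eq hcont continuous_const) ?_
    refine (hK.2.isBounded.cthickening (δ := ε)).subset ?_
    intro x hx
    exact hthick x (le_of_eq hx)
  have hsep : ∀ x ∈ D, ∃ p : (E →L[ℝ] ℝ) × ℝ, (∀ a ∈ K, p.1 a < p.2) ∧ p.2 < p.1 x := by
    intro x hx
    have hxK : x ∉ K := by
      intro h
      have : infDist x K = ε := hx
      rw [infDist_zero_of_mem h] at this
      linarith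
    obtain ⟨f, u, h1, h2⟩ := geometric_hahn_banach_closed_point hK.1 hK.2.isClosed hxK
    exact ⟨(f, u), h1, h2⟩
  choose! P hP1 hP2 using hsep
  obtain ⟨t, htD, hcov⟩ := hDc.elim_nhds_subcover (fun x => {y | (P x).2 < (P x).1 y})
    (fun x hx => (isOpen_lt continuous_const (P x).1.continuous).mem_nhds (hP2 x hx))
  set s := t.image P with hs
  have hKs : K ⊆ Poly s := by
    intro x hx p hp
    obtain ⟨y, hy, rfl⟩ := Finset.mem_image.1 hp
    exact (hP1 y (htD y hy) x hx).le
  have hnear : ∀ x ∈ Poly s, infDist x K ≤ ε := by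
    intro x hx
    by_contra! hlt
    obtain ⟨k, hk⟩ := hne
    have hc : ContinuousOn (fun r : ℝ => infDist (AffineMap.lineMap k x r) K) (Icc 0 1) := by
      apply Continuous.continuousOn
      exact hcont.comp (AffineMap.lineMap_continuous)
    have hmem : ε ∈ Icc (infDist (AffineMap.lineMap k x (0:ℝ)) K)
        (infDist (AffineMap.lineMap k x (1:ℝ)) K) := by
      simp only [AffineMap.lineMap_apply_zero, AffineMap.lineMap_apply_one]
      rw [infDist_zero_of_mem hk]
      exact ⟨hε.le, hlt.le⟩
    obtain ⟨r, hr, hre⟩ := intermediate_value_Icc zero_le_one hc hmem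
    have hyP : AffineMap.lineMap k x r ∈ Poly s :=
      (poly_convex s).lineMap_mem (hKs hk) hx hr
    have hyD : AffineMap.lineMap k x r ∈ D := hre
    have := hcov hyD
    simp only [mem_iUnion] at this
    obtain ⟨z, hz, hz'⟩ := this
    have h2 := hyP (P z) (Finset.mem_image_of_mem P hz)
    have hz'' : (P z).2 < (P z).1 (AffineMap.lineMap k x r) := hz'
    linarith
  refine ⟨s, ?_, hKs, ?_, ?_⟩
  · intro p hp h0
    obtain ⟨y, hy, rfl⟩ := Finset.mem_image.1 hp
    obtain ⟨k, hk⟩ := hne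
    have h1 := hP1 y (htD y hy) k hk
    have h2 := hP2 y (htD y hy)
    rw [h0] at h1 h2
    simp at h1 h2
    linarith
  · refine Metric.isCompact_of_isClosed_isBounded (poly_closed s) ?_
    refine (hK.2.isBounded.cthickening (δ := ε)).subset ?_
    intro x hx
    exact hthick x (hnear x hx)
  · intro x hx
    obtain ⟨y, hy, hxy⟩ := hK.2.exists_infDist_eq_dist hne x
    exact ⟨y, hy, hxy ▸ hnear x hx⟩

lemma exists_poly_near {K : Set E} (hK : CC K) (hne : K.Nonempty) {ε : ℝ} (hε : 0 < ε) :
    ∃ s : Finset ((E →L[ℝ] ℝ) × ℝ), (∀ p ∈ s, p.1 ≠ 0) ∧ (Poly s).Nonempty ∧ IsCompact (Poly s) ∧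
      Near ε K (Poly s) := by
  obtain ⟨s, h1, h2, h3, h4⟩ := exists_poly hK hne hε
  refine ⟨s, h1, hne.mono h2, h3, fun x hx => ⟨x, h2 hx, by simp [hε.le]⟩, fun y hy => ?_⟩
  obtain ⟨x, hx, h⟩ := h4 y hy
  exact ⟨x, hx, by rwa [dist_comm]⟩

variable {m : Set E → ℂ}

lemma Good.add_seg (hm : Good m) (hcyl : Cyl m) {K : Set E} (hK : CC K) (hne : K.Nonempty) (v : E) :
    m (K + segment ℝ 0 v) = m K := by
  have hsne : (segment ℝ 0 v).Nonempty := ⟨0, left_mem_segment ℝ 0 v⟩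
  apply hm.lim_eq (hK.add (CC.segment 0 v)) (hne.add hsne) hK hne
  intro δ hδ
  obtain ⟨s, h1, h2, h3, h4⟩ := exists_poly_near hK hne hδ
  have hs : CC (Poly s) := ⟨poly_convex s, h3⟩
  exact ⟨Poly s + segment ℝ 0 v, Poly s, hs.add (CC.segment 0 v), h2.add hsne, hs, h2,
    h4.add_right _, h4, hm.poly_add_seg hcyl h3 h2 v⟩

/-- all symmetric bodies vanish -/
def SymZero (m : Set E → ℂ) : Prop := ∀ S, CC S → S.Nonempty → -S = S → m S = 0

/-- the symmetric cylinder -/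
def Qc (l : E →L[ℝ] ℝ) (v : E) (r R : ℝ) : Set E :=
  {x | (-R ≤ l x ∧ l x ≤ R) ∧ ‖x - l x • v‖ ≤ r}

lemma Qc_CC (l : E →L[ℝ] ℝ) (v : E) (r R : ℝ) : CC (Qc l v r R) := by
  have : ProperSpace E := FiniteDimensional.proper ℝ E
  have e : Qc l v r R = ({x | l x ≤ R} ∩ {x | -R ≤ l x}) ∩
      (ContinuousLinearMap.id ℝ E - l.smulRight v) ⁻¹' (closedBall 0 r) := by
    ext x; simp [Qc]; tauto
  have hcl : IsClosed (Qc l v r R) := by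
    rw [e]
    exact ((closed_le _ _).inter (closed_ge _ _)).inter
      (isClosed_closedBall.preimage (ContinuousLinearMap.continuous _))
  refine ⟨?_, Metric.isCompact_of_isClosed_isBounded hcl ?_⟩
  · rw [e]
    exact ((convex_le _ _).inter (convex_ge _ _)).inter
      ((convex_closedBall 0 r).linear_preimage
        (ContinuousLinearMap.id ℝ E - l.smulRight v).toLinearMap)
  · rw [isBounded_iff_forall_norm_le]
    refine ⟨r + |R| * ‖v‖, ?_⟩
    rintro x ⟨⟨h1, h2⟩, h3⟩
    have h4 : ‖x‖ ≤ ‖x - l x • v‖ + ‖l x • v‖ := by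
      have := norm_add_le (x - l x • v) (l x • v)
      simpa using this
    have h5 : ‖l x • v‖ ≤ |R| * ‖v‖ := by
      rw [norm_smul, Real.norm_eq_abs]
      have : |l x| ≤ |R| := by
        rw [abs_le]; constructor <;> linarith [le_abs_self R]
      exact mul_le_mul_of_nonneg_right this (norm_nonneg _)
    linarith

/-- downward closed closed convex sets containing the bottom of the cylinder -/
structure Down (l : E →L[ℝ] ℝ) (v : E) (r R : ℝ) (A : Set E) : Prop where
  conv : Convex ℝ A
  clos : IsClosed A
  down : ∀ x ∈ A, ∀ t : ℝ, 0 ≤ t → x - t • v ∈ A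
  bot : ∀ x, l x = -R → ‖x - l x • v‖ ≤ r → x ∈ A

lemma Good.stalactite (hm : Good m) (hsym : SymZero m) {l : E →L[ℝ] ℝ} {v : E} (hlv : l v = 1)
    {r R : ℝ} (hR : 0 ≤ R) {A : Set E} (hA : Down l v r R A) : m (A ∩ Qc l v r R) = 0 := by
  set L := A ∩ Qc l v r R with hL
  have hLC : CC L := by
    rw [hL, inter_comm]; exact (Qc_CC l v r R).inter hA.conv hA.clos
  rcases L.eq_empty_or_nonempty with h0 | hne
  · rw [h0]; exact hm.empty
  have hl0 : l ≠ 0 := by intro h; rw [h] at hlv; simp at hlv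
  set L' : Set E := {(-(2 * R)) • v} + -L with hL'
  have hL'C : CC L' := (CC.singleton _).add hLC.neg
  have memL' : ∀ x, x ∈ L' ↔ (-(2 * R)) • v - x ∈ L := by
    intro x
    rw [hL', singleton_add]
    constructor
    · rintro ⟨y, hy, rfl⟩
      have : (-(2 * R)) • v - ((-(2 * R)) • v + y) = -y := by abel
      simp only [this]
      exact hy
    · intro h
      exact ⟨x - (-(2 * R)) • v, by simpa [sub_eq_add_neg] using h, by simp⟩
  have refl2 : ∀ x, (-(2 * R)) • v - ((-(2 * R)) • v - x) = x := by intro x; abel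
  have key : ∀ x ∈ L, ∀ y ∈ L', ∀ a b : ℝ, 0 ≤ a → 0 ≤ b → a + b = 1 →
      -R ≤ l (a • x + b • y) → a • x + b • y ∈ L := by
    intro x hx y hy a b ha hb hab hz
    have hy' := (memL' y).1 hy
    have hly : l y ≤ -R := by
      have := hy'.2.1.1
      simp only [map_sub, map_smul, smul_eq_mul, hlv] at this
      linarith
    have hpy : ‖y - l y • v‖ ≤ r := by
      have := hy'.2.2
      rw [map_sub, map_smul, smul_eq_mul, hlv] at this
      have e : (-(2 * R)) • v - y - (-(2 * R) * 1 - l y) • v = -(y - l y • v) := by module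
      rwa [e, norm_neg] at this
    set y0 := y + (-R - l y) • v with hy0
    have hly0 : l y0 = -R := by simp [hy0, hlv]
    have hpy0 : y0 - l y0 • v = y - l y • v := by
      rw [hly0, hy0]; module
    have hy0L : y0 ∈ L := ⟨hA.bot y0 hly0 (by rw [hpy0]; exact hpy),
      ⟨by rw [hly0]; constructor <;> linarith, by rw [hpy0]; exact hpy⟩⟩
    have hw : a • x + b • y0 ∈ L := hLC.1 hx hy0L ha hb hab
    have e : a • x + b • y = (a • x + b • y0) - (b * (-R - l y)) • v := by
      rw [hy0]; module
    have hnn : 0 ≤ b * (-R - l y) := mul_nonneg hb (by linarith)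
    refine ⟨?_, ⟨hz, ?_⟩, ?_⟩
    · rw [e]; exact hA.down _ hw.1 _ hnn
    · have h1 := hw.2.1.2
      rw [e, map_sub, map_smul, smul_eq_mul, hlv]
      linarith
    · have h1 := hw.2.2
      convert h1 using 2
      rw [e]
      simp only [map_sub, map_smul, smul_eq_mul, hlv]
      module
  have key2 : ∀ x ∈ L, ∀ y ∈ L', ∀ a b : ℝ, 0 ≤ a → 0 ≤ b → a + b = 1 →
      a • x + b • y ∈ L ∪ L' := by
    intro x hx y hy a b ha hb hab
    rcases le_total (-R) (l (a • x + b • y)) with h | h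
    · left; exact key x hx y hy a b ha hb hab h
    · right
      rw [memL']
      have hx' : (-(2 * R)) • v - x ∈ L' := by rw [memL', refl2]; exact hx
      have hy' := (memL' y).1 hy
      have e : (-(2 * R)) • v - (a • x + b • y) =
          b • ((-(2 * R)) • v - y) + a • ((-(2 * R)) • v - x) := by
        have ha' : a = 1 - b := by linarith
        rw [ha']; module
      rw [e]
      apply key _ hy' _ hx' b a hb ha (by linarith)
      rw [← e, map_sub, map_smul, smul_eq_mul, hlv]
      linarith
  have hconv : Convex ℝ (L ∪ L') := by
    intro x hx y hy a b ha hb hab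
    rcases hx with hx | hx <;> rcases hy with hy | hy
    · left; exact hLC.1 hx hy ha hb hab
    · exact key2 x hx y hy a b ha hb hab
    · rw [add_comm]; exact key2 y hy x hx b a hb ha (by linarith)
    · right; exact hL'C.1 hx hy ha hb hab
  have hW : CC (L ∪ L') := ⟨hconv, hLC.2.union hL'C.2⟩
  have hglue := hm.glue L L' hLC hL'C hconv l hl0 (-R) (by
    rintro x ⟨h1, h2⟩
    have h3 := ((memL' x).1 h2).2.1.1
    simp only [map_sub, map_smul, smul_eq_mul, hlv] at h3
    exact le_antisymm (by linarith) h1.2.1.1)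
  have hmL' : m L' = m L := by rw [hL', hm.trans _ hLC.neg, hm.even _ hLC]
  have hzero : m (L ∪ L') = 0 := by
    rw [← hm.trans _ hW (R • v)]
    apply hsym _ ((CC.singleton _).add hW) ((singleton_nonempty _).add (hne.mono subset_union_left))
    have hh : ∀ x, x ∈ ({R • v} : Set E) + (L ∪ L') ↔ x - R • v ∈ L ∪ L' := by
      intro x
      rw [singleton_add]
      constructor
      · rintro ⟨y, hy, rfl⟩; simpa using hy
      · intro h; exact ⟨_, h, by simp⟩
    have hs : ∀ x, x ∈ L ∪ L' → (-(2 * R)) • v - x ∈ L ∪ L' := by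
      rintro x (h | h)
      · right; rw [memL', refl2]; exact h
      · left; exact (memL' x).1 h
    ext x
    rw [mem_neg, hh, hh]
    constructor
    · intro h
      have := hs _ h
      convert this using 1
      module
    · intro h
      have := hs _ h
      convert this using 1
      module
  rw [hzero, hmL'] at hglue
  have : 2 * m L = 0 := by rw [two_mul]; exact hglue.symm
  simpa using this

lemma Good.lower (hm : Good m) (hsym : SymZero m) {l : E →L[ℝ] ℝ} {v : E} (hlv : l v = 1)
    {r R : ℝ} (hR : 0 ≤ R) (W : List ((E →L[ℝ] ℝ) × ℝ))
    (hW : ∀ p ∈ W, p.1 ≠ 0 ∧ p.1 v ≤ 0 ∧ ∀ x, l x = -R → ‖x - l x • v‖ ≤ r → p.2 ≤ p.1 x) :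
    ∀ A, Down l v r R A → m ((A ∩ Qc l v r R) ∩ {x | ∀ p ∈ W, p.1 x ≤ p.2}) = 0 := by
  induction W with
  | nil => intro A hA; simpa using hm.stalactite hsym hlv hR hA
  | cons p W ih =>
    intro A hA
    have hW' : ∀ q ∈ W, q.1 ≠ 0 ∧ q.1 v ≤ 0 ∧ ∀ x, l x = -R → ‖x - l x • v‖ ≤ r → q.2 ≤ q.1 x :=
      fun q hq => hW q (by simp [hq])
    obtain ⟨hp0, hpv, hpb⟩ := hW p (by simp)
    have h1 := ih hW' A hA
    have hA' : Down l v r R (A ∩ {x | p.2 ≤ p.1 x}) := by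
      refine ⟨hA.conv.inter (convex_ge _ _), hA.clos.inter (closed_ge _ _), ?_, ?_⟩
      · rintro x ⟨hx, hx'⟩ t ht
        refine ⟨hA.down x hx t ht, ?_⟩
        simp only [mem_ofPred_eq, map_sub, map_smul, smul_eq_mul] at *
        nlinarith
      · intro x hx hx'
        exact ⟨hA.bot x hx hx', hpb x hx hx'⟩
    have h2 := ih hW' _ hA'
    have hSC : CC ((A ∩ Qc l v r R) ∩ {x | ∀ p ∈ W, p.1 x ≤ p.2}) := by
      have e : {x | ∀ p ∈ W, p.1 x ≤ p.2} = ⋂ p ∈ W, {x : E | p.1 x ≤ p.2} := by ext; simp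
      rw [inter_comm A]
      refine ((Qc_CC l v r R).inter hA.conv hA.clos).inter ?_ ?_
      · rw [e]; exact convex_iInter₂ fun p _ => convex_le _ _
      · rw [e]; exact isClosed_biInter fun p _ => closed_le _ _
    have h3 := hm.cut hSC hp0 p.2
    have e1 : A ∩ Qc l v r R ∩ {x | ∀ q ∈ p :: W, q.1 x ≤ q.2} =
      ((A ∩ Qc l v r R) ∩ {x | ∀ p ∈ W, p.1 x ≤ p.2}) ∩ {x | p.1 x ≤ p.2} := by
      ext x; simp; tauto
    have e2 : ((A ∩ Qc l v r R) ∩ {x | ∀ p ∈ W, p.1 x ≤ p.2}) ∩ {x | p.2 ≤ p.1 x} =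
      ((A ∩ {x | p.2 ≤ p.1 x}) ∩ Qc l v r R) ∩ {x | ∀ p ∈ W, p.1 x ≤ p.2} := by
      ext x; simp; tauto
    rw [e2, h2, h1, ← e1, add_zero] at h3
    exact h3.symm

lemma exists_generic [Nontrivial E] (s : Finset ((E →L[ℝ] ℝ) × ℝ)) (hs : ∀ p ∈ s, p.1 ≠ 0) :
    ∃ v : E, v ≠ 0 ∧ ∀ p ∈ s, p.1 v ≠ 0 := by
  classical
  set T : Finset (Subspace ℝ E) := insert ⊥ (s.image (fun p => p.1.toLinearMap.ker)) with hT
  have htop : ⊤ ∉ T := by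
    intro h
    rcases Finset.mem_insert.1 h with h | h
    · exact top_ne_bot h
    · obtain ⟨p, hp, h⟩ := Finset.mem_image.1 h
      apply hs p hp
      ext x
      have : x ∈ p.1.toLinearMap.ker := by rw [h]; trivial
      simpa using this
  have hne := Subspace.biUnion_ne_univ_of_top_notMem htop
  obtain ⟨v, hv⟩ := (ne_univ_iff_exists_notMem _).1 hne
  simp only [mem_iUnion, not_exists] at hv
  refine ⟨v, ?_, fun p hp h => ?_⟩
  · rintro rfl; exact hv ⊥ (by simp [hT]) (by simp)
  · exact hv p.1.toLinearMap.ker (Finset.mem_insert_of_mem (Finset.mem_image_of_mem _ hp)) (by simpa using h)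

lemma Good.poly_zero [Nontrivial E] (hm : Good m) (hsym : SymZero m)
    (s : Finset ((E →L[ℝ] ℝ) × ℝ)) (hs : ∀ p ∈ s, p.1 ≠ 0) (hc : IsCompact (Poly s)) :
    m (Poly s) = 0 := by
  classical
  obtain ⟨v, hv0, hv⟩ := exists_generic s hs
  obtain ⟨l, hl⟩ : ∃ l : E →L[ℝ] ℝ, l v = 1 := by
    obtain ⟨f, hf⟩ := SeparatingDual.exists_eq_one (R := ℝ) hv0
    exact ⟨f, hf⟩
  obtain ⟨M, hM⟩ := (isBounded_iff_forall_norm_le).1 hc.isBounded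
  set r := |M| + ‖l‖ * |M| * ‖v‖ with hr
  have hr0 : 0 ≤ r := by positivity
  have hev : ∀ p ∈ s, ∀ᶠ R : ℝ in Filter.atTop, ∀ x, l x = -R → ‖x - l x • v‖ ≤ r →
      (0 < p.1 v → p.1 x ≤ p.2) ∧ (p.1 v < 0 → p.2 ≤ p.1 x) := by
    intro p hp
    filter_upwards [Filter.eventually_ge_atTop ((|p.2| + ‖p.1‖ * r) / |p.1 v|)] with R hR x hx hxr
    have hpv : 0 < |p.1 v| := abs_pos.2 (hv p hp)
    rw [div_le_iff₀ hpv] at hR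
    have e : p.1 x = p.1 (x - l x • v) + -R * p.1 v := by
      rw [hx]; simp
    have h1 : |p.1 (x - l x • v)| ≤ ‖p.1‖ * r :=
      (p.1.le_opNorm _).trans (mul_le_mul_of_nonneg_left hxr (norm_nonneg _))
    have h2 := abs_le.1 h1
    have h3 := le_abs_self p.2
    have h4 := neg_abs_le p.2
    constructor
    · intro h; rw [abs_of_pos h] at hR; rw [e]; linarith [h2.2]
    · intro h; rw [abs_of_neg h] at hR; rw [e]; linarith [h2.1]
  obtain ⟨R, hR1, hR2, hR3⟩ := (((Filter.eventually_all_finset s).2 hev).and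
    ((Filter.eventually_ge_atTop (‖l‖ * |M|)).and (Filter.eventually_ge_atTop 0))).exists
  set Up := s.filter (fun p => 0 < p.1 v) with hUp
  set Lo := s.filter (fun p => p.1 v < 0) with hLo
  have hDown : Down l v r R (Poly Up) := by
    refine ⟨poly_convex _, poly_closed _, ?_, ?_⟩
    · intro x hx t ht p hp
      have h1 := hx p hp
      have h2 := (Finset.mem_filter.1 hp).2
      simp only [map_sub, map_smul, smul_eq_mul]
      nlinarith
    · intro x hx hx' p hp
      have h2 := Finset.mem_filter.1 hp
      exact (hR1 p h2.1 x hx hx').1 h2.2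
  have := hm.lower hsym hl hR3 Lo.toList (by
    intro p hp
    rw [Finset.mem_toList] at hp
    have h2 := Finset.mem_filter.1 hp
    exact ⟨hs p h2.1, h2.2.le, fun x hx hx' => (hR1 p h2.1 x hx hx').2 h2.2⟩) _ hDown
  convert this using 2
  ext x
  simp only [mem_inter_iff, mem_ofPred_eq, Finset.mem_toList]
  constructor
  · intro hx
    refine ⟨⟨fun p hp => hx p (Finset.mem_filter.1 hp).1, ?_⟩,
      fun p hp => hx p (Finset.mem_filter.1 hp).1⟩
    have hxM : ‖x‖ ≤ |M| := (hM x hx).trans (le_abs_self M)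
    have hlx : |l x| ≤ ‖l‖ * |M| :=
      (l.le_opNorm x).trans (mul_le_mul_of_nonneg_left hxM (norm_nonneg _))
    have h5 := abs_le.1 hlx
    refine ⟨⟨by linarith [h5.1], by linarith [h5.2]⟩, ?_⟩
    calc ‖x - l x • v‖ ≤ ‖x‖ + ‖l x • v‖ := norm_sub_le _ _
      _ = ‖x‖ + |l x| * ‖v‖ := by rw [norm_smul, Real.norm_eq_abs]
      _ ≤ r := add_le_add hxM (mul_le_mul_of_nonneg_right hlx (norm_nonneg _))
  · rintro ⟨⟨h1, -⟩, h3⟩ p hp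
    rcases lt_or_gt_of_ne (hv p hp) with h | h
    · exact h3 p (Finset.mem_filter.2 ⟨hp, h⟩)
    · exact h1 p (Finset.mem_filter.2 ⟨hp, h⟩)

lemma Good.zero_of_symZero (hm : Good m) (hsym : SymZero m) {S : Set E} (hS : CC S) : m S = 0 := by
  rcases S.eq_empty_or_nonempty with rfl | hne
  · exact hm.empty
  rcases subsingleton_or_nontrivial E with h | h
  · apply hsym S hS hne
    ext x; rw [mem_neg, Subsingleton.elim (-x) x]
  apply hm.lim_zero hS hne
  intro δ hδ
  obtain ⟨s, h1, h2, h3, h4⟩ := exists_poly_near hS hne hδ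
  exact ⟨Poly s, ⟨poly_convex s, h3⟩, h2, h4, hm.poly_zero hsym s h1 h3⟩

end Density
end Klain

namespace Klain

section Support

variable {E : Type*} [NormedAddCommGroup E] [InnerProductSpace ℝ E] [FiniteDimensional ℝ E]

/-- `h` is the support function of `S` -/
def Supp (S : Set E) (h : E → ℝ) : Prop :=
  ∀ x, (∀ y ∈ S, inner ℝ x y ≤ h x) ∧ ∃ y ∈ S, inner ℝ x y = h x

lemma supp_exists {S : Set E} (hS : IsCompact S) (hne : S.Nonempty) : ∃ h, Supp S h := by
  have : ∀ x : E, ∃ c, (∀ y ∈ S, inner ℝ x y ≤ c) ∧ ∃ y ∈ S, inner ℝ x y = c := by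
    intro x
    obtain ⟨y, hy, hmax⟩ := hS.exists_isMaxOn hne (f := fun y => inner ℝ x y) (by fun_prop)
    exact ⟨inner ℝ x y, fun z hz => hmax hz, y, hy, rfl⟩
  choose h hh using this
  exact ⟨h, hh⟩

lemma Supp.add {A B : Set E} {h k : E → ℝ} (hA : Supp A h) (hB : Supp B k) :
    Supp (A + B) (fun x => h x + k x) := by
  intro x
  constructor
  · rintro _ ⟨a, ha, b, hb, rfl⟩
    simp only [inner_add_right]
    exact add_le_add ((hA x).1 a ha) ((hB x).1 b hb)
  · obtain ⟨a, ha, ea⟩ := (hA x).2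
    obtain ⟨b, hb, eb⟩ := (hB x).2
    exact ⟨a + b, ⟨a, ha, b, hb, rfl⟩, by rw [inner_add_right, ea, eb]⟩

lemma Supp.smul {A : Set E} {h : E → ℝ} (hA : Supp A h) {t : ℝ} (ht : 0 ≤ t) :
    Supp (t • A) (fun x => t * h x) := by
  intro x
  constructor
  · rintro _ ⟨a, ha, rfl⟩
    simp only [inner_smul_right]
    exact mul_le_mul_of_nonneg_left ((hA x).1 a ha) ht
  · obtain ⟨a, ha, ea⟩ := (hA x).2
    exact ⟨t • a, ⟨a, ha, rfl⟩, by rw [inner_smul_right, ea]⟩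

lemma Supp.homog {A : Set E} {h : E → ℝ} (hA : Supp A h) {t : ℝ} (ht : 0 ≤ t) (x : E) :
    h (t • x) = t * h x := by
  obtain ⟨a, ha, ea⟩ := (hA (t • x)).2
  obtain ⟨b, hb, eb⟩ := (hA x).2
  apply le_antisymm
  · rw [← ea, real_inner_smul_left]
    exact mul_le_mul_of_nonneg_left ((hA x).1 a ha) ht
  · rw [← eb, ← real_inner_smul_left]
    exact (hA (t • x)).1 b hb

lemma Supp.near_aux {A B : Set E} (hB : CC B) (hB' : B.Nonempty) {h k : E → ℝ}
    (hA : Supp A h) (hBk : Supp B k) {ε : ℝ} (hε : 0 ≤ ε) (hle : ∀ x, h x ≤ k x + ε * ‖x‖) :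
    ∀ x ∈ A, ∃ y ∈ B, dist x y ≤ ε := by
  intro x hx
  obtain ⟨z, hz, hmin⟩ := exists_norm_eq_iInf_of_complete_convex hB' hB.2.isComplete hB.1 x
  rw [norm_eq_iInf_iff_real_inner_le_zero hB.1 hz] at hmin
  refine ⟨z, hz, ?_⟩
  rw [dist_eq_norm]
  obtain ⟨w, hw, ew⟩ := (hBk (x - z)).2
  have h1 := hmin w hw
  have h2 := (hA (x - z)).1 x hx
  have h3 := hle (x - z)
  rw [inner_sub_right] at h1
  have h4 : inner ℝ (x - z) x - inner ℝ (x - z) z = ‖x - z‖ * ‖x - z‖ := by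
    rw [← inner_sub_right, real_inner_self_eq_norm_mul_norm]
  by_contra! hlt
  have h5 : 0 ≤ ‖x - z‖ := norm_nonneg _
  have h6 : 0 < ‖x - z‖ := lt_of_le_of_lt hε hlt
  nlinarith

lemma Supp.near {A B : Set E} (hA : CC A) (hA' : A.Nonempty) (hB : CC B) (hB' : B.Nonempty)
    {h k : E → ℝ} (hAh : Supp A h) (hBk : Supp B k) {ε : ℝ} (hε : 0 ≤ ε)
    (hle : ∀ x, |h x - k x| ≤ ε * ‖x‖) : Near ε A B := by
  constructor
  · exact Supp.near_aux hB hB' hAh hBk hε (fun x => by linarith [(abs_le.1 (hle x)).2])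
  · intro y hy
    obtain ⟨x, hx, hd⟩ := Supp.near_aux hA hA' hBk hAh hε
      (fun x => by linarith [(abs_le.1 (hle x)).1]) y hy
    exact ⟨x, hx, by rwa [dist_comm]⟩

lemma Supp.unique {A B : Set E} (hA : CC A) (hA' : A.Nonempty) (hB : CC B) (hB' : B.Nonempty)
    {h : E → ℝ} (hAh : Supp A h) (hBk : Supp B h) : A = B := by
  have h := Supp.near hA hA' hB hB' hAh hBk le_rfl (by simp)
  apply Subset.antisymm
  · intro x hx
    obtain ⟨y, hy, hd⟩ := h.1 x hx
    rwa [dist_le_zero.1 hd]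
  · intro x hx
    obtain ⟨y, hy, hd⟩ := h.2 x hx
    rwa [← dist_le_zero.1 hd]

lemma supp_of_sublinear (h : E → ℝ) (hom : ∀ c : ℝ, 0 < c → ∀ x, h (c • x) = c * h x)
    (hadd : ∀ x y, h (x + y) ≤ h x + h y) {C : ℝ} (hC : ∀ x, h x ≤ C * ‖x‖) :
    ∃ A : Set E, CC A ∧ A.Nonempty ∧ Supp A h := by
  have : ProperSpace E := FiniteDimensional.proper ℝ E
  set A : Set E := {y | ∀ x, inner ℝ x y ≤ h x} with hAdef
  have hA0 : ∀ y, y ∈ A ↔ ∀ x, inner ℝ x y ≤ h x := fun y => Iff.rfl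
  have h0 : h 0 = 0 := by
    have := hom 2 (by norm_num) 0
    rw [smul_zero] at this; linarith
  have hneg : ∀ x, -h x ≤ h (-x) := by
    intro x
    have := hadd x (-x)
    rw [add_neg_cancel, h0] at this; linarith
  have key : ∀ x, ∃ y ∈ A, inner ℝ x y = h x := by
    intro x
    obtain ⟨g, hg1, hg2⟩ := exists_extension_of_le_sublinear
      (LinearPMap.mkSpanSingleton' x (h x) (by
        intro c hc
        rcases smul_eq_zero.1 hc with hc | hc
        · simp [hc]
        · simp [hc, h0])) h hom hadd (by
        rintro ⟨y, hy⟩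
        obtain ⟨c, rfl⟩ := Submodule.mem_span_singleton.1 hy
        rw [LinearPMap.mkSpanSingleton'_apply]
        simp only [smul_eq_mul, RingHom.id_apply]
        rcases lt_trichotomy c 0 with hc | hc | hc
        · have e1 := hom (-c) (by linarith) (-x)
          rw [smul_neg, neg_smul, neg_neg] at e1
          rw [e1]
          nlinarith [hneg x]
        · simp [hc, h0]
        · rw [hom c hc])
    set y := (InnerProductSpace.toDual ℝ E).symm (LinearMap.toContinuousLinearMap g) with hy
    have hyi : ∀ z, inner ℝ z y = g z := by
      intro z
      rw [real_inner_comm, hy, InnerProductSpace.toDual_symm_apply]; rfl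
    refine ⟨y, fun z => by rw [hyi]; exact hg2 z, ?_⟩
    rw [hyi]
    have := hg1 ⟨x, Submodule.mem_span_singleton_self x⟩
    simp only at this
    rw [this]
    have h2 := LinearPMap.mkSpanSingleton'_apply x (h x) (σ := RingHom.id ℝ) (by
        intro c hc
        rcases smul_eq_zero.1 hc with hc | hc
        · simp [hc]
        · simp [hc, h0]) 1 (by simpa using Submodule.mem_span_singleton_self x)
    simpa using h2
  refine ⟨A, ⟨?_, ?_⟩, ?_, fun x => ⟨fun y hy => hy x, key x⟩⟩
  · intro y hy z hz a b ha hb hab x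
    rw [inner_add_right, inner_smul_right, inner_smul_right]
    have := mul_le_mul_of_nonneg_left (hy x) ha
    have := mul_le_mul_of_nonneg_left (hz x) hb
    calc _ ≤ a * h x + b * h x := by linarith
      _ = h x := by rw [← add_mul, hab, one_mul]
  · apply Metric.isCompact_of_isClosed_isBounded
    · have : A = ⋂ x, {y | inner ℝ x y ≤ h x} := by ext y; simp [hA0]
      rw [this]
      exact isClosed_iInter fun x => isClosed_le (by fun_prop) continuous_const
    · refine (isBounded_closedBall (x := (0 : E)) (r := |C|)).subset ?_
      intro y hy
      rw [mem_closedBall_zero_iff]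
      have h1 := (hy y).trans (hC y)
      rw [real_inner_self_eq_norm_mul_norm] at h1
      rcases (norm_nonneg y).eq_or_lt with h2 | h2
      · rw [← h2]; positivity
      · exact (le_of_mul_le_mul_right h1 h2).trans (le_abs_self C)
  · obtain ⟨y, hy, -⟩ := key 0
    exact ⟨y, hy⟩

end Support

section Zonoid

variable {E : Type*} [NormedAddCommGroup E] [InnerProductSpace ℝ E] [FiniteDimensional ℝ E]

lemma supp_segment (y : E) : Supp (segment ℝ (-y) y) (fun x => |inner ℝ x y|) := by
  intro x
  constructor
  · intro z hz
    rw [segment_eq_image'] at hz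
    obtain ⟨t, ht, rfl⟩ := hz
    have e : inner ℝ x (-y + t • (y - -y)) = (2 * t - 1) * inner ℝ x y := by
      simp only [inner_add_right, inner_neg_right, inner_smul_right, inner_sub_right]; ring
    simp only [e]
    refine (le_abs_self _).trans ?_
    rw [abs_mul]
    have : |2 * t - 1| ≤ 1 := abs_le.2 ⟨by linarith [ht.1], by linarith [ht.2]⟩
    exact mul_le_of_le_one_left (abs_nonneg _) this
  · rcases abs_cases (inner ℝ x y) with h | h
    · exact ⟨y, right_mem_segment _ _ _, h.1.symm⟩
    · exact ⟨-y, left_mem_segment _ _ _, by simp only [inner_neg_right, h.1]⟩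

variable {m : Set E → ℂ}

lemma Good.add_symseg (hm : Good m) (hcyl : Cyl m) {K : Set E} (hK : CC K) (hne : K.Nonempty)
    (y : E) : m (K + segment ℝ (-y) y) = m K := by
  have e : K + segment ℝ (-y) y = {-y} + (K + segment ℝ 0 ((2 : ℝ) • y)) := by
    have : segment ℝ (-y) y = {-y} + segment ℝ 0 ((2 : ℝ) • y) := by
      rw [singleton_add, segment_eq_image', segment_eq_image', image_image]
      apply image_congr
      intro t _
      simp only [sub_neg_eq_add, sub_zero, zero_add, two_smul]
    rw [this, ← add_assoc, ← add_assoc, add_comm K]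
  rw [e, hm.trans _ (hK.add (CC.segment _ _)), hm.add_seg hcyl hK hne]

/-- bodies which can be added freely -/
def Free (m : Set E → ℂ) (Z : Set E) : Prop :=
  CC Z ∧ Z.Nonempty ∧ ∀ t : ℝ, 0 ≤ t → ∀ K, CC K → K.Nonempty → m (K + t • Z) = m K

lemma Free.smul {Z : Set E} (h : Free m Z) {s : ℝ} (hs : 0 ≤ s) : Free m (s • Z) :=
  ⟨h.1.smul s, h.2.1.smul_set, fun t ht K hK hne => by
    rw [smul_smul]; exact h.2.2 _ (mul_nonneg ht hs) K hK hne⟩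

lemma Free.add {Z W : Set E} (h : Free m Z) (h' : Free m W) : Free m (Z + W) :=
  ⟨h.1.add h'.1, h.2.1.add h'.2.1, fun t ht K hK hne => by
    rw [smul_add, ← add_assoc, h'.2.2 t ht _ (hK.add (h.1.smul t)) (hne.add h.2.1.smul_set),
      h.2.2 t ht K hK hne]⟩

lemma Good.free_symseg (hm : Good m) (hcyl : Cyl m) (y : E) : Free m (segment ℝ (-y) y) := by
  refine ⟨CC.segment _ _, ⟨y, right_mem_segment _ _ _⟩, fun t ht K hK hne => ?_⟩
  have : t • segment ℝ (-y) y = segment ℝ (-(t • y)) (t • y) := by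
    rw [segment_eq_image', segment_eq_image', ← image_smul, image_image]
    apply image_congr
    intro s _
    simp only [smul_add, smul_neg, sub_neg_eq_add, smul_comm t s]
  rw [this]
  exact hm.add_symseg hcyl hK hne _

/-- functions on the unit ball that are restrictions of support functions of free bodies -/
def FreeFun (m : Set E → ℂ) : Set C(closedBall (0 : E) 1, ℝ) :=
  {f | ∃ Z, Free m Z ∧ ∃ h, Supp Z h ∧ ∀ x, f x = h x}

lemma freeFun_smul {f : C(closedBall (0 : E) 1, ℝ)} (hf : f ∈ FreeFun m) {s : ℝ} (hs : 0 ≤ s) :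
    s • f ∈ FreeFun m := by
  obtain ⟨Z, hZ, h, hh, hfh⟩ := hf
  exact ⟨_, hZ.smul hs, _, hh.smul hs, fun x => by simp [hfh x]⟩

lemma freeFun_convex : Convex ℝ (FreeFun m) := by
  intro f hf g hg a b ha hb _
  obtain ⟨Z, hZ, h, hh, hfh⟩ := freeFun_smul hf ha
  obtain ⟨W, hW, k, hk, hgk⟩ := freeFun_smul hg hb
  exact ⟨_, hZ.add hW, _, hh.add hk, fun x => by
    rw [ContinuousMap.add_apply, hfh x, hgk x]⟩

/-- the zonoid of a finite measure can be added freely -/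
lemma Good.zonoid [MeasurableSpace E] [BorelSpace E] (hm : Good m) (hcyl : Cyl m)
    (ν : Measure E) [IsFiniteMeasure ν] (hν : Integrable (fun y => ‖y‖) ν) :
    ∃ Z, CC Z ∧ Z.Nonempty ∧ Supp Z (fun x => ∫ y, |inner ℝ x y| ∂ν) ∧
      ∀ K, CC K → K.Nonempty → m (K + Z) = m K := by
  have : ProperSpace E := FiniteDimensional.proper ℝ E
  have : CompactSpace (closedBall (0 : E) 1) :=
    isCompact_iff_compactSpace.1 (isCompact_closedBall _ _)
  have hIntg : ∀ x : E, Integrable (fun y => |inner ℝ x y|) ν := by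
    intro x
    refine (hν.const_mul ‖x‖).mono' (by fun_prop) (ae_of_all _ fun y => ?_)
    rw [Real.norm_eq_abs, abs_abs]
    exact abs_real_inner_le_norm x y
  obtain ⟨Z, hZ, hZne, hZs⟩ := supp_of_sublinear (fun x : E => ∫ y, |inner ℝ x y| ∂ν)
    (by
      intro c hc x
      simp only [real_inner_smul_left, abs_mul, abs_of_pos hc]
      rw [integral_const_mul])
    (by
      intro x y
      rw [← integral_add (hIntg x) (hIntg y)]
      refine integral_mono (hIntg _) ((hIntg x).add (hIntg y)) fun z => ?_
      simp only [inner_add_left]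
      exact abs_add_le _ _) (C := ∫ y, ‖y‖ ∂ν)
    (by
      intro x
      rw [mul_comm, ← integral_const_mul]
      exact integral_mono (hIntg x) (hν.const_mul _) fun y => abs_real_inner_le_norm x y)
  refine ⟨Z, hZ, hZne, hZs, ?_⟩
  set h : E → ℝ := fun x : E => ∫ y, |inner ℝ x y| ∂ν with hh
  -- the curried function
  let Ψ : C(E, C(closedBall (0 : E) 1, ℝ)) := ContinuousMap.curry
    ⟨fun p : E × closedBall (0 : E) 1 => |inner ℝ (p.2 : E) p.1|, by fun_prop⟩
  have hΨ : ∀ y x, Ψ y x = |inner ℝ (x : E) y| := fun y x => rfl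
  have hΨmem : ∀ y, Ψ y ∈ FreeFun m := fun y =>
    ⟨_, hm.free_symseg hcyl y, _, supp_segment y, fun x => rfl⟩
  have hΨint : Integrable Ψ ν := by
    refine hν.mono' Ψ.continuous.aestronglyMeasurable (ae_of_all _ fun y => ?_)
    rw [ContinuousMap.norm_le _ (norm_nonneg _)]
    intro x
    rw [hΨ, Real.norm_eq_abs, abs_abs]
    refine (abs_real_inner_le_norm _ _).trans ?_
    exact mul_le_of_le_one_left (norm_nonneg _) (mem_closedBall_zero_iff.1 x.2)
  have hev : ∀ x, (∫ y, Ψ y ∂ν) x = h x := by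
    intro x
    rw [ContinuousMap.integral_apply hΨint]
    rfl
  have hcl : ∀ ε > 0, ∃ g ∈ FreeFun m, dist (∫ y, Ψ y ∂ν) g ≤ ε := by
    intro ε hε
    by_cases h0 : ν = 0
    · refine ⟨0, ⟨{0}, ⟨CC.singleton 0, singleton_nonempty _, ?_⟩, fun _ => 0, ?_, ?_⟩, ?_⟩
      · intro t _ K _ _
        simp
      · intro x; simp
      · intro x; simp
      · simp [h0, hε.le]
    · have : NeZero ν := ⟨h0⟩
      have hav := Convex.average_mem (μ := ν) (freeFun_convex (m := m)).closure isClosed_closure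
        (ae_of_all _ fun y => subset_closure (hΨmem y)) hΨint
      set c := ν.real univ with hc
      have hcpos : 0 < c := by
        rw [hc, measureReal_def]
        exact ENNReal.toReal_pos (by simpa using h0) (measure_ne_top _ _)
      rw [average_eq] at hav
      obtain ⟨g, hg, hd⟩ := Metric.mem_closure_iff.1 hav (ε / c) (by positivity)
      refine ⟨c • g, freeFun_smul hg hcpos.le, ?_⟩
      have e : (∫ y, Ψ y ∂ν) = c • (c⁻¹ • ∫ y, Ψ y ∂ν) := by
        rw [smul_smul, mul_inv_cancel₀ hcpos.ne', one_smul]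
      rw [dist_eq_norm] at hd ⊢
      rw [e, ← smul_sub, norm_smul, Real.norm_eq_abs, abs_of_pos hcpos]
      have := mul_le_mul_of_nonneg_left hd.le hcpos.le
      rwa [mul_div_cancel₀ _ hcpos.ne'] at this
  intro K hK hne
  refine hm.lim_eq (hK.add hZ) (hne.add hZne) hK hne fun δ hδ => ?_
  obtain ⟨g, ⟨W, hW, k, hk, hgk⟩, hd⟩ := hcl δ hδ
  have hnear : Near δ Z W := by
    refine Supp.near hZ hZne hW.1 hW.2.1 hZs hk hδ.le fun x => ?_
    by_cases hx : x = 0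
    · subst hx
      have a1 := hZs.homog (le_refl 0) 0
      have a2 := hk.homog (le_refl 0) 0
      simp only [smul_zero, zero_mul] at a1 a2
      rw [a1, a2]; simp
    · have hxp : 0 < ‖x‖ := norm_pos_iff.2 hx
      have hu : ‖x‖⁻¹ • x ∈ closedBall (0 : E) 1 := by
        rw [mem_closedBall_zero_iff, norm_smul, norm_inv, norm_norm, inv_mul_cancel₀ hxp.ne']
      have h1 := (ContinuousMap.dist_le hδ.le).1 hd ⟨_, hu⟩
      rw [hev, hgk, Real.dist_eq] at h1
      have ex : x = ‖x‖ • (‖x‖⁻¹ • x) := by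
        rw [smul_smul, mul_inv_cancel₀ hxp.ne', one_smul]
      have a1 := hZs.homog hxp.le (‖x‖⁻¹ • x)
      have a2 := hk.homog hxp.le (‖x‖⁻¹ • x)
      rw [← ex] at a1 a2
      rw [a1, a2, ← mul_sub, abs_mul, abs_norm, mul_comm]
      exact mul_le_mul_of_nonneg_right h1 hxp.le
  refine ⟨K + W, K, hK.add hW.1, hne.add hW.2.1, hK, hne, hnear.add_left K, ?_, ?_⟩
  · exact ⟨fun x hx => ⟨x, hx, by simpa using hδ.le⟩, fun x hx => ⟨x, hx, by simpa using hδ.le⟩⟩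
  · simpa using hW.2.2 1 zero_le_one K hK hne

end Zonoid
end Klain

namespace Klain

section Fourier

open FourierTransform SchwartzMap

variable {E : Type*} [NormedAddCommGroup E] [InnerProductSpace ℝ E] [FiniteDimensional ℝ E]
  [MeasurableSpace E] [BorelSpace E]

lemma cos_rep (φ : E → ℝ) (hφ : ContDiff ℝ (⊤ : ℕ∞) φ) (hc : HasCompactSupport φ)
    (hev : ∀ x, φ (-x) = φ x) :
    ∃ ρ : E → ℝ, Continuous ρ ∧ Integrable ρ ∧ Integrable (fun y => ‖y‖ * |ρ y|) ∧
      ∀ x, φ x = ∫ y, Real.cos (2 * Real.pi * inner ℝ y x) * ρ y := by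
  have hc' : HasCompactSupport (fun x => (φ x : ℂ)) := hc.comp_left (g := fun r : ℝ => (r : ℂ)) (by simp)
  have hs' : ContDiff ℝ (⊤ : ℕ∞) (fun x => (φ x : ℂ)) :=
    Complex.ofRealCLM.contDiff.comp hφ
  set f : 𝓢(E, ℂ) := hc'.toSchwartzMap hs' with hf
  have hfx : ∀ x, f x = (φ x : ℂ) := fun x => rfl
  set ψ : 𝓢(E, ℂ) := 𝓕 f with hψ
  have inv : ∀ x : E, (φ x : ℂ) =
      ∫ y, Complex.exp (((2 * Real.pi * inner ℝ y x : ℝ) : ℂ) * Complex.I) • ψ y := by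
    intro x
    have h : 𝓕⁻ (𝓕 f) = f := by simp
    rw [← hfx, ← h, SchwartzMap.fourierInv_coe, Real.fourierInv_eq']
  have hre : ∀ x y : E,
      (Complex.exp (((2 * Real.pi * inner ℝ y x : ℝ) : ℂ) * Complex.I) • ψ y).re =
      Real.cos (2 * Real.pi * inner ℝ y x) * (ψ y).re
        - Real.sin (2 * Real.pi * inner ℝ y x) * (ψ y).im := by
    intro x y
    rw [smul_eq_mul, Complex.mul_re, Complex.exp_ofReal_mul_I_re, Complex.exp_ofReal_mul_I_im]
  have hψc : Continuous ψ := ψ.continuous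
  have hψi : Integrable ψ := ψ.integrable
  have hI1 : Integrable (fun y => (ψ y).re) := hψi.re
  have hI2 : Integrable (fun y => (ψ y).im) := hψi.im
  have hJ1 : ∀ x : E, Integrable (fun y => Real.cos (2 * Real.pi * inner ℝ y x) * (ψ y).re) := by
    intro x
    refine hI1.bdd_mul (c := 1) (by fun_prop) (ae_of_all _ fun y => Real.abs_cos_le_one _)
  have hJ2 : ∀ x : E, Integrable (fun y => Real.sin (2 * Real.pi * inner ℝ y x) * (ψ y).im) := by
    intro x
    refine hI2.bdd_mul (c := 1) (by fun_prop) (ae_of_all _ fun y => Real.abs_sin_le_one _)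
  have hIntg : ∀ x : E, Integrable
      (fun y => Complex.exp (((2 * Real.pi * inner ℝ y x : ℝ) : ℂ) * Complex.I) • ψ y) := by
    intro x
    refine hψi.bdd_mul (c := 1) (by fun_prop) (ae_of_all _ fun y => ?_)
    rw [Complex.norm_exp_ofReal_mul_I]
  have hφ1 : ∀ x : E, φ x = (∫ y, Real.cos (2 * Real.pi * inner ℝ y x) * (ψ y).re)
      - ∫ y, Real.sin (2 * Real.pi * inner ℝ y x) * (ψ y).im := by
    intro x
    rw [← integral_sub (hJ1 x) (hJ2 x)]
    have h1 : φ x = (∫ y, Complex.exp (((2 * Real.pi * inner ℝ y x : ℝ) : ℂ) * Complex.I) • ψ y).re := by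
      rw [← inv x, Complex.ofReal_re]
    have h2 := integral_re (hIntg x)
    simp only [RCLike.re_eq_complex_re, hre] at h2
    rw [h1, ← h2]
  refine ⟨fun y => (ψ y).re, by fun_prop, hI1, ?_, ?_⟩
  · refine (ψ.integrable_pow_mul volume 1).mono' (by fun_prop) (ae_of_all _ fun y => ?_)
    rw [norm_mul, norm_norm, Real.norm_eq_abs, abs_abs, pow_one]
    exact mul_le_mul_of_nonneg_left (Complex.abs_re_le_norm _) (norm_nonneg _)
  · intro x
    have h1 := hφ1 x
    have h2 := hφ1 (-x)
    simp only [inner_neg_right, mul_neg, Real.cos_neg, Real.sin_neg, neg_mul] at h2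
    rw [integral_neg, hev] at h2
    linarith

lemma scale_int (k : ℝ → ℝ) {u : ℝ} (hu : 0 < u) :
    ∫ s in Ioi (0 : ℝ), k (s * u) / s ^ 2 = u * ∫ r in Ioi (0 : ℝ), k r / r ^ 2 := by
  have h := integral_comp_mul_right_Ioi (fun r => k r / r ^ 2) 0 hu
  rw [zero_mul, smul_eq_mul] at h
  have e : ∀ s : ℝ, k (s * u) / s ^ 2 = u ^ 2 * (k (s * u) / (s * u) ^ 2) := by
    intro s
    rcases eq_or_ne s 0 with hs | hs
    · simp [hs]
    · field_simp
  simp_rw [e]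
  rw [integral_const_mul, h]
  field_simp

lemma scale_integrable (k : ℝ → ℝ) {u : ℝ} (hu : 0 < u)
    (hk : IntegrableOn (fun r => k r / r ^ 2) (Ioi 0)) :
    IntegrableOn (fun s => k (s * u) / s ^ 2) (Ioi 0) := by
  have h := (integrableOn_Ioi_comp_mul_right_iff (fun r => k r / r ^ 2) 0 hu).2 (by rwa [zero_mul])
  have e : ∀ s : ℝ, k (s * u) / s ^ 2 = u ^ 2 * (k (s * u) / (s * u) ^ 2) := by
    intro s
    rcases eq_or_ne s 0 with hs | hs
    · simp [hs]
    · field_simp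
  simp_rw [e]
  exact h.const_mul _

lemma integrable_div_sq (k : ℝ → ℝ) (hk : Measurable k) (C : ℝ)
    (h1 : ∀ r, 0 < r → r ≤ 1 → |k r| ≤ C * r ^ 2) (h2 : ∀ r, 1 < r → |k r| ≤ C) :
    IntegrableOn (fun r => k r / r ^ 2) (Ioi 0) := by
  rw [← Ioc_union_Ioi_eq_Ioi (zero_le_one' ℝ)]
  have hmeas : Measurable (fun r => k r / r ^ 2) := hk.div (by fun_prop)
  refine IntegrableOn.union ?_ ?_
  · refine Integrable.mono' (g := fun _ => C) (integrable_const C) hmeas.aestronglyMeasurable ?_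
    filter_upwards [ae_restrict_mem measurableSet_Ioc] with r hr
    rw [Real.norm_eq_abs, abs_div, abs_of_nonneg (sq_nonneg r), div_le_iff₀ (pow_pos hr.1 2)]
    exact h1 r hr.1 hr.2
  · have h := (integrableOn_Ioi_rpow_of_lt (a := -2) (by norm_num) zero_lt_one).const_mul C
    refine Integrable.mono' h hmeas.aestronglyMeasurable ?_
    filter_upwards [ae_restrict_mem measurableSet_Ioi] with r hr
    have hr0 : (0 : ℝ) < r := lt_trans zero_lt_one hr
    rw [Real.norm_eq_abs, abs_div, abs_of_nonneg (sq_nonneg r), Real.rpow_neg hr0.le, div_eq_mul_inv]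
    have : r ^ (2 : ℝ) = r ^ 2 := by norm_cast
    rw [this]
    exact mul_le_mul_of_nonneg_right (h2 r hr) (by positivity)

lemma cos_integrable :
    IntegrableOn (fun r : ℝ => (1 - Real.cos (2 * Real.pi * r)) / r ^ 2) (Ioi 0) := by
  refine integrable_div_sq _ (by fun_prop) (2 * Real.pi ^ 2) ?_ ?_
  · intro r _ _
    have h1 := Real.one_sub_sq_div_two_le_cos (x := 2 * Real.pi * r)
    have h2 := Real.cos_le_one (2 * Real.pi * r)
    rw [abs_of_nonneg (by linarith)]
    nlinarith
  · intro r _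
    have h1 := Real.neg_one_le_cos (2 * Real.pi * r)
    have h2 := Real.cos_le_one (2 * Real.pi * r)
    rw [abs_of_nonneg (by linarith)]
    nlinarith [Real.pi_gt_three]

/-- integral of `(1 - cos)/r^2` -/
def kap : ℝ := ∫ r in Ioi (0 : ℝ), (1 - Real.cos (2 * Real.pi * r)) / r ^ 2

lemma cos_int (u : ℝ) :
    IntegrableOn (fun s : ℝ => (1 - Real.cos (2 * Real.pi * (s * u))) / s ^ 2) (Ioi 0) ∧
    ∫ s in Ioi (0 : ℝ), (1 - Real.cos (2 * Real.pi * (s * u))) / s ^ 2 = kap * |u| := by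
  have hpos : ∀ v : ℝ, 0 < v →
    IntegrableOn (fun s : ℝ => (1 - Real.cos (2 * Real.pi * (s * v))) / s ^ 2) (Ioi 0) ∧
    ∫ s in Ioi (0 : ℝ), (1 - Real.cos (2 * Real.pi * (s * v))) / s ^ 2 = kap * v := by
    intro v hv
    refine ⟨scale_integrable (fun r => 1 - Real.cos (2 * Real.pi * r)) hv cos_integrable, ?_⟩
    rw [scale_int (fun r => 1 - Real.cos (2 * Real.pi * r)) hv, kap, mul_comm]
  rcases lt_trichotomy u 0 with hu | hu | hu
  · have h := hpos (-u) (by linarith)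
    simpa only [mul_neg, Real.cos_neg, abs_of_neg hu] using h
  · simp [hu]
  · rw [abs_of_pos hu]; exact hpos u hu

/-- representation of even homogeneous roots as integrals of `|inner x y|` -/
lemma abs_rep (F : E → ℝ) (hF : ContDiff ℝ (⊤ : ℕ∞) F) (k : ℕ) (hk : Even k) (hk0 : k ≠ 0)
    (hom : ∀ (s : ℝ) x, F (s • x) = s ^ k * F x) (hpos : ∀ x, x ≠ 0 → 0 < F x)
    (hbd : Bornology.IsBounded {x | F x ≤ 2}) :
    ∃ ρ : E → ℝ, Continuous ρ ∧ Integrable ρ ∧ Integrable (fun y => ‖y‖ * |ρ y|) ∧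
      ∀ x, (F x) ^ ((k : ℝ)⁻¹) = ∫ y, |inner ℝ x y| * ρ y := by
  have : ProperSpace E := FiniteDimensional.proper ℝ E
  have hF0 : F 0 = 0 := by
    have := hom 0 0
    rwa [zero_pow hk0, zero_mul, smul_zero] at this
  have hFnn : ∀ x, 0 ≤ F x := by
    intro x
    by_cases hx : x = 0
    · rw [hx, hF0]
    · exact (hpos x hx).le
  let g : ContDiffBump (0 : ℝ) := ⟨1, 2, by norm_num, by norm_num⟩
  have hg1 : ∀ t, |t| ≤ 1 → g t = 1 := fun t ht =>
    g.one_of_mem_closedBall (by rw [mem_closedBall_zero_iff]; exact ht)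
  have hg2 : ∀ t, 2 ≤ |t| → g t = 0 := fun t ht =>
    g.zero_of_le_dist (by rw [dist_zero_right]; exact ht)
  have hgc : Continuous g := g.continuous
  have hφev : ∀ x, g (F (-x)) = g (F x) := by
    intro x
    have := hom (-1) x
    rw [neg_one_smul, hk.neg_one_pow, one_mul] at this
    rw [this]
  have hφc : HasCompactSupport (fun x => g (F x)) := by
    refine HasCompactSupport.of_support_subset_isCompact (K := {x | F x ≤ 2})
      (Metric.isCompact_of_isClosed_isBounded (isClosed_le hF.continuous continuous_const) hbd) ?_
    intro x hx
    by_contra hlt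
    apply hx
    apply hg2
    rw [abs_of_nonneg (hFnn x)]
    exact (not_le.1 hlt).le
  obtain ⟨ρ, hρc, hρi, hρn, hrep⟩ := cos_rep (fun x => g (F x)) (g.contDiff.comp hF) hφc hφev
  -- the constant
  set G : ℝ → ℝ := fun r => 1 - g (r ^ k) with hG
  have hGc : Continuous G := by fun_prop
  have hG0 : ∀ r, 0 ≤ G r := fun r => by
    have := g.le_one (x := r ^ k); simp only [hG]; linarith
  have hG1 : ∀ r, G r ≤ 1 := fun r => by
    have := g.nonneg (x := r ^ k); simp only [hG]; linarith
  have hGi : IntegrableOn (fun r => G r / r ^ 2) (Ioi 0) := by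
    refine integrable_div_sq G hGc.measurable 1 ?_ ?_
    · intro r h0 h1
      have : G r = 0 := by
        simp only [hG]
        rw [hg1, sub_self]
        rw [abs_of_nonneg (by positivity)]
        exact pow_le_one₀ h0.le h1
      rw [this, abs_zero]; positivity
    · intro r _
      rw [abs_of_nonneg (hG0 r)]; exact hG1 r
  set c0 := ∫ r in Ioi (0 : ℝ), G r / r ^ 2 with hc0
  have hc0pos : 0 < c0 := by
    rw [hc0, setIntegral_pos_iff_support_of_nonneg_ae _ hGi]
    · have hsub : Ioi (2 : ℝ) ⊆ Function.support (fun r => G r / r ^ 2) ∩ Ioi 0 := by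
        intro r hr
        have hr' : (2 : ℝ) < r := hr
        refine ⟨?_, lt_trans (by norm_num) hr'⟩
        have : G r = 1 := by
          simp only [hG]
          rw [hg2, sub_zero]
          rw [abs_of_nonneg (by positivity)]
          exact hr'.le.trans (le_self_pow₀ (by linarith) hk0)
        rw [Function.mem_support, this]
        positivity
      refine lt_of_lt_of_le ?_ (measure_mono hsub)
      simp
    · exact ae_of_all _ fun r => div_nonneg (hG0 r) (sq_nonneg r)
  have hone : (∫ y, ρ y) = 1 := by
    have := hrep 0
    simp only [inner_zero_right, mul_zero, Real.cos_zero, one_mul, hF0] at this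
    rw [← this, hg1]; simp
  have hcosi : ∀ x : E, Integrable (fun y => Real.cos (2 * Real.pi * inner ℝ y x) * ρ y) := by
    intro x
    refine hρi.bdd_mul (c := 1) (by fun_prop) (ae_of_all _ fun y => Real.abs_cos_le_one _)
  have hrep2 : ∀ x, 1 - g (F x) = ∫ y, (1 - Real.cos (2 * Real.pi * inner ℝ y x)) * ρ y := by
    intro x
    rw [hrep x]
    simp only [sub_mul, one_mul]
    rw [integral_sub hρi (hcosi x), hone]
  have main : ∀ x, c0 * (F x) ^ ((k : ℝ)⁻¹) = kap * ∫ y, |inner ℝ x y| * ρ y := by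
    intro x
    by_cases hx : x = 0
    · have hk' : (k : ℝ)⁻¹ ≠ 0 := by positivity
      simp [hx, hF0, Real.zero_rpow hk']
    set N := (F x) ^ ((k : ℝ)⁻¹) with hN
    have hNpos : 0 < N := Real.rpow_pos_of_pos (hpos x hx) _
    have hNk : N ^ k = F x := Real.rpow_inv_natCast_pow (hFnn x) hk0
    have e1 : c0 * N = ∫ s in Ioi (0 : ℝ), (1 - g (F (s • x))) / s ^ 2 := by
      rw [mul_comm, hc0, ← scale_int G hNpos]
      congr 1
      ext s
      simp only [hG]
      rw [hom, mul_pow, hNk]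
    have e2 : ∀ s : ℝ, (1 - g (F (s • x))) / s ^ 2 =
        ∫ y, (1 - Real.cos (2 * Real.pi * (s * inner ℝ x y))) / s ^ 2 * ρ y := by
      intro s
      rw [hrep2, div_eq_mul_inv, mul_comm, ← integral_const_mul]
      congr 1
      ext y
      rw [inner_smul_right, real_inner_comm]
      ring
    rw [e1]
    simp_rw [e2]
    have hfub : Integrable (fun p : E × ℝ =>
        (1 - Real.cos (2 * Real.pi * (p.2 * inner ℝ x p.1))) / p.2 ^ 2 * ρ p.1)
        ((volume : Measure E).prod (volume.restrict (Ioi (0 : ℝ)))) := by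
      rw [integrable_prod_iff]
      · constructor
        · exact ae_of_all _ fun y => ((cos_int (inner ℝ x y)).1.integrable).mul_const (ρ y)
        · have e3 : ∀ y : E, ∫ s in Ioi (0 : ℝ),
              ‖(1 - Real.cos (2 * Real.pi * (s * inner ℝ x y))) / s ^ 2 * ρ y‖
              = kap * |inner ℝ x y| * |ρ y| := by
            intro y
            rw [← (cos_int (inner ℝ x y)).2, ← integral_mul_const]
            congr 1
            ext s
            rw [norm_mul, Real.norm_eq_abs, Real.norm_eq_abs, abs_of_nonneg]
            exact div_nonneg (by linarith [Real.cos_le_one (2 * Real.pi * (s * inner ℝ x y))])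
              (sq_nonneg s)
          simp_rw [e3]
          refine (hρn.const_mul (|kap| * ‖x‖)).mono' (by fun_prop) (ae_of_all _ fun y => ?_)
          rw [norm_mul, norm_mul, Real.norm_eq_abs, Real.norm_eq_abs, Real.norm_eq_abs, abs_abs,
            abs_abs, mul_assoc, mul_assoc, ← mul_assoc ‖x‖]
          have := abs_real_inner_le_norm x y
          gcongr
      · refine Measurable.aestronglyMeasurable ?_
        refine Measurable.mul (Measurable.div ?_ ?_) ?_
        · exact (Continuous.measurable (by fun_prop))
        · exact (Continuous.measurable (by fun_prop))
        · exact (Continuous.measurable (by fun_prop))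
    have hsw := integral_integral_swap (f := fun (y : E) (s : ℝ) =>
      (1 - Real.cos (2 * Real.pi * (s * inner ℝ x y))) / s ^ 2 * ρ y) hfub
    rw [← hsw, ← integral_const_mul]
    congr 1
    ext y
    rw [integral_mul_const, (cos_int (inner ℝ x y)).2]
    ring
  refine ⟨fun y => kap / c0 * ρ y, by fun_prop, hρi.const_mul _, ?_, ?_⟩
  · refine (hρn.const_mul |kap / c0|).congr (ae_of_all _ fun y => ?_)
    simp only [abs_mul]; ring
  · intro x
    have h := main x
    have e : (fun y => |inner ℝ x y| * (kap / c0 * ρ y)) =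
      fun y => kap / c0 * (|inner ℝ x y| * ρ y) := by ext y; ring
    rw [e, integral_const_mul]
    rw [div_mul_eq_mul_div, ← h, mul_div_cancel_left₀ _ hc0pos.ne']

end Fourier
end Klain

namespace Klain

section SymBodies

variable {E : Type*} [NormedAddCommGroup E] [InnerProductSpace ℝ E] [FiniteDimensional ℝ E]
variable {m : Set E → ℂ}

lemma Good.zonoid_density [MeasurableSpace E] [BorelSpace E] (hm : Good m) (hcyl : Cyl m)
    (ρ : E → ℝ) (hρc : Continuous ρ) (hρi : Integrable ρ)
    (hρn : Integrable (fun y => ‖y‖ * |ρ y|)) :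
    ∃ Z, CC Z ∧ Z.Nonempty ∧ Supp Z (fun x => ∫ y, |inner ℝ x y| * max (ρ y) 0) ∧
      ∀ K, CC K → K.Nonempty → m (K + Z) = m K := by
  have hmeas : Measurable (fun y => Real.toNNReal (ρ y)) := by fun_prop
  set ν : Measure E := volume.withDensity (fun y => ((Real.toNNReal (ρ y) : NNReal) : ℝ≥0∞)) with hν
  have hfin : IsFiniteMeasure ν := isFiniteMeasure_withDensity_ofReal hρi.hasFiniteIntegral
  have hn : Integrable (fun y => ‖y‖) ν := by
    rw [hν, integrable_withDensity_iff_integrable_smul hmeas]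
    refine hρn.mono' ?_ (ae_of_all _ fun y => ?_)
    · refine Continuous.aestronglyMeasurable ?_
      exact (continuous_real_toNNReal.comp hρc).smul continuous_norm
    · rw [NNReal.smul_def, Real.coe_toNNReal', smul_eq_mul, norm_mul, norm_norm, mul_comm]
      refine mul_le_mul_of_nonneg_left ?_ (norm_nonneg _)
      rw [Real.norm_eq_abs, abs_of_nonneg (le_max_right _ _)]
      exact max_le (le_abs_self _) (abs_nonneg _)
  obtain ⟨Z, h1, h2, h3, h4⟩ := hm.zonoid hcyl ν hn
  refine ⟨Z, h1, h2, ?_, h4⟩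
  have e : (fun x => ∫ y, |inner ℝ x y| ∂ν) = fun x => ∫ y, |inner ℝ x y| * max (ρ y) 0 := by
    ext x
    rw [hν, integral_withDensity_eq_integral_smul hmeas]
    congr 1
    ext y
    rw [NNReal.smul_def, Real.coe_toNNReal', smul_eq_mul, mul_comm]
  rwa [e] at h3

lemma Good.singleton_zero [Nontrivial E] (hm : Good m) (x : E) : m {x} = 0 := by
  obtain ⟨v, hv⟩ := exists_ne (0 : E)
  refine hm.flat _ (CC.singleton x) (innerSL ℝ v) ?_ (inner ℝ v x) ?_
  · intro h
    have := DFunLike.congr_fun h v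
    rw [innerSL_apply_apply] at this
    simp [hv] at this
  · rintro y rfl
    rfl

lemma Good.root_body [Nontrivial E] (hm : Good m) (hcyl : Cyl m) (T : Finset E)
    (hT : ∀ x : E, (∀ a ∈ T, inner ℝ a x = 0) → x = 0) (k : ℕ) (hk : Even k) (hk0 : k ≠ 0) :
    ∃ A, CC A ∧ A.Nonempty ∧ Supp A (fun x => (∑ a ∈ T, (inner ℝ a x : ℝ) ^ k) ^ ((k : ℝ)⁻¹)) ∧
      m A = 0 := by
  borelize E
  have : ProperSpace E := FiniteDimensional.proper ℝ E
  set F : E → ℝ := fun x => ∑ a ∈ T, (inner ℝ a x : ℝ) ^ k with hFdef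
  have hF : ContDiff ℝ (⊤ : ℕ∞) F := by
    refine ContDiff.sum fun a _ => ?_
    exact (contDiff_const.inner ℝ contDiff_id).pow k
  have hnn : ∀ a x : E, 0 ≤ (inner ℝ a x : ℝ) ^ k := fun a x => hk.pow_nonneg _
  have hom : ∀ (s : ℝ) x, F (s • x) = s ^ k * F x := by
    intro s x
    simp only [hFdef, inner_smul_right, mul_pow, Finset.mul_sum]
  have hpos : ∀ x, x ≠ 0 → 0 < F x := by
    intro x hx
    have : ∃ a ∈ T, (inner ℝ a x : ℝ) ≠ 0 := by
      by_contra! h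
      exact hx (hT x h)
    obtain ⟨a, ha, hax⟩ := this
    refine lt_of_lt_of_le (hk.pow_pos hax) ?_
    exact Finset.single_le_sum (f := fun a => (inner ℝ a x : ℝ) ^ k) (fun b _ => hnn b x) ha
  have hbd : Bornology.IsBounded {x | F x ≤ 2} := by
    obtain ⟨z, hz, hmin⟩ := (isCompact_sphere (0 : E) 1).exists_isMinOn
      (NormedSpace.sphere_nonempty.2 zero_le_one) hF.continuous.continuousOn
    have hz0 : z ≠ 0 := by
      rintro rfl
      simp at hz
    have hc := hpos z hz0
    refine (isBounded_closedBall (x := (0 : E)) (r := max 1 (2 / F z))).subset ?_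
    intro x hx
    rw [mem_closedBall_zero_iff]
    rcases le_total ‖x‖ 1 with h1 | h1
    · exact h1.trans (le_max_left _ _)
    · refine le_trans ?_ (le_max_right _ _)
      have hxp : 0 < ‖x‖ := by linarith
      have hu : ‖x‖⁻¹ • x ∈ sphere (0 : E) 1 := by
        rw [mem_sphere_zero_iff_norm, norm_smul, norm_inv, norm_norm, inv_mul_cancel₀ hxp.ne']
      have h2 : F z ≤ F (‖x‖⁻¹ • x) := hmin hu
      have ex : x = ‖x‖ • (‖x‖⁻¹ • x) := by
        rw [smul_smul, mul_inv_cancel₀ hxp.ne', one_smul]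
      have h3 := hom ‖x‖ (‖x‖⁻¹ • x)
      rw [← ex] at h3
      have h4 : F x ≤ 2 := hx
      have h5 : ‖x‖ ≤ ‖x‖ ^ k := le_self_pow₀ h1 hk0
      rw [le_div_iff₀ hc]
      calc ‖x‖ * F z ≤ ‖x‖ ^ k * F (‖x‖⁻¹ • x) := by gcongr
        _ ≤ 2 := by rw [← h3]; exact h4
  obtain ⟨ρ, hρc, hρi, hρn, hrep⟩ := abs_rep F hF k hk hk0 hom hpos hbd
  have hIntg : ∀ (ρ' : E → ℝ), Continuous ρ' → (∀ y, |ρ' y| ≤ |ρ y|) → ∀ x : E,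
      Integrable (fun y => |inner ℝ x y| * ρ' y) := by
    intro ρ' hc hle x
    refine (hρn.const_mul ‖x‖).mono' (by fun_prop) (ae_of_all _ fun y => ?_)
    rw [norm_mul, Real.norm_eq_abs, Real.norm_eq_abs, abs_abs, ← mul_assoc]
    exact mul_le_mul (abs_real_inner_le_norm x y) (hle y) (abs_nonneg _) (by positivity)
  obtain ⟨A, hA, hAne, hAs⟩ := supp_of_sublinear (fun x => (F x) ^ ((k : ℝ)⁻¹))
    (by
      intro c hc x
      have hFx : 0 ≤ F x := Finset.sum_nonneg fun a _ => hnn a x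
      simp only [hom]
      rw [Real.mul_rpow (by positivity) hFx, Real.pow_rpow_inv_natCast hc.le hk0])
    (by
      intro x y
      have hp : (1 : ℝ) ≤ (k : ℝ) := by exact_mod_cast Nat.one_le_iff_ne_zero.2 hk0
      have h := Real.Lp_add_le T (fun a => (inner ℝ a x : ℝ)) (fun a => inner ℝ a y) hp
      simp only [Real.rpow_natCast, hk.pow_abs, one_div] at h
      simpa only [hFdef, inner_add_right] using h)
    (C := ∫ y, ‖y‖ * |ρ y|)
    (by
      intro x
      rw [hrep, mul_comm, ← integral_const_mul]
      refine integral_mono (hIntg ρ hρc (fun _ => le_rfl) x) (hρn.const_mul _) fun y => ?_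
      simp only [← mul_assoc]
      refine (le_abs_self _).trans ?_
      rw [abs_mul, abs_abs]
      exact mul_le_mul_of_nonneg_right (abs_real_inner_le_norm x y) (abs_nonneg _))
  obtain ⟨Zp, p1, p2, p3, p4⟩ := hm.zonoid_density hcyl ρ hρc hρi hρn
  obtain ⟨Zm, q1, q2, q3, q4⟩ := hm.zonoid_density hcyl (fun y => -ρ y) hρc.neg hρi.neg
    (by simpa only [abs_neg] using hρn)
  refine ⟨A, hA, hAne, hAs, ?_⟩
  have key : A + Zm = Zp := by
    refine Supp.unique (hA.add q1) (hAne.add q2) p1 p2 (hAs.add q3) ?_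
    convert p3 using 1
    ext x
    rw [hrep, ← integral_add (hIntg ρ hρc (fun _ => le_rfl) x)
      (hIntg (fun y => max (-ρ y) 0) (by fun_prop) (fun y => by
        rw [abs_of_nonneg (le_max_right _ _)]
        exact max_le (neg_le_abs _) (abs_nonneg _)) x)]
    congr 1
    ext y
    rw [← mul_add]
    congr 1
    rcases le_total (ρ y) 0 with h | h
    · rw [max_eq_left (by linarith), max_eq_right h]; ring
    · rw [max_eq_right (by linarith), max_eq_left h]; ring
  rw [← q4 A hA hAne, key, ← hm.singleton_zero 0, ← p4 {0} (CC.singleton 0) (singleton_nonempty _)]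
  simp

lemma Good.symZero [Nontrivial E] (hm : Good m) (hcyl : Cyl m) : SymZero m := by
  classical
  intro S hS hne hsym
  refine hm.lim_zero hS hne fun δ hδ => ?_
  obtain ⟨h, hh⟩ := supp_exists hS.2 hne
  set d := δ / 3 with hd
  have hdpos : 0 < d := by positivity
  obtain ⟨t, htS, htf, htc⟩ := hS.2.finite_cover_balls hdpos
  set b := stdOrthonormalBasis ℝ E with hb
  set T : Finset E := htf.toFinset ∪ Finset.univ.image (fun i => d • b i) with hTdef
  have hTsep : ∀ x : E, (∀ a ∈ T, inner ℝ a x = 0) → x = 0 := by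
    intro x hx
    refine InnerProductSpace.ext_inner_left_basis b.toBasis fun i => ?_
    have h1 := hx (d • b i) (by
      rw [hTdef]
      exact Finset.mem_union_right _ (Finset.mem_image_of_mem _ (Finset.mem_univ i)))
    rw [real_inner_smul_left] at h1
    rw [inner_zero_right, b.coe_toBasis]
    exact (mul_eq_zero.1 h1).resolve_left hdpos.ne'
  have habs : ∀ x, ∀ a ∈ S, |inner ℝ a x| ≤ h x := by
    intro x a ha
    rw [real_inner_comm, abs_le]
    refine ⟨?_, (hh x).1 a ha⟩
    have : -a ∈ S := by rw [← hsym]; simpa using ha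
    have := (hh x).1 _ this
    rw [inner_neg_right] at this
    linarith
  have hh0 : ∀ x, 0 ≤ h x := fun x => by
    obtain ⟨a, ha⟩ := hne
    exact (abs_nonneg _).trans (habs x a ha)
  have hTle : ∀ x, ∀ a ∈ T, |inner ℝ a x| ≤ h x + d * ‖x‖ := by
    intro x a ha
    rw [hTdef, Finset.mem_union] at ha
    rcases ha with ha | ha
    · have := habs x a (htS (htf.mem_toFinset.1 ha))
      have : 0 ≤ d * ‖x‖ := by positivity
      linarith
    · obtain ⟨i, -, rfl⟩ := Finset.mem_image.1 ha
      refine (abs_real_inner_le_norm _ _).trans ?_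
      rw [norm_smul, b.norm_eq_one, mul_one, Real.norm_eq_abs, abs_of_pos hdpos]
      linarith [hh0 x]
  have hTge : ∀ x, ∃ a ∈ T, h x ≤ |inner ℝ a x| + d * ‖x‖ := by
    intro x
    obtain ⟨y, hy, ey⟩ := (hh x).2
    obtain ⟨a, ha, hay⟩ := mem_iUnion₂.1 (htc hy)
    refine ⟨a, Finset.mem_union_left _ (htf.mem_toFinset.2 ha), ?_⟩
    have e : h x = inner ℝ a x + inner ℝ (y - a) x := by
      rw [inner_sub_left, ← ey, real_inner_comm]; ring
    have h1 : inner ℝ (y - a) x ≤ d * ‖x‖ := by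
      refine (real_inner_le_norm _ _).trans ?_
      refine mul_le_mul_of_nonneg_right ?_ (norm_nonneg _)
      rw [← dist_eq_norm]; exact (mem_ball.1 hay).le
    have h2 := le_abs_self (inner ℝ a x)
    linarith
  obtain ⟨R, hR0, hR⟩ : ∃ R : ℝ, 0 < R ∧ ∀ x, h x ≤ R * ‖x‖ := by
    obtain ⟨R, hR0, hR⟩ := hS.2.isBounded.exists_pos_norm_le
    refine ⟨R, hR0, fun x => ?_⟩
    obtain ⟨y, hy, ey⟩ := (hh x).2
    rw [← ey, mul_comm]
    exact (real_inner_le_norm _ _).trans (mul_le_mul_of_nonneg_left (hR y hy) (norm_nonneg _))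
  have hTne : T.Nonempty := by
    obtain ⟨a, ha, -⟩ := hTge 0
    exact ⟨a, ha⟩
  have hcard : (0 : ℝ) < T.card := by exact_mod_cast hTne.card_pos
  -- choose the exponent
  obtain ⟨k, hk, hk0, hkb⟩ : ∃ k : ℕ, Even k ∧ k ≠ 0 ∧
      (T.card : ℝ) ^ ((k : ℝ)⁻¹) ≤ 1 + d / (R + d) := by
    have h1 : Filter.Tendsto (fun n : ℕ => (T.card : ℝ) ^ ((n : ℝ)⁻¹)) Filter.atTop (nhds 1) := by
      have h2 := (Real.continuousAt_const_rpow (a := (T.card : ℝ)) (b := 0) hcard.ne').tendsto.comp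
        (tendsto_inv_atTop_nhds_zero_nat (𝕜 := ℝ))
      rw [Real.rpow_zero] at h2
      exact h2
    have h3 := h1.eventually_le_const (u := 1 + d / (R + d)) (by
      have : 0 < d / (R + d) := by positivity
      linarith)
    obtain ⟨n, hn⟩ := Filter.eventually_atTop.1 h3
    exact ⟨2 * (n + 1), even_two_mul _, by omega, hn _ (by omega)⟩
  obtain ⟨A, hA, hAne, hAs, hA0⟩ := hm.root_body hcyl T hTsep k hk hk0
  refine ⟨A, hA, hAne, ?_, hA0⟩
  refine Supp.near hS hne hA hAne hh hAs hδ.le fun x => ?_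
  have hnn : ∀ a x : E, 0 ≤ (inner ℝ a x : ℝ) ^ k := fun a x => hk.pow_nonneg _
  have hkR : (0 : ℝ) ≤ (k : ℝ)⁻¹ := by positivity
  have hu0 : 0 ≤ h x + d * ‖x‖ := by have := hh0 x; positivity
  have hup : (∑ a ∈ T, (inner ℝ a x : ℝ) ^ k) ^ ((k : ℝ)⁻¹) ≤
      (T.card : ℝ) ^ ((k : ℝ)⁻¹) * (h x + d * ‖x‖) := by
    have h1 : ∑ a ∈ T, (inner ℝ a x : ℝ) ^ k ≤ T.card * (h x + d * ‖x‖) ^ k := by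
      rw [← nsmul_eq_mul]
      refine Finset.sum_le_card_nsmul _ _ _ fun a ha => ?_
      rw [← hk.pow_abs]
      exact pow_le_pow_left₀ (abs_nonneg _) (hTle x a ha) k
    refine (Real.rpow_le_rpow (Finset.sum_nonneg fun a _ => hnn a x) h1 hkR).trans ?_
    rw [Real.mul_rpow hcard.le (by positivity), Real.pow_rpow_inv_natCast hu0 hk0]
  have hlow : h x ≤ (∑ a ∈ T, (inner ℝ a x : ℝ) ^ k) ^ ((k : ℝ)⁻¹) + d * ‖x‖ := by
    obtain ⟨a, ha, hax⟩ := hTge x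
    refine hax.trans ?_
    have h1 : |(inner ℝ a x : ℝ)| ^ k ≤ ∑ a ∈ T, (inner ℝ a x : ℝ) ^ k := by
      rw [hk.pow_abs]
      exact Finset.single_le_sum (f := fun a => (inner ℝ a x : ℝ) ^ k) (fun b _ => hnn b x) ha
    have h2 := Real.rpow_le_rpow (by positivity) h1 hkR
    rw [Real.pow_rpow_inv_natCast (abs_nonneg _) hk0] at h2
    linarith
  have hup2 : (T.card : ℝ) ^ ((k : ℝ)⁻¹) * (h x + d * ‖x‖) ≤ h x + d * ‖x‖ + d * ‖x‖ := by
    have h1 : (T.card : ℝ) ^ ((k : ℝ)⁻¹) * (h x + d * ‖x‖) ≤ (1 + d / (R + d)) * (h x + d * ‖x‖) :=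
      mul_le_mul_of_nonneg_right hkb hu0
    have h2 : d / (R + d) * (h x + d * ‖x‖) ≤ d / (R + d) * ((R + d) * ‖x‖) := by
      refine mul_le_mul_of_nonneg_left ?_ (by positivity)
      linarith [hR x]
    have h3 : d / (R + d) * ((R + d) * ‖x‖) = d * ‖x‖ := by field_simp
    linarith
  have hdx : 0 ≤ d * ‖x‖ := by positivity
  have hδd : δ * ‖x‖ = 3 * (d * ‖x‖) := by rw [hd]; ring
  rw [abs_le, hδd]
  constructor <;> linarith

/-- main conclusion of the functional-analytic part -/
lemma Good.zero_of_cyl [Nontrivial E] (hm : Good m) (hcyl : Cyl m) {S : Set E} (hS : CC S) :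
    m S = 0 :=
  hm.zero_of_symZero (hm.symZero hcyl) hS

end SymBodies
end Klain

namespace Klain

section Slice

variable {E : Type*} [NormedAddCommGroup E] [NormedSpace ℝ E]
variable {m : Set E → ℂ}

/-- projection onto the kernel of `l` along `v` -/
def slicePr (l : E →L[ℝ] ℝ) (v : E) (hv : l v ≠ 0) : E →L[ℝ] l.toLinearMap.ker :=
  (ContinuousLinearMap.id ℝ E - l.smulRight ((l v)⁻¹ • v)).codRestrict _ (by
    intro x
    rw [LinearMap.mem_ker]
    simp [hv])

lemma slicePr_add (l : E →L[ℝ] ℝ) (v : E) (hv : l v ≠ 0) (x : l.toLinearMap.ker) (t : ℝ) :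
    slicePr l v hv ((x : E) + t • v) = x := by
  have hx : l (x : E) = 0 := x.2
  apply Subtype.ext
  simp [slicePr, hx, smul_smul, hv]

/-- the induced function on the hyperplane -/
def sliceVal (m : Set E → ℂ) (l : E →L[ℝ] ℝ) (v : E) (T : Set l.toLinearMap.ker) : ℂ :=
  m (Subtype.val '' T + segment ℝ 0 v)

lemma CC.val_image {H : Submodule ℝ E} {T : Set H} (hT : CC T) : CC (Subtype.val '' T : Set E) :=
  ⟨hT.1.linear_image H.subtype, hT.2.image continuous_subtype_val⟩

lemma seg_neg (v : E) : -segment ℝ 0 v = {-v} + segment ℝ 0 v := by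
  ext x
  rw [mem_neg, mem_seg, singleton_add, mem_image]
  constructor
  · rintro ⟨t, h0, h1, e⟩
    refine ⟨(1 - t) • v, mem_seg.2 ⟨1 - t, by linarith, by linarith, rfl⟩, ?_⟩
    rw [← neg_neg x, e, sub_smul, one_smul]; abel
  · rintro ⟨y, hy, rfl⟩
    obtain ⟨t, h0, h1, rfl⟩ := mem_seg.1 hy
    refine ⟨1 - t, by linarith, by linarith, ?_⟩
    rw [sub_smul, one_smul]; abel

lemma Good.slice (hm : Good m) (l : E →L[ℝ] ℝ) (v : E) (hv : l v ≠ 0) :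
    Good (sliceVal m l v) := by
  have hLne : ∀ k : l.toLinearMap.ker →L[ℝ] ℝ, k ≠ 0 → k.comp (slicePr l v hv) ≠ 0 := by
    intro k hk h
    apply hk
    ext x
    have := DFunLike.congr_fun h (x : E)
    have h2 := slicePr_add l v hv x 0
    rw [zero_smul, add_zero] at h2
    rw [ContinuousLinearMap.comp_apply, h2] at this
    simpa using this
  constructor
  · simp [sliceVal, hm.empty]
  · intro A B hA hB hU k hk c hAB
    simp only [sliceVal, image_union, union_add]
    refine hm.glue _ _ (hA.val_image.add (CC.segment _ _)) (hB.val_image.add (CC.segment _ _)) ?_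
      (k.comp (slicePr l v hv)) (hLne k hk) c ?_
    · rw [← union_add, ← image_union]
      exact (hU.linear_image (l.toLinearMap.ker).subtype).add (convex_segment _ _)
    · rintro x ⟨h1, h2⟩
      obtain ⟨_, ⟨a, ha, rfl⟩, t, -, -, rfl⟩ := mem_add_seg.1 h1
      obtain ⟨_, ⟨b, hb, rfl⟩, s, -, -, e⟩ := mem_add_seg.1 h2
      have e' := congrArg (slicePr l v hv) e
      rw [slicePr_add, slicePr_add] at e'
      subst e'
      change k (slicePr l v hv (a + t • v)) = c
      rw [slicePr_add]
      exact hAB ⟨ha, hb⟩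
  · intro A hA k hk c hAc
    refine hm.flat _ (hA.val_image.add (CC.segment _ _)) (k.comp (slicePr l v hv)) (hLne k hk) c ?_
    intro x h1
    obtain ⟨_, ⟨a, ha, rfl⟩, t, -, -, rfl⟩ := mem_add_seg.1 h1
    change k (slicePr l v hv (a + t • v)) = c
    rw [slicePr_add]
    exact hAc ha
  · intro A hA x
    have : (Subtype.val '' ({x} + A) : Set E) = {(x : E)} + Subtype.val '' A := by
      simp only [singleton_add, image_image, Submodule.coe_add]
    rw [sliceVal, this, add_assoc, hm.trans _ (hA.val_image.add (CC.segment _ _))]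
    rfl
  · intro A hA
    have h1 : (Subtype.val '' (-A) : Set E) = - (Subtype.val '' A) := by
      simp only [← image_neg_eq_neg, image_image, Submodule.coe_neg]
    have h2 : {-v} + (-(Subtype.val '' A) + segment ℝ 0 v) =
        -(Subtype.val '' A + segment ℝ 0 v) := by
      rw [neg_add, seg_neg, ← add_assoc, ← add_assoc, add_comm {-v}]
    have hc := hA.val_image
    rw [sliceVal, h1, ← hm.trans _ (hc.neg.add (CC.segment _ _)) (-v), h2,
      hm.even _ (hc.add (CC.segment _ _))]
    rfl
  · intro A hA hne ε hε
    obtain ⟨δ, hδ, H⟩ := hm.cont _ (hA.val_image.add (CC.segment 0 v))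
      ((hne.image _).add ⟨0, left_mem_segment _ _ _⟩) ε hε
    refine ⟨δ, hδ, fun B hB hBne hnear => ?_⟩
    refine H _ (hB.val_image.add (CC.segment 0 v)) ((hBne.image _).add ⟨0, left_mem_segment _ _ _⟩) ?_
    refine Near.add_right ?_ _
    constructor
    · rintro _ ⟨x, hx, rfl⟩
      obtain ⟨y, hy, hd⟩ := hnear.1 x hx
      exact ⟨_, ⟨y, hy, rfl⟩, hd⟩
    · rintro _ ⟨x, hx, rfl⟩
      obtain ⟨y, hy, hd⟩ := hnear.2 x hx
      exact ⟨_, ⟨y, hy, rfl⟩, hd⟩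

end Slice

universe u

theorem Good.zero_of_par (n : ℕ) : ∀ {E : Type u} [NormedAddCommGroup E] [InnerProductSpace ℝ E]
    [FiniteDimensional ℝ E] (_ : Module.finrank ℝ E = n) (m : Set E → ℂ) (_ : Good m)
    (_ : ∀ w : Fin n → E, m (parallelepiped w) = 0) (S : Set E) (_ : CC S), m S = 0 := by
  induction n with
  | zero =>
    intro E _ _ _ hE m hm hpar S hS
    have : Subsingleton E := Module.finrank_zero_iff.1 hE
    rcases S.eq_empty_or_nonempty with rfl | hne
    · exact hm.empty
    · rw [← hpar 0, Subsingleton.eq_univ_of_nonempty hne]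
      congr 1
      symm
      apply Subsingleton.eq_univ_of_nonempty
      rw [parallelepiped_eq_sum_segment]
      simp
  | succ n ih =>
    intro E _ _ _ hE m hm hpar S hS
    have : Nontrivial E := Module.nontrivial_of_finrank_pos (R := ℝ) (by omega)
    refine hm.zero_of_cyl ?_ hS
    intro S hS l c v hv hSc
    have hfin : Module.finrank ℝ l.toLinearMap.ker = n := by
      have h1 := LinearMap.finrank_range_add_finrank_ker l.toLinearMap
      have h2 : l.toLinearMap.range = ⊤ := by
        rw [LinearMap.range_eq_top]
        intro t
        refine ⟨(t / l v) • v, ?_⟩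
        simp [hv]
      rw [h2, finrank_top, Module.finrank_self, hE] at h1
      omega
    have hz := ih hfin (sliceVal m l v) (hm.slice l v hv) (by
      intro w
      have h := hpar (Fin.cons v (fun i => (w i : E)))
      rw [parallelepiped_eq_sum_segment, Fin.sum_univ_succ] at h
      simp only [Fin.cons_zero, Fin.cons_succ] at h
      have h2 := image_parallelepiped (l.toLinearMap.ker).subtype w
      rw [sliceVal, add_comm]
      have h3 : (Subtype.val '' parallelepiped w : Set E) = ∑ i, segment ℝ 0 (w i : E) := by
        rw [← parallelepiped_eq_sum_segment]
        exact h2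
      rw [h3]
      exact h)
    set x0 := (c / l v) • v with hx0
    have hlx0 : l x0 = c := by simp [hx0, hv]
    set T : Set l.toLinearMap.ker := Subtype.val ⁻¹' ({-x0} + S) with hT
    have hTS : (Subtype.val '' T : Set E) = {-x0} + S := by
      apply Subset.antisymm
      · rintro _ ⟨x, hx, rfl⟩
        exact hx
      · intro x hx
        refine ⟨⟨x, ?_⟩, hx, rfl⟩
        obtain ⟨_, rfl, y, hy, rfl⟩ := hx
        have hly : l y = c := hSc hy
        simp [hly, hlx0]
    have hS' : CC ({-x0} + S) := (CC.singleton _).add hS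
    have hTC : CC T := by
      refine ⟨hS'.1.linear_preimage (l.toLinearMap.ker).subtype, ?_⟩
      exact (Submodule.closed_of_finiteDimensional _).isClosedEmbedding_subtypeVal.isCompact_preimage hS'.2
    have h := hz T hTC
    rw [sliceVal, hTS, add_assoc, hm.trans _ (hS.add (CC.segment _ _))] at h
    exact h

end Klain

namespace Klain

section Par

variable {E : Type*} [NormedAddCommGroup E] [NormedSpace ℝ E]
variable {m : Set E → ℂ}

lemma CC.sum {ι : Type*} (s : Finset ι) (A : ι → Set E) (h : ∀ i ∈ s, CC (A i)) :
    CC (∑ i ∈ s, A i) := by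
  classical
  induction s using Finset.induction_on with
  | empty => exact CC.singleton (0 : E)
  | insert a s ha ih =>
    rw [Finset.sum_insert ha]
    exact (h a (Finset.mem_insert_self a s)).add (ih fun i hi => h i (Finset.mem_insert_of_mem hi))

lemma sum_nonempty {ι : Type*} (s : Finset ι) (A : ι → Set E) (h : ∀ i ∈ s, (A i).Nonempty) :
    (∑ i ∈ s, A i).Nonempty := by
  classical
  induction s using Finset.induction_on with
  | empty => simp
  | insert a s ha ih =>
    rw [Finset.sum_insert ha]
    exact (h a (Finset.mem_insert_self a s)).add (ih fun i hi => h i (Finset.mem_insert_of_mem hi))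

lemma sum_seg_subset {ι : Type*} (s : Finset ι) (w : ι → E) (l : E →L[ℝ] ℝ)
    (h : ∀ i ∈ s, l (w i) = 0) : ∑ i ∈ s, segment ℝ 0 (w i) ⊆ {x | l x = 0} := by
  classical
  induction s using Finset.induction_on with
  | empty => intro x hx; simp at hx; simp [hx]
  | insert a s ha ih =>
    rw [Finset.sum_insert ha]
    rintro _ ⟨x, hx, y, hy, rfl⟩
    obtain ⟨t, -, -, rfl⟩ := mem_seg.1 hx
    have h1 := h a (Finset.mem_insert_self a s)
    have h2 : l y = 0 := ih (fun i hi => h i (Finset.mem_insert_of_mem hi)) hy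
    change l (t • w a + y) = 0
    rw [map_add, map_smul, h1, h2]; simp

lemma seg_smul_neg (x : E) : segment ℝ 0 (-x) = {-x} + segment ℝ 0 x := by
  rw [← seg_neg, segment_eq_image', segment_eq_image', ← image_neg_eq_neg, image_image]
  apply image_congr
  intro t _
  simp

lemma Good.seg_add (hm : Good m) {C : Set E} (hC : CC C) {l : E →L[ℝ] ℝ}
    (hCl : C ⊆ {x | l x = 0}) {x : E} (hx : 0 < l x) {s t : ℝ} (hs : 0 ≤ s) (ht : 0 ≤ t) :
    m (C + segment ℝ 0 ((s + t) • x)) = m (C + segment ℝ 0 (s • x)) + m (C + segment ℝ 0 (t • x)) := by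
  have hl : l ≠ 0 := by rintro rfl; simp at hx
  rw [hm.cut (hC.add (CC.segment _ _)) hl (s * l x)]
  congr 1
  · congr 1
    apply Subset.antisymm
    · rintro y ⟨hy, hy2⟩
      obtain ⟨c, hc, r, h0, h1, rfl⟩ := mem_add_seg.1 hy
      have hlc : l c = 0 := hCl hc
      have h2 : l (c + r • (s + t) • x) ≤ s * l x := hy2
      rw [map_add, map_smul, map_smul, hlc, zero_add, smul_eq_mul, smul_eq_mul, ← mul_assoc] at h2
      have h3 : r * (s + t) ≤ s := le_of_mul_le_mul_right h2 hx
      rcases hs.eq_or_lt with h4 | h4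
      · have : r * (s + t) = 0 := le_antisymm (by linarith) (by positivity)
        exact mem_add_seg.2 ⟨c, hc, 0, le_rfl, zero_le_one, by rw [smul_smul, this]; simp⟩
      · refine mem_add_seg.2 ⟨c, hc, r * (s + t) / s, by positivity, (div_le_one h4).2 h3, ?_⟩
        rw [smul_smul, smul_smul]
        congr 2
        field_simp
    · intro y hy
      obtain ⟨c, hc, r, h0, h1, rfl⟩ := mem_add_seg.1 hy
      have hlc : l c = 0 := hCl hc
      constructor
      · rcases (add_nonneg hs ht).eq_or_lt with h4 | h4
        · have : s = 0 := by linarith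
          exact mem_add_seg.2 ⟨c, hc, 0, le_rfl, zero_le_one, by rw [this]; simp⟩
        · refine mem_add_seg.2 ⟨c, hc, r * s / (s + t), by positivity, ?_, ?_⟩
          · rw [div_le_one h4]; nlinarith
          · rw [smul_smul, smul_smul]
            congr 2
            field_simp
      · change l (c + r • s • x) ≤ s * l x
        rw [map_add, map_smul, map_smul, hlc, zero_add, smul_eq_mul, smul_eq_mul]
        exact mul_le_of_le_one_left (by positivity) h1
  · rw [← hm.trans (C + segment ℝ 0 (t • x)) (hC.add (CC.segment _ _)) (s • x)]
    congr 1
    apply Subset.antisymm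
    · rintro y ⟨hy, hy2⟩
      obtain ⟨c, hc, r, h0, h1, rfl⟩ := mem_add_seg.1 hy
      have hlc : l c = 0 := hCl hc
      have h2 : s * l x ≤ l (c + r • (s + t) • x) := hy2
      rw [map_add, map_smul, map_smul, hlc, zero_add, smul_eq_mul, smul_eq_mul, ← mul_assoc] at h2
      have h3 : s ≤ r * (s + t) := le_of_mul_le_mul_right h2 hx
      rw [singleton_add]
      rcases ht.eq_or_lt with h4 | h4
      · refine ⟨c, mem_add_seg.2 ⟨c, hc, 0, le_rfl, zero_le_one, by simp⟩, ?_⟩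
        have : r * (s + t) = s := by
          rw [← h4, add_zero] at h3 ⊢
          exact le_antisymm (mul_le_of_le_one_left hs h1) h3
        rw [smul_smul, this]; simp only [add_comm]
      · refine ⟨c + ((r * (s + t) - s) / t) • t • x, mem_add_seg.2 ⟨c, hc, _, ?_, ?_, rfl⟩, ?_⟩
        · exact div_nonneg (by linarith) ht
        · rw [div_le_one h4]; nlinarith
        · have e : (r * (s + t) - s) / t * t = r * (s + t) - s := by field_simp
          simp only [smul_smul]
          rw [e, sub_smul]; abel
    · rintro y hy
      rw [singleton_add] at hy
      obtain ⟨z, hz, rfl⟩ := hy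
      obtain ⟨c, hc, r, h0, h1, rfl⟩ := mem_add_seg.1 hz
      have hlc : l c = 0 := hCl hc
      constructor
      · rcases (add_nonneg hs ht).eq_or_lt with h4 | h4
        · have e1 : s = 0 := by linarith
          have e2 : t = 0 := by linarith
          exact mem_add_seg.2 ⟨c, hc, 0, le_rfl, zero_le_one, by simp [e1, e2]⟩
        · refine mem_add_seg.2 ⟨c, hc, (s + r * t) / (s + t), by positivity, ?_, ?_⟩
          · rw [div_le_one h4]; nlinarith
          · have e : (s + r * t) / (s + t) * (s + t) = s + r * t := by field_simp
            simp only [smul_smul]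
            rw [e, add_smul]; abel
      · change s * l x ≤ l (s • x + (c + r • t • x))
        rw [map_add, map_add, map_smul, map_smul, map_smul, hlc, zero_add]
        simp only [smul_eq_mul]
        have : 0 ≤ r * (t * l x) := by positivity
        linarith

lemma near_seg (C : Set E) (x : E) (s t : ℝ) {δ : ℝ} (h : |s - t| * ‖x‖ ≤ δ) :
    Near δ (C + segment ℝ 0 (s • x)) (C + segment ℝ 0 (t • x)) := by
  have key : ∀ s t : ℝ, |s - t| * ‖x‖ ≤ δ → ∀ y ∈ segment ℝ 0 (s • x),
      ∃ z ∈ segment ℝ 0 (t • x), dist y z ≤ δ := by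
    intro s t h y hy
    obtain ⟨r, h0, h1, rfl⟩ := mem_seg.1 hy
    refine ⟨_, mem_seg.2 ⟨r, h0, h1, rfl⟩, ?_⟩
    rw [dist_eq_norm, ← smul_sub, ← sub_smul, norm_smul, norm_smul, Real.norm_eq_abs,
      Real.norm_eq_abs, abs_of_nonneg h0]
    refine le_trans ?_ h
    exact mul_le_of_le_one_left (by positivity) h1
  refine Near.add_left ⟨key s t h, fun y hy => ?_⟩ C
  obtain ⟨z, hz, hd⟩ := key t s (by rwa [abs_sub_comm]) y hy
  exact ⟨z, hz, by rwa [dist_comm]⟩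

lemma Good.scale (hm : Good m) {C : Set E} (hC : CC C) (hne : C.Nonempty) {l : E →L[ℝ] ℝ}
    (hCl : C ⊆ {x | l x = 0}) {x : E} (hx : 0 < l x)
    (h0 : m (C + segment ℝ 0 x) = 0) (t : ℝ) : m (C + segment ℝ 0 (t • x)) = 0 := by
  have hnat : ∀ (n : ℕ) (s : ℝ), 0 ≤ s → m (C + segment ℝ 0 (((n : ℝ) * s) • x)) =
      n * m (C + segment ℝ 0 (s • x)) := by
    intro n s hs
    have hz : m (C + segment ℝ 0 ((0 : ℝ) • x)) = 0 := by
      have := hm.seg_add hC hCl hx (le_refl 0) (le_refl 0)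
      rw [add_zero] at this
      simpa using this
    induction n with
    | zero => rw [Nat.cast_zero, zero_mul, hz]; simp
    | succ n ih =>
      have : ((n + 1 : ℕ) : ℝ) * s = n * s + s := by push_cast; ring
      rw [this, hm.seg_add hC hCl hx (by positivity) hs, ih]
      push_cast; ring
  have hrat : ∀ q : ℚ, 0 < q → m (C + segment ℝ 0 ((q : ℝ) • x)) = 0 := by
    intro q hq
    have hd : (q.den : ℝ) ≠ 0 := by exact_mod_cast q.den_nz
    have h1 := hnat q.den q (by exact_mod_cast hq.le)
    have h2 := hnat q.num.toNat 1 zero_le_one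
    have e : (q.den : ℝ) * q = (q.num.toNat : ℝ) * 1 := by
      have e1 : ((q.num.toNat : ℤ) : ℝ) = (q.num : ℝ) := by
        rw [Int.toNat_of_nonneg (Rat.num_nonneg.2 hq.le)]
      have e2 : (q.den : ℚ) * q = q.num := by rw [mul_comm]; exact Rat.mul_den_eq_num q
      have e3 : (q.den : ℝ) * (q : ℝ) = (q.num : ℝ) := by exact_mod_cast e2
      rw [e3, ← e1, mul_one, Int.cast_natCast]
    rw [e, h2, one_smul, h0, mul_zero] at h1
    have hd' : (q.den : ℂ) ≠ 0 := by exact_mod_cast q.den_nz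
    exact (mul_eq_zero.1 h1.symm).resolve_left hd'
  have hpos : ∀ t : ℝ, 0 ≤ t → m (C + segment ℝ 0 (t • x)) = 0 := by
    intro t ht
    refine hm.lim_zero (hC.add (CC.segment _ _)) (hne.add ⟨0, left_mem_segment _ _ _⟩) fun δ hδ => ?_
    obtain ⟨q, hq1, hq2⟩ := exists_rat_btwn (show t < t + δ / (‖x‖ + 1) by
      have : 0 < δ / (‖x‖ + 1) := by positivity
      linarith)
    refine ⟨_, hC.add (CC.segment _ _), hne.add ⟨0, left_mem_segment _ _ _⟩,
      near_seg C x t q ?_, hrat q (by exact_mod_cast lt_of_le_of_lt ht hq1)⟩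
    rw [abs_sub_comm, abs_of_pos (by linarith)]
    have h3 : (q : ℝ) - t ≤ δ / (‖x‖ + 1) := by linarith
    calc ((q : ℝ) - t) * ‖x‖ ≤ δ / (‖x‖ + 1) * (‖x‖ + 1) := by
          apply mul_le_mul h3 (by linarith) (norm_nonneg _) (by positivity)
      _ = δ := by field_simp
  rcases le_total 0 t with ht | ht
  · exact hpos t ht
  · have h1 := hpos (-t) (by linarith)
    have e : t • x = -((-t) • x) := by rw [neg_smul, neg_neg]
    rw [e, seg_smul_neg, add_left_comm, hm.trans _ (hC.add (CC.segment _ _))]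
    exact h1

lemma Good.shear (hm : Good m) {C : Set E} (hC : CC C) {l1 l2 : E →L[ℝ] ℝ} {x y : E}
    (h1 : C ⊆ {z | l1 z = 0}) (h2 : C ⊆ {z | l2 z = 0}) (h1x : l1 x = 1) (h1y : l1 y = 0)
    (h2x : l2 x = 0) (h2y : l2 y = 1) :
    m (C + segment ℝ 0 x + segment ℝ 0 (y + x)) = m (C + segment ℝ 0 x + segment ℝ 0 y) := by
  have hl : l1 ≠ 0 := by rintro rfl; simp at h1x
  have hl' : l1 - l2 ≠ 0 := by
    intro h
    have := DFunLike.congr_fun h x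
    simp [h1x, h2x] at this
  have memP : ∀ u z : E, z ∈ C + segment ℝ 0 x + segment ℝ 0 u ↔ ∃ c ∈ C, ∃ a b : ℝ,
      0 ≤ a ∧ a ≤ 1 ∧ 0 ≤ b ∧ b ≤ 1 ∧ z = c + a • x + b • u := by
    intro u z
    constructor
    · intro hz
      obtain ⟨_, hw, b, hb0, hb1, rfl⟩ := mem_add_seg.1 hz
      obtain ⟨c, hc, a, ha0, ha1, rfl⟩ := mem_add_seg.1 hw
      exact ⟨c, hc, a, b, ha0, ha1, hb0, hb1, rfl⟩
    · rintro ⟨c, hc, a, b, ha0, ha1, hb0, hb1, rfl⟩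
      exact mem_add_seg.2 ⟨_, mem_add_seg.2 ⟨c, hc, a, ha0, ha1, rfl⟩, b, hb0, hb1, rfl⟩
  have hP : CC (C + segment ℝ 0 x + segment ℝ 0 y) := (hC.add (CC.segment _ _)).add (CC.segment _ _)
  have hQ : CC (C + segment ℝ 0 x + segment ℝ 0 (y + x)) :=
    (hC.add (CC.segment _ _)).add (CC.segment _ _)
  rw [hm.cut hP hl' 0, hm.cut hQ hl 1, add_comm]
  have v1 : ∀ c ∈ C, ∀ a b : ℝ, l1 (c + a • x + b • y) = a := by
    intro c hc a b
    have : l1 c = 0 := h1 hc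
    simp [this, h1x, h1y]
  have v2 : ∀ c ∈ C, ∀ a b : ℝ, l2 (c + a • x + b • y) = b := by
    intro c hc a b
    have : l2 c = 0 := h2 hc
    simp [this, h2x, h2y]
  have e0 : ∀ (c : E) (a b : ℝ), c + a • x + b • (y + x) = c + (a + b) • x + b • y := by
    intro c a b
    rw [smul_add, add_smul]; abel
  congr 1
  · rw [← hm.trans _ (hP.inter (convex_le _ _) (closed_le _ _)) x]
    congr 1
    apply Subset.antisymm
    · rintro z ⟨hz, hz2⟩
      obtain ⟨c, hc, a, b, ha0, ha1, hb0, hb1, rfl⟩ := (memP _ _).1 hz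
      have hz3 : 1 ≤ l1 (c + a • x + b • (y + x)) := hz2
      rw [e0, v1 c hc] at hz3
      rw [singleton_add]
      refine ⟨c + (a + b - 1) • x + b • y, ⟨(memP _ _).2
        ⟨c, hc, a + b - 1, b, by linarith, by linarith, hb0, hb1, rfl⟩, ?_⟩, ?_⟩
      · change (l1 - l2) _ ≤ 0
        rw [sub_apply, v1 c hc, v2 c hc]; linarith
      · simp only
        rw [e0, sub_smul, one_smul]; abel
    · intro z hz
      rw [singleton_add] at hz
      obtain ⟨_, ⟨hz, hz2⟩, rfl⟩ := hz
      obtain ⟨c, hc, a, b, ha0, ha1, hb0, hb1, rfl⟩ := (memP _ _).1 hz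
      have hz3 : (l1 - l2) (c + a • x + b • y) ≤ 0 := hz2
      rw [sub_apply, v1 c hc, v2 c hc] at hz3
      have e1 : x + (c + a • x + b • y) = c + (1 + a) • x + b • y := by
        rw [add_smul, one_smul]; abel
      constructor
      · refine (memP _ _).2 ⟨c, hc, 1 + a - b, b, by linarith, by linarith, hb0, hb1, ?_⟩
        simp only
        rw [e0, e1]; congr 3; ring
      · change 1 ≤ l1 _
        simp only
        rw [e1, v1 c hc]; linarith
  · congr 1
    apply Subset.antisymm
    · rintro z ⟨hz, hz2⟩
      obtain ⟨c, hc, a, b, ha0, ha1, hb0, hb1, rfl⟩ := (memP _ _).1 hz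
      have hz3 : l1 (c + a • x + b • (y + x)) ≤ 1 := hz2
      rw [e0, v1 c hc] at hz3
      rw [e0]
      refine ⟨(memP _ _).2 ⟨c, hc, a + b, b, by linarith, by linarith, hb0, hb1, rfl⟩, ?_⟩
      change 0 ≤ (l1 - l2) _
      rw [sub_apply, v1 c hc, v2 c hc]; linarith
    · rintro z ⟨hz, hz2⟩
      obtain ⟨c, hc, a, b, ha0, ha1, hb0, hb1, rfl⟩ := (memP _ _).1 hz
      have hz3 : 0 ≤ (l1 - l2) (c + a • x + b • y) := hz2
      rw [sub_apply, v1 c hc, v2 c hc] at hz3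
      constructor
      · refine (memP _ _).2 ⟨c, hc, a - b, b, by linarith, by linarith, hb0, hb1, ?_⟩
        rw [e0]; congr 3; ring
      · change l1 _ ≤ 1
        rw [v1 c hc]; linarith

end Par

section ParMatrix

variable {E : Type*} [NormedAddCommGroup E] [NormedSpace ℝ E] [FiniteDimensional ℝ E]
variable {m : Set E → ℂ} {n : ℕ}

lemma cc_par (w : Fin n → E) : CC (parallelepiped w) := by
  rw [parallelepiped_eq_sum_segment]
  exact CC.sum _ _ fun i _ => CC.segment _ _

lemma Good.par_flat (hm : Good m) (w : Fin n → E) (h : Submodule.span ℝ (range w) ≠ ⊤) :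
    m (parallelepiped w) = 0 := by
  obtain ⟨f, hf, hle⟩ := Submodule.exists_le_ker_of_lt_top _ (lt_top_iff_ne_top.2 h)
  refine hm.flat _ (cc_par w) (LinearMap.toContinuousLinearMap f) ?_ 0 ?_
  · intro h0
    apply hf
    ext x
    exact DFunLike.congr_fun h0 x
  · rw [parallelepiped_eq_sum_segment]
    refine sum_seg_subset _ _ _ fun i _ => ?_
    exact hle (Submodule.subset_span (mem_range_self i))

lemma exists_coord (hE : Module.finrank ℝ E = n) (w : Fin n → E)
    (h : Submodule.span ℝ (range w) = ⊤) :
    ∃ l : Fin n → (E →L[ℝ] ℝ), ∀ i j, l i (w j) = if i = j then 1 else 0 := by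
  classical
  let B := basisOfTopLeSpanOfCardEqFinrank w h.ge (by simp [hE])
  have hB : ∀ j, w j = B j := fun j => by simp [B]
  refine ⟨fun i => LinearMap.toContinuousLinearMap (B.coord i), fun i j => ?_⟩
  rw [hB j, LinearMap.coe_toContinuousLinearMap', Module.Basis.coord_apply, Module.Basis.repr_self,
    Finsupp.single_apply]
  simp only [eq_comm]

lemma par_update (w : Fin n → E) (i : Fin n) (x : E) :
    parallelepiped (Function.update w i x) =
      (∑ k ∈ Finset.univ.erase i, segment ℝ 0 (w k)) + segment ℝ 0 x := by
  rw [parallelepiped_eq_sum_segment, ← Finset.sum_erase_add _ _ (Finset.mem_univ i),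
    Function.update_self]
  congr 1
  refine Finset.sum_congr rfl fun k hk => ?_
  rw [Function.update_of_ne (Finset.ne_of_mem_erase hk)]

lemma par_update2 (w : Fin n → E) {i j : Fin n} (hij : i ≠ j) (x : E) :
    parallelepiped (Function.update w j x) =
      (∑ k ∈ (Finset.univ.erase j).erase i, segment ℝ 0 (w k)) + segment ℝ 0 (w i)
        + segment ℝ 0 x := by
  rw [par_update, Finset.sum_erase_add _ _ (Finset.mem_erase.2 ⟨hij, Finset.mem_univ i⟩)]

lemma span_update_le (w : Fin n → E) (i : Fin n) (x : E) (hx : x ∈ Submodule.span ℝ (range w)) :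
    Submodule.span ℝ (range (Function.update w i x)) ≤ Submodule.span ℝ (range w) := by
  rw [Submodule.span_le]
  rintro _ ⟨k, rfl⟩
  by_cases hk : k = i
  · subst hk; rw [Function.update_self]; exact hx
  · rw [Function.update_of_ne hk]; exact Submodule.subset_span (mem_range_self k)

lemma Good.par_scale (hm : Good m) (hE : Module.finrank ℝ E = n) (w : Fin n → E)
    (h0 : m (parallelepiped w) = 0) (i : Fin n) (t : ℝ) :
    m (parallelepiped (Function.update w i (t • w i))) = 0 := by
  by_cases hs : Submodule.span ℝ (range w) = ⊤
  · obtain ⟨l, hl⟩ := exists_coord hE w hs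
    rw [par_update]
    rw [← Function.update_eq_self i w, par_update] at h0
    refine hm.scale (CC.sum _ _ fun k _ => CC.segment _ _)
      (sum_nonempty _ _ fun k _ => ⟨0, left_mem_segment _ _ _⟩) (l := l i) ?_ ?_ h0 t
    · refine sum_seg_subset _ _ _ fun k hk => ?_
      rw [hl, if_neg (Finset.ne_of_mem_erase hk).symm]
    · rw [hl, if_pos rfl]; norm_num
  · refine hm.par_flat _ fun h => hs (top_unique ?_)
    rw [← h]
    exact span_update_le w i _ (Submodule.smul_mem _ _ (Submodule.subset_span (mem_range_self i)))

lemma Good.par_shear (hm : Good m) (hE : Module.finrank ℝ E = n) (w : Fin n → E)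
    (h0 : m (parallelepiped w) = 0) {i j : Fin n} (hij : i ≠ j) :
    m (parallelepiped (Function.update w j (w j + w i))) = 0 := by
  by_cases hs : Submodule.span ℝ (range w) = ⊤
  · obtain ⟨l, hl⟩ := exists_coord hE w hs
    rw [par_update2 w hij]
    rw [← Function.update_eq_self j w, par_update2 w hij] at h0
    rw [hm.shear (CC.sum _ _ fun k _ => CC.segment _ _) (l1 := l i) (l2 := l j) ?_ ?_ ?_ ?_ ?_ ?_, h0]
    · refine sum_seg_subset _ _ _ fun k hk => ?_
      rw [hl, if_neg (Finset.ne_of_mem_erase hk).symm]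
    · refine sum_seg_subset _ _ _ fun k hk => ?_
      rw [hl, if_neg (Finset.ne_of_mem_erase (Finset.mem_of_mem_erase hk)).symm]
    · rw [hl, if_pos rfl]
    · rw [hl, if_neg hij]
    · rw [hl, if_neg hij.symm]
    · rw [hl, if_pos rfl]
  · refine hm.par_flat _ fun h => hs (top_unique ?_)
    rw [← h]
    exact span_update_le w j _ (Submodule.add_mem _ (Submodule.subset_span (mem_range_self j))
      (Submodule.subset_span (mem_range_self i)))

lemma Good.par_transvection (hm : Good m) (hE : Module.finrank ℝ E = n) (w : Fin n → E)
    (h0 : m (parallelepiped w) = 0) {i j : Fin n} (hij : i ≠ j) (c : ℝ) :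
    m (parallelepiped (Function.update w j (w j + c • w i))) = 0 := by
  by_cases hc : c = 0
  · rw [hc, zero_smul, add_zero, Function.update_eq_self]; exact h0
  have h1 := hm.par_scale hE w h0 i c
  have h2 := hm.par_shear hE _ h1 hij
  have h3 := hm.par_scale hE _ h2 i c⁻¹
  convert h3 using 2
  congr 1
  ext k
  by_cases hki : k = i
  · subst hki
    simp [Function.update_of_ne hij, hc]
  · by_cases hkj : k = j
    · subst hkj
      simp [Function.update_of_ne hij.symm]
    · simp [Function.update_of_ne hki, Function.update_of_ne hkj]

lemma Good.par_diag (hm : Good m) (hE : Module.finrank ℝ E = n) (w : Fin n → E)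
    (h0 : m (parallelepiped w) = 0) (D : Fin n → ℝ) (s : Finset (Fin n)) :
    m (parallelepiped (fun k => if k ∈ s then D k • w k else w k)) = 0 := by
  classical
  induction s using Finset.induction_on with
  | empty => simpa using h0
  | insert a s ha ih =>
    have h := hm.par_scale hE _ ih a (D a)
    convert h using 2
    congr 1
    ext k
    by_cases hk : k = a
    · subst hk; simp [ha]
    · simp [Function.update_of_ne hk, hk]

/-- if `m` vanishes on one nondegenerate parallelepiped, it vanishes on all -/
lemma Good.par_all (hm : Good m) (hE : Module.finrank ℝ E = n) (b : Module.Basis (Fin n) ℝ E)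
    (h0 : m (parallelepiped b) = 0) (w : Fin n → E) : m (parallelepiped w) = 0 := by
  classical
  by_cases hs : Submodule.span ℝ (range w) = ⊤
  swap
  · exact hm.par_flat w hs
  have hli : LinearIndependent ℝ w :=
    linearIndependent_of_top_le_span_of_card_eq_finrank hs.ge (by simp [hE])
  have hdet : (b.toMatrix w).det ≠ 0 := by
    have := (Module.Basis.is_basis_iff_det b).1 ⟨hli, hs⟩
    rw [Module.Basis.det_apply] at this
    exact this.ne_zero
  have key := Matrix.diagonal_transvection_induction_of_det_ne_zero
    (fun M : Matrix (Fin n) (Fin n) ℝ => ∀ w : Fin n → E, m (parallelepiped w) = 0 →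
      m (parallelepiped (fun j => ∑ i, M i j • w i)) = 0) (b.toMatrix w) hdet ?_ ?_ ?_
  · have := key b h0
    convert this using 3
    ext j
    exact (b.sum_toMatrix_smul_self w j).symm
  · intro D _ w hw
    have h := hm.par_diag hE w hw D Finset.univ
    convert h using 3
    ext j
    simp [Matrix.diagonal_apply]
  · intro t w hw
    have h := hm.par_transvection hE w hw t.hij t.c
    convert h using 3
    ext k
    simp only [Matrix.TransvectionStruct.toMatrix, Matrix.transvection, Matrix.add_apply, add_smul,
      Finset.sum_add_distrib]
    by_cases hk : k = t.j
    · subst hk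
      simp [Matrix.one_apply, Matrix.single_apply]
    · simp [Matrix.one_apply, Matrix.single_apply, Function.update_of_ne hk, Ne.symm hk]
  · intro A B _ _ hA hB w hw
    have h := hB _ (hA w hw)
    convert h using 3
    ext j
    simp only [Matrix.mul_apply, Finset.sum_smul, Finset.smul_sum, smul_smul]
    rw [Finset.sum_comm]
    refine Finset.sum_congr rfl fun k _ => Finset.sum_congr rfl fun i _ => ?_
    rw [mul_comm]

end ParMatrix
end Klain

namespace Klain

section Vol

variable {E : Type*} [NormedAddCommGroup E] [InnerProductSpace ℝ E] [FiniteDimensional ℝ E]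

lemma mem_of_near {A B : Set E} (hB : CC B) {x : E} {r δ : ℝ} (hr : 0 < r)
    (hx : closedBall x r ⊆ A) (hδ : δ < r) (hn : Near δ A B) : x ∈ B := by
  by_contra hxB
  obtain ⟨l, s, h1, h2⟩ := geometric_hahn_banach_closed_point hB.1 hB.2.isClosed hxB
  obtain ⟨w, hw⟩ : ∃ w : E, ∀ y, l y = inner ℝ w y :=
    ⟨(InnerProductSpace.toDual ℝ E).symm l, fun y => by simp⟩
  have hz0 : x ∈ A := hx (mem_closedBall_self hr.le)
  have hw0 : w ≠ 0 := by
    rintro rfl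
    obtain ⟨b, hb, _⟩ := hn.1 x hz0
    have := h1 b hb
    simp only [hw, inner_zero_left] at this h2
    linarith
  have hwn : 0 < ‖w‖ := norm_pos_iff.2 hw0
  have hz : x + (r / ‖w‖) • w ∈ A := by
    apply hx
    rw [mem_closedBall, dist_eq_norm, add_sub_cancel_left, norm_smul, Real.norm_eq_abs,
      abs_of_pos (by positivity)]
    rw [div_mul_cancel₀ _ hwn.ne']
  obtain ⟨b, hb, hd⟩ := hn.1 _ hz
  have h3 := h1 b hb
  have h4 : inner ℝ w (x + (r / ‖w‖) • w - b) ≤ ‖w‖ * δ :=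
    (real_inner_le_norm _ _).trans (by rw [← dist_eq_norm]; gcongr)
  rw [inner_sub_right, inner_add_right, inner_smul_right, real_inner_self_eq_norm_sq,
    ← hw, ← hw] at h4
  have h5 : r / ‖w‖ * ‖w‖ ^ 2 = ‖w‖ * r := by field_simp
  rw [h5] at h4
  have : ‖w‖ * δ < ‖w‖ * r := by gcongr
  linarith

variable [MeasurableSpace E] [BorelSpace E]

lemma vol_flat (l : E →L[ℝ] ℝ) (hl : l ≠ 0) (c : ℝ) : volume {x | l x = c} = 0 := by
  obtain ⟨x0, hx0⟩ : ∃ x0, l x0 = c := by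
    obtain ⟨y, hy⟩ : ∃ y, l y ≠ 0 := by
      by_contra! h
      exact hl (ContinuousLinearMap.ext h)
    exact ⟨(c / l y) • y, by simp [hy]⟩
  have : {x | l x = c} = (fun x => x + (-x0)) ⁻¹' ((LinearMap.ker (l : E →ₗ[ℝ] ℝ) : Submodule ℝ E) : Set E) := by
    ext x
    simp [hx0, ← sub_eq_add_neg, sub_eq_zero]
  rw [this, measure_preimage_add_right]
  apply Measure.addHaar_submodule
  intro h
  apply hl
  ext x
  have : x ∈ LinearMap.ker (l : E →ₗ[ℝ] ℝ) := by rw [h]; trivial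
  simpa using this

lemma good_vol : Good (fun S : Set E => (((volume S).toReal : ℝ) : ℂ)) where
  empty := by simp
  glue A B hA hB _ l hl c hAB := by
    have h0 : volume (A ∩ B) = 0 := measure_mono_null hAB (vol_flat l hl c)
    have := measure_union_add_inter A hB.2.measurableSet (μ := (volume : Measure E))
    rw [h0, add_zero] at this
    rw [this, ENNReal.toReal_add hA.2.measure_lt_top.ne hB.2.measure_lt_top.ne]
    push_cast
    rfl
  flat A hA l hl c h := by
    rw [measure_mono_null h (vol_flat l hl c)]
    simp
  trans A hA x := by
    rw [singleton_add, image_add_left, measure_preimage_add]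
  even A hA := by
    rw [Measure.measure_neg]
  cont A hA hA' ε hε := by
    by_contra! H
    have hpos : ∀ k : ℕ, (0 : ℝ) < 1 / ((k : ℝ) + 1) := fun k => by positivity
    choose B hB hB' hN hD using fun k : ℕ => H _ (hpos k)
    have hlim : Filter.Tendsto (fun k => volume (B k)) Filter.atTop (nhds (volume A)) := by
      refine tendsto_measure_of_ae_tendsto_indicator Filter.atTop hA.2.measurableSet
        (fun k => (hB k).2.measurableSet) (B := cthickening 1 A) isClosed_cthickening.measurableSet
        hA.2.cthickening.measure_lt_top.ne (Filter.Eventually.of_forall ?_) ?_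
      · intro k x hx
        obtain ⟨y, hy, hxy⟩ := (hN k).2 x hx
        refine mem_cthickening_of_dist_le x y 1 A hy ?_
        rw [dist_comm]
        refine hxy.trans ?_
        rw [div_le_one (by positivity)]
        have : (0 : ℝ) ≤ k := by positivity
        linarith
      · have hf : ∀ᵐ x ∂(volume : Measure E), x ∉ frontier A :=
          measure_eq_zero_iff_ae_notMem.1 (hA.1.addHaar_frontier volume)
        filter_upwards [hf] with x hx
        have htend := tendsto_one_div_add_atTop_nhds_zero_nat (𝕜 := ℝ)
        by_cases hxA : x ∈ A
        · have hxi : x ∈ interior A := by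
            by_contra h
            exact hx ⟨subset_closure hxA, h⟩
          obtain ⟨r, hr, hrA⟩ := Metric.nhds_basis_closedBall.mem_iff.1 (mem_interior_iff_mem_nhds.1 hxi)
          filter_upwards [htend.eventually (gt_mem_nhds hr)] with k hk
          exact ⟨fun _ => hxA, fun _ => mem_of_near (hB k) hr hrA hk (hN k)⟩
        · obtain ⟨r, hr, hrA⟩ := Metric.nhds_basis_ball.mem_iff.1
            (hA.2.isClosed.isOpen_compl.mem_nhds hxA)
          filter_upwards [htend.eventually (gt_mem_nhds hr)] with k hk
          refine ⟨fun h => ?_, fun h => absurd h hxA⟩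
          obtain ⟨y, hy, hxy⟩ := (hN k).2 x h
          exact absurd hy (hrA (mem_ball.2 (hxy.trans_lt hk)))
    have hlim2 := (ENNReal.tendsto_toReal hA.2.measure_lt_top.ne).comp hlim
    have hlim3 := (Complex.continuous_ofReal.tendsto _).comp hlim2
    obtain ⟨k, hk⟩ := ((Metric.tendsto_nhds.1 hlim3) ε hε).exists
    rw [dist_comm, dist_eq_norm] at hk
    exact absurd hk (not_lt.2 (hD k).le)

end Vol

section Comb

variable {E : Type*} [NormedAddCommGroup E] [NormedSpace ℝ E]

lemma Good.sub_smul {m m' : Set E → ℂ} (hm : Good m) (hm' : Good m') (c : ℂ) :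
    Good (fun S => m S - c * m' S) where
  empty := by simp [hm.empty, hm'.empty]
  glue A B hA hB h l hl d hAB := by
    simp only [hm.glue A B hA hB h l hl d hAB, hm'.glue A B hA hB h l hl d hAB]
    ring
  flat A hA l hl d h := by
    simp only [hm.flat A hA l hl d h, hm'.flat A hA l hl d h]
    simp
  trans A hA x := by
    simp only [hm.trans A hA x, hm'.trans A hA x]
  even A hA := by
    simp only [hm.even A hA, hm'.even A hA]
  cont A hA hA' ε hε := by
    obtain ⟨δ, hδ, h1⟩ := hm.cont A hA hA' (ε / 2) (by positivity)
    obtain ⟨δ', hδ', h2⟩ := hm'.cont A hA hA' (ε / 2 / (‖c‖ + 1)) (by positivity)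
    refine ⟨min δ δ', lt_min hδ hδ', fun B hB hB' hN => ?_⟩
    have e1 := h1 B hB hB' (hN.mono (min_le_left _ _))
    have e2 := h2 B hB hB' (hN.mono (min_le_right _ _))
    have e3 : ‖c‖ * ‖m' A - m' B‖ ≤ ε / 2 := by
      calc ‖c‖ * ‖m' A - m' B‖ ≤ (‖c‖ + 1) * (ε / 2 / (‖c‖ + 1)) := by gcongr; linarith
        _ = ε / 2 := by field_simp
    calc ‖m A - c * m' A - (m B - c * m' B)‖ = ‖(m A - m B) - c * (m' A - m' B)‖ := by ring_nf
      _ ≤ ‖m A - m B‖ + ‖c * (m' A - m' B)‖ := norm_sub_le _ _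
      _ ≤ ε := by rw [norm_mul]; linarith

open Classical in
/-- The set function attached to a function on convex bodies. -/
def toSet (μ : ConvexBody E → ℂ) (S : Set E) : ℂ :=
  if h : CC S ∧ S.Nonempty then μ ⟨S, h.1.1, h.1.2, h.2⟩ else 0

lemma toSet_eq (μ : ConvexBody E → ℂ) {S : Set E} (h : CC S) (h' : S.Nonempty) :
    toSet μ S = μ ⟨S, h.1, h.2, h'⟩ := by
  unfold toSet
  rw [dif_pos ⟨h, h'⟩]

lemma toSet_empty (μ : ConvexBody E → ℂ) : toSet μ ∅ = 0 := by
  unfold toSet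
  rw [dif_neg (fun h => Set.not_nonempty_empty h.2)]

end Comb

end Klain

namespace Klain

section Final

variable {E : Type*} [NormedAddCommGroup E] [InnerProductSpace ℝ E] [FiniteDimensional ℝ E]

lemma good_toSet {n : ℕ} (hn : 0 < n) (hE : Module.finrank ℝ E = n) {μ : ConvexBody E → ℂ}
    (hval : IsValuationC μ) (hcont : Continuous μ)
    (htrans : IsTranslationInvariantC μ) (heven : IsEvenValC μ)
    (hsimple : IsSimpleValC n μ) : Good (toSet μ) := by
  have hflat : ∀ A : Set E, CC A → ∀ l : E →L[ℝ] ℝ, l ≠ 0 → ∀ c : ℝ, A ⊆ {x | l x = c} →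
      toSet μ A = 0 := by
    intro A hA l hl c h
    rcases A.eq_empty_or_nonempty with rfl | hne
    · exact toSet_empty μ
    rw [toSet_eq μ hA hne]
    obtain ⟨x0, hx0⟩ := hne
    refine hsimple _ ⟨l.toLinearMap.ker, x0, ?_, fun x hx => ?_⟩
    · have h1 := LinearMap.finrank_range_add_finrank_ker l.toLinearMap
      have h2 : l.toLinearMap.range = ⊤ := by
        apply LinearMap.range_eq_top.2
        apply LinearMap.surjective
        intro h
        apply hl
        ext x
        exact congrArg (fun f : E →ₗ[ℝ] ℝ => f x) h
      rw [h2, finrank_top, Module.finrank_self, hE] at h1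
      omega
    · refine ⟨x - x0, ?_, by simp⟩
      have e1 : l x = c := h hx
      have e2 : l x0 = c := h hx0
      simp [e1, e2]
  refine ⟨toSet_empty μ, ?_, hflat, ?_, ?_, ?_⟩
  · intro A B hA hB hAB l hl c hI
    rcases A.eq_empty_or_nonempty with rfl | hneA
    · simp [toSet_empty]
    rcases B.eq_empty_or_nonempty with rfl | hneB
    · simp [toSet_empty]
    have hne : (A ∩ B).Nonempty := by
      have h1 := isPreconnected_closed_iff.1 hAB.isPreconnected A B hA.2.isClosed hB.2.isClosed
        subset_rfl (hneA.mono (fun x hx => ⟨Or.inl hx, hx⟩))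
        (hneB.mono (fun x hx => ⟨Or.inr hx, hx⟩))
      exact h1.mono (fun x hx => hx.2)
    have hCI : CC (A ∩ B) := hA.inter hB.1 hB.2.isClosed
    have hCU : CC (A ∪ B) := ⟨hAB, hA.2.union hB.2⟩
    have h0 := hflat (A ∩ B) hCI l hl c hI
    rw [toSet_eq μ hCI hne] at h0
    rw [toSet_eq μ hA hneA, toSet_eq μ hB hneB, toSet_eq μ hCU (hneA.mono subset_union_left)]
    have := hval ⟨A, hA.1, hA.2, hneA⟩ ⟨B, hB.1, hB.2, hneB⟩
      ⟨A ∪ B, hCU.1, hCU.2, hneA.mono subset_union_left⟩ ⟨A ∩ B, hCI.1, hCI.2, hne⟩ rfl rfl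
    rw [h0, add_zero] at this
    exact this
  · intro A hA x
    rcases A.eq_empty_or_nonempty with rfl | hne
    · simp
    rw [toSet_eq μ hA hne, toSet_eq μ ((CC.singleton x).add hA) ((singleton_nonempty x).add hne)]
    refine htrans x _ _ ?_
    change {x} + A = x +ᵥ A
    rw [singleton_add]
    rfl
  · intro A hA
    rcases A.eq_empty_or_nonempty with rfl | hne
    · simp
    rw [toSet_eq μ hA hne, toSet_eq μ hA.neg hne.neg]
    exact heven _ _ rfl
  · intro A hA hne ε hε
    obtain ⟨δ, hδ, h⟩ := Metric.continuous_iff.1 hcont ⟨A, hA.1, hA.2, hne⟩ ε hε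
    refine ⟨δ / 2, by positivity, fun B hB hneB hN => ?_⟩
    rw [toSet_eq μ hA hne, toSet_eq μ hB hneB, ← dist_eq_norm, dist_comm]
    refine (h _ (lt_of_le_of_lt ?_ (half_lt_self hδ))).le
    rw [← ConvexBody.hausdorffDist_coe]
    refine hausdorffDist_le_of_mem_dist (by positivity) ?_ ?_
    · intro x hx
      obtain ⟨y, hy, hxy⟩ := hN.2 x hx
      exact ⟨y, hy, by rwa [dist_comm]⟩
    · intro x hx
      obtain ⟨y, hy, hxy⟩ := hN.1 x hx
      exact ⟨y, hy, hxy⟩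

end Final

end Klain

/-- Klain's characterization of the volume: a continuous, translation invariant,
even, simple valuation is a multiple of the Lebesgue measure. -/
theorem statement9 {V : Type*} [NormedAddCommGroup V] [InnerProductSpace ℝ V]
    [FiniteDimensional ℝ V] [MeasurableSpace V] [BorelSpace V]
    (n : ℕ) (hV : Module.finrank ℝ V = n)
    (μ : ConvexBody V → ℂ) (hval : IsValuationC μ) (hcont : Continuous μ)
    (htrans : IsTranslationInvariantC μ) (heven : IsEvenValC μ)
    (hsimple : IsSimpleValC n μ) :
    ∃ c : ℂ, ∀ K : ConvexBody V, μ K = c * ((volume (K : Set V)).toReal : ℂ) := by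
  classical
  rcases Nat.eq_zero_or_pos n with rfl | hn
  · refine ⟨0, fun K => ?_⟩
    rw [zero_mul]
    refine hsimple K ⟨⊥, 0, by simp, fun x _ => ?_⟩
    have : Subsingleton V := Module.finrank_zero_iff.1 hV
    exact ⟨0, by simp, Subsingleton.elim _ _⟩
  have hgood : Klain.Good (Klain.toSet μ) := Klain.good_toSet hn hV hval hcont htrans heven hsimple
  let b : OrthonormalBasis (Fin n) ℝ V := (stdOrthonormalBasis ℝ V).reindex (finCongr hV)
  set c : ℂ := Klain.toSet μ (parallelepiped b) with hc
  refine ⟨c, fun K => ?_⟩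
  have hg := hgood.sub_smul Klain.good_vol c
  have h0 : Klain.toSet μ (parallelepiped b.toBasis) -
      c * (((volume (parallelepiped b.toBasis)).toReal : ℝ) : ℂ) = 0 := by
    rw [b.coe_toBasis, b.volume_parallelepiped, ← hc]
    simp
  have hK := Klain.Good.zero_of_par n hV _ hg (hg.par_all hV b.toBasis h0) (K : Set V)
    ⟨K.convex, K.isCompact⟩
  have hK' := sub_eq_zero.1 hK
  rwa [Klain.toSet_eq μ ⟨K.convex, K.isCompact⟩ K.nonempty] at hK'

end
end

section
/- (Existence of the Klain function) Let V be an n-dimensional Euclidean vector space, 0 ≤ k ≤ n, and let μ be a continuous, translation invariant, complex-valued valuation on V which is even and homogeneous of degree k (μ(tK) = t^k μ(K) for all t ≥ 0). Then for every k-dimensional linear subspace E of V there is a constant Kl_μ(E) ∈ ℂ such that μ(K) = Kl_μ(E) · H^k(K) for every nonempty compact convex K ⊆ E, where H^k is k-dimensional Hausdorff measure. -/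
open MeasureTheory Metric Set
open scoped Pointwise ENNReal

noncomputable section

variable {V : Type*} [NormedAddCommGroup V] [NormedSpace ℝ V]

/-- face of the unit cell at `z` -/
def kface {k : ℕ} (t : Finset (Fin k)) (z : Fin k → ℤ) : Set (Fin k → ℝ) :=
  {x | ∀ i, (z i : ℝ) ≤ x i ∧ x i ≤ z i + 1 ∧ (i ∈ t → x i = z i + 1)}

def kslab {k : ℕ} (i : Fin k) (j : ℤ) : Set (Fin k → ℝ) := {x | (j : ℝ) ≤ x i ∧ x i ≤ j + 1}
def kwall {k : ℕ} (i : Fin k) (j : ℤ) : Set (Fin k → ℝ) := {x | x i = j}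

def knu {k : ℕ} (φ : Set (Fin k → ℝ) → ℂ) (z : Fin k → ℤ) (B : Set (Fin k → ℝ)) : ℂ :=
  ∑ t ∈ (Finset.univ : Finset (Fin k)).powerset, (-1) ^ t.card * φ (B ∩ kface t z)

def CC {k : ℕ} (A : Set (Fin k → ℝ)) : Prop := Convex ℝ A ∧ IsCompact A

/-- hyperplane cut property -/
def KCut {k : ℕ} (φ : Set (Fin k → ℝ) → ℂ) : Prop :=
  ∀ A, CC A → ∀ (i : Fin k) (a : ℝ),
    φ A = φ (A ∩ {x | x i ≤ a}) + φ (A ∩ {x | a ≤ x i}) - φ (A ∩ {x | x i = a})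

lemma convex_le {k : ℕ} (i : Fin k) (a : ℝ) : Convex ℝ {x : Fin k → ℝ | x i ≤ a} :=
  convex_halfSpace_le (IsLinearMap.mk (fun _ _ => rfl) (fun _ _ => rfl)) a

lemma convex_ge {k : ℕ} (i : Fin k) (a : ℝ) : Convex ℝ {x : Fin k → ℝ | a ≤ x i} :=
  convex_halfSpace_ge (IsLinearMap.mk (fun _ _ => rfl) (fun _ _ => rfl)) a

lemma CC.inter {k : ℕ} {A B : Set (Fin k → ℝ)} (hA : CC A) (hB : Convex ℝ B) (hB' : IsClosed B) :
    CC (A ∩ B) := ⟨hA.1.inter hB, hA.2.inter_right hB'⟩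

lemma CC.le {k : ℕ} {A : Set (Fin k → ℝ)} (hA : CC A) (i : Fin k) (a : ℝ) :
    CC (A ∩ {x | x i ≤ a}) :=
  hA.inter (convex_le i a) (isClosed_le (by fun_prop) (by fun_prop))

lemma CC.slab {k : ℕ} {A : Set (Fin k → ℝ)} (hA : CC A) (i : Fin k) (j : ℤ) :
    CC (A ∩ kslab i j) := by
  refine hA.inter ((convex_ge i j).inter (convex_le i (j+1))) ?_
  have h1 : IsClosed {x : Fin k → ℝ | (j : ℝ) ≤ x i} := isClosed_le (by fun_prop) (by fun_prop)
  have h2 : IsClosed {x : Fin k → ℝ | x i ≤ (j : ℝ) + 1} := isClosed_le (by fun_prop) (by fun_prop)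
  exact h1.inter h2

lemma CC.wall {k : ℕ} {A : Set (Fin k → ℝ)} (hA : CC A) (i : Fin k) (j : ℤ) :
    CC (A ∩ kwall i j) := by
  refine hA.inter ?_ (isClosed_eq (by fun_prop) (by fun_prop))
  have := (convex_ge i (j:ℝ)).inter (convex_le i (j:ℝ))
  convert this using 1
  ext x; simp only [kwall, mem_ofPred_eq, mem_inter_iff]
  exact ⟨fun h => ⟨h.ge, h.le⟩, fun h => le_antisymm h.2 h.1⟩

lemma kface_eq {k : ℕ} (t : Finset (Fin k)) (z : Fin k → ℤ) :
    kface t z = Icc (fun i => (z i : ℝ) + if i ∈ t then 1 else 0) (fun i => (z i : ℝ) + 1) := by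
  ext x
  simp only [kface, mem_ofPred_eq, mem_Icc, Pi.le_def, ← forall_and]
  refine forall_congr' fun i => ?_
  by_cases h : i ∈ t
  · simp only [h, if_true, forall_true_left]
    constructor
    · rintro ⟨h1, h2, h3⟩; exact ⟨h3.ge, h2⟩
    · rintro ⟨h1, h2⟩; exact ⟨by linarith, h2, le_antisymm h2 h1⟩
  · simp [h]

lemma CC.face {k : ℕ} {A : Set (Fin k → ℝ)} (hA : CC A) (t : Finset (Fin k)) (z : Fin k → ℤ) :
    CC (A ∩ kface t z) := by
  rw [kface_eq]; exact hA.inter (convex_Icc _ _) isClosed_Icc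

lemma one_dim {k : ℕ} {φ : Set (Fin k → ℝ) → ℂ} (h0 : φ ∅ = 0) (hcut : KCut φ)
    {A : Set (Fin k → ℝ)} (hA : CC A) (i : Fin k) (N : ℤ)
    (hN : ∀ x ∈ A, (-N : ℝ) ≤ x i ∧ x i < N) :
    φ A = ∑ j ∈ Finset.Ico (-N) N, (φ (A ∩ kslab i j) - φ (A ∩ kwall i (j + 1))) := by
  rcases A.eq_empty_or_nonempty with rfl | ⟨x0, hx0⟩
  · simp [h0]
  have hNN : -N ≤ N := by
    have := hN x0 hx0
    have : (-N : ℝ) ≤ N := by linarith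
    exact_mod_cast this
  set u : ℤ → ℂ := fun j => φ (A ∩ {x | x i ≤ (j : ℝ)}) - φ (A ∩ kwall i j) with hu
  have step : ∀ j, u (j + 1) = u j + (φ (A ∩ kslab i j) - φ (A ∩ kwall i (j + 1))) := by
    intro j
    have := hcut _ (hA.le i ((j:ℝ)+1)) i j
    have e1 : A ∩ {x | x i ≤ (j:ℝ)+1} ∩ {x | x i ≤ (j:ℝ)} = A ∩ {x | x i ≤ (j:ℝ)} := by
      ext x; simp only [mem_inter_iff, mem_ofPred_eq]
      constructor
      · tauto
      · rintro ⟨h, h'⟩; exact ⟨⟨h, by linarith⟩, h'⟩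
    have e2 : A ∩ {x | x i ≤ (j:ℝ)+1} ∩ {x | (j:ℝ) ≤ x i} = A ∩ kslab i j := by
      ext x; simp only [mem_inter_iff, mem_ofPred_eq, kslab]; tauto
    have e3 : A ∩ {x | x i ≤ (j:ℝ)+1} ∩ {x | x i = (j:ℝ)} = A ∩ kwall i j := by
      ext x; simp only [mem_inter_iff, mem_ofPred_eq, kwall]
      constructor
      · tauto
      · rintro ⟨h, h'⟩; exact ⟨⟨h, by linarith⟩, h'⟩
    rw [e1, e2, e3] at this
    simp only [hu]; push_cast; rw [this]; ring
  have main : ∀ b, -N ≤ b →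
      u b = u (-N) + ∑ j ∈ Finset.Ico (-N) b, (φ (A ∩ kslab i j) - φ (A ∩ kwall i (j + 1))) := by
    intro b hb
    induction b, hb using Int.leInduction with
    | base => simp
    | succ b hb ih =>
      have : Finset.Ico (-N) (b + 1) = insert b (Finset.Ico (-N) b) := by
        ext x; simp only [Finset.mem_Ico, Finset.mem_insert]; omega
      rw [step, ih, this, Finset.sum_insert (by simp)]; ring
  have h1 : u (-N) = 0 := by
    have : A ∩ {x | x i ≤ ((-N : ℤ) : ℝ)} = A ∩ kwall i (-N) := by
      ext x; simp only [mem_inter_iff, mem_ofPred_eq, kwall]; push_cast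
      constructor
      · rintro ⟨h, h'⟩; exact ⟨h, le_antisymm h' (hN x h).1⟩
      · rintro ⟨h, h'⟩; exact ⟨h, h'.le⟩
    simp only [hu, this, sub_self]
  have h2 : u N = φ A := by
    have e1 : A ∩ {x | x i ≤ (N : ℝ)} = A := inter_eq_left.2 fun x hx => (hN x hx).2.le
    have e2 : A ∩ kwall i N = ∅ := by
      ext x; simp only [mem_inter_iff, kwall, mem_ofPred_eq, mem_empty_iff_false, iff_false, not_and]
      intro h; exact (hN x h).2.ne
    simp only [hu, e1, e2, h0, sub_zero]
  rw [← h2, main N hNN, h1, zero_add]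

/-- index for slabs and walls -/
abbrev KIdx (k : ℕ) := Bool × Fin k × ℤ

def kset {k : ℕ} (v : KIdx k) : Set (Fin k → ℝ) :=
  if v.1 then kwall v.2.1 v.2.2 else kslab v.2.1 v.2.2

def KL {k : ℕ} (φ : Set (Fin k → ℝ) → ℂ) (A : Set (Fin k → ℝ)) :
    MvPolynomial (KIdx k) ℂ →ₗ[ℂ] ℂ :=
  (MvPolynomial.basisMonomials (KIdx k) ℂ).constr ℂ
    (fun m => φ (A ∩ ⋂ v ∈ m.support, kset v))

lemma KL_monomial {k : ℕ} (φ : Set (Fin k → ℝ) → ℂ) (A : Set (Fin k → ℝ)) (m : KIdx k →₀ ℕ) :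
    KL φ A (MvPolynomial.monomial m 1) = φ (A ∩ ⋂ v ∈ m.support, kset v) := by
  have := (MvPolynomial.basisMonomials (KIdx k) ℂ).constr_basis ℂ
    (fun m => φ (A ∩ ⋂ v ∈ m.support, kset v)) m
  rwa [MvPolynomial.coe_basisMonomials] at this

lemma KL_one {k : ℕ} (φ : Set (Fin k → ℝ) → ℂ) (A : Set (Fin k → ℝ)) :
    KL φ A 1 = φ A := by
  have := KL_monomial φ A 0
  simpa using this

lemma KL_X_mul {k : ℕ} (φ : Set (Fin k → ℝ) → ℂ) (A : Set (Fin k → ℝ)) (v : KIdx k)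
    (p : MvPolynomial (KIdx k) ℂ) :
    KL φ A (MvPolynomial.X v * p) = KL φ (A ∩ kset v) p := by
  have : (KL φ A) ∘ₗ (LinearMap.mulLeft ℂ (MvPolynomial.X v)) = KL φ (A ∩ kset v) := by
    refine (MvPolynomial.basisMonomials (KIdx k) ℂ).ext fun m => ?_
    rw [MvPolynomial.coe_basisMonomials]
    simp only [LinearMap.comp_apply, LinearMap.mulLeft_apply]
    rw [MvPolynomial.X, MvPolynomial.monomial_mul, one_mul, KL_monomial, KL_monomial]
    congr 1
    have : (Finsupp.single v 1 + m).support = insert v m.support := by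
      ext w
      simp only [Finsupp.mem_support_iff, Finsupp.add_apply, Finset.mem_insert,
        Finsupp.single_apply]
      by_cases h : v = w
      · simp [h]
      · simp [h, Ne.symm h]
    rw [this, Finset.set_biInter_insert, inter_assoc]
  exact LinearMap.congr_fun this p

lemma KL_prod_X_mul {k : ℕ} (φ : Set (Fin k → ℝ) → ℂ) (f : Fin k → KIdx k) (s : Finset (Fin k))
    (A : Set (Fin k → ℝ)) (p : MvPolynomial (KIdx k) ℂ) :
    KL φ A ((∏ i ∈ s, MvPolynomial.X (f i)) * p) = KL φ (A ∩ ⋂ i ∈ s, kset (f i)) p := by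
  induction s using Finset.induction_on generalizing A with
  | empty => simp
  | insert a s ha ih =>
    rw [Finset.prod_insert ha, mul_assoc, KL_X_mul, ih, Finset.set_biInter_insert, inter_assoc]

lemma KL_cell {k : ℕ} (φ : Set (Fin k → ℝ) → ℂ) (A : Set (Fin k → ℝ)) (z : Fin k → ℤ) :
    KL φ A (∏ i, (MvPolynomial.X (false, i, z i) - MvPolynomial.X (true, i, z i + 1)))
      = knu φ z A := by
  have : ∀ i, (MvPolynomial.X (false, i, z i) - MvPolynomial.X (true, i, z i + 1) :
      MvPolynomial (KIdx k) ℂ) = 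
      (-1) * MvPolynomial.X (true, i, z i + 1) + MvPolynomial.X (false, i, z i) := by
    intro i; ring
  simp only [this]
  rw [Finset.prod_add, map_sum, knu]
  refine Finset.sum_congr rfl fun t _ => ?_
  rw [Finset.prod_mul_distrib, Finset.prod_const, mul_assoc]
  have e : ((-1 : MvPolynomial (KIdx k) ℂ)) ^ t.card = MvPolynomial.C ((-1) ^ t.card) := by simp
  rw [e, ← MvPolynomial.smul_eq_C_mul, map_smul, smul_eq_mul,
    KL_prod_X_mul φ (fun i => (true, i, z i + 1)),
    ← mul_one (∏ i ∈ Finset.univ \ t, _), KL_prod_X_mul φ (fun i => (false, i, z i)), KL_one,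
    inter_assoc]
  congr 3
  ext x
  simp only [mem_inter_iff, mem_iInter, kset, kwall, kslab, kface, mem_ofPred_eq]
  constructor
  · rintro ⟨h1, h2⟩ i
    by_cases hi : i ∈ t
    · have := h1 i hi
      simp at this
      exact ⟨by linarith, by linarith, fun _ => this⟩
    · have := h2 i (by simp [hi])
      simp at this
      exact ⟨this.1, this.2, fun h => absurd h hi⟩
  · intro h
    refine ⟨fun i hi => ?_, fun i hi => ?_⟩
    · simpa using (h i).2.2 hi
    · simpa using ⟨(h i).1, (h i).2.1⟩

lemma KL_sum {k : ℕ} {φ : Set (Fin k → ℝ) → ℂ} (h0 : φ ∅ = 0) (hcut : KCut φ) (N : ℤ)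
    (s : Finset (Fin k)) {A : Set (Fin k → ℝ)} (hA : CC A)
    (hN : ∀ x ∈ A, ∀ i, (-N : ℝ) ≤ x i ∧ x i < N) :
    KL φ A (∏ i ∈ s, ∑ j ∈ Finset.Ico (-N) N,
      (MvPolynomial.X (false, i, j) - MvPolynomial.X (true, i, j + 1))) = φ A := by
  induction s using Finset.induction_on generalizing A with
  | empty => simp [KL_one]
  | insert a s ha ih =>
    rw [Finset.prod_insert ha, Finset.sum_mul, map_sum,
      one_dim h0 hcut hA a N (fun x hx => hN x hx a)]
    refine Finset.sum_congr rfl fun j _ => ?_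
    rw [sub_mul, map_sub, KL_X_mul, KL_X_mul]
    congr 1
    · exact ih (hA.slab a j) (fun x hx => hN x hx.1)
    · exact ih (hA.wall a (j+1)) (fun x hx => hN x hx.1)

lemma sum_cells {k : ℕ} {φ : Set (Fin k → ℝ) → ℂ} (h0 : φ ∅ = 0) (hcut : KCut φ) (N : ℤ)
    {A : Set (Fin k → ℝ)} (hA : CC A)
    (hN : ∀ x ∈ A, ∀ i, (-N : ℝ) ≤ x i ∧ x i < N) :
    φ A = ∑ z ∈ Fintype.piFinset (fun _ : Fin k => Finset.Ico (-N) N), knu φ z A := by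
  rw [← KL_sum h0 hcut N Finset.univ hA hN, Finset.prod_univ_sum, map_sum]
  exact Finset.sum_congr rfl fun z _ => KL_cell φ A z

lemma kface_sub {k : ℕ} (t : Finset (Fin k)) (z : Fin k → ℤ) : kface t z ⊆ kface ∅ z :=
  fun x hx i => ⟨(hx i).1, (hx i).2.1, fun h => absurd h (by simp)⟩

lemma kface_trans {k : ℕ} (t : Finset (Fin k)) (z : Fin k → ℤ) :
    kface t z = (fun i => (z i : ℝ)) +ᵥ kface t 0 := by
  ext x
  rw [mem_vadd_set_iff_neg_vadd_mem]
  simp only [kface, mem_ofPred_eq]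
  refine forall_congr' fun i => ?_
  simp only [Pi.zero_apply, Int.cast_zero, vadd_eq_add, Pi.add_apply, Pi.neg_apply, zero_add]
  refine and_congr ?_ (and_congr ?_ (imp_congr Iff.rfl ?_))
  · constructor <;> intro h <;> linarith
  · constructor <;> intro h <;> linarith
  · constructor <;> intro h <;> linarith

lemma CC_face {k : ℕ} (t : Finset (Fin k)) (z : Fin k → ℤ) : CC (kface t z) := by
  rw [kface_eq]; exact ⟨convex_Icc _ _, isCompact_Icc⟩

def KTrans {k : ℕ} (φ : Set (Fin k → ℝ) → ℂ) : Prop :=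
  ∀ (x : Fin k → ℝ) A, CC A → φ (x +ᵥ A) = φ A

lemma CC.vadd {k : ℕ} {A : Set (Fin k → ℝ)} (hA : CC A) (x : Fin k → ℝ) : CC (x +ᵥ A) :=
  ⟨hA.1.vadd x, hA.2.vadd x⟩

lemma knu_bound {k : ℕ} {φ : Set (Fin k → ℝ) → ℂ} (htr : KTrans φ) {C : ℝ}
    (hC : ∀ A, CC A → A ⊆ Icc 0 1 → ‖φ A‖ ≤ C) (z : Fin k → ℤ) {B : Set (Fin k → ℝ)}
    (hB : CC B) : ‖knu φ z B‖ ≤ 2 ^ k * C := by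
  rw [knu]
  refine (norm_sum_le _ _).trans ?_
  have : ∀ t ∈ (Finset.univ : Finset (Fin k)).powerset,
      ‖(-1) ^ t.card * φ (B ∩ kface t z)‖ ≤ C := by
    intro t _
    rw [norm_mul, norm_pow, norm_neg, norm_one, one_pow, one_mul,
      ← htr (-fun i => (z i : ℝ)) _ (hB.face t z)]
    refine hC _ ((hB.face t z).vadd _) ?_
    rintro _ ⟨x, hx, rfl⟩
    refine ⟨fun i => ?_, fun i => ?_⟩
    · have := (hx.2 i).1
      simp; linarith
    · have := (hx.2 i).2.1
      simp; linarith
  refine (Finset.sum_le_card_nsmul _ _ _ this).trans ?_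
  simp

lemma knu_in {k : ℕ} {φ : Set (Fin k → ℝ) → ℂ} (htr : KTrans φ) {z : Fin k → ℤ}
    {B : Set (Fin k → ℝ)} (h : kface ∅ z ⊆ B) : knu φ z B = knu φ 0 univ := by
  refine Finset.sum_congr rfl fun t _ => ?_
  rw [inter_eq_right.2 ((kface_sub t z).trans h), univ_inter, kface_trans, htr _ _ (CC_face t 0)]

lemma knu_out {k : ℕ} {φ : Set (Fin k → ℝ) → ℂ} (h0 : φ ∅ = 0) {z : Fin k → ℤ}
    {B : Set (Fin k → ℝ)} (h : ∀ x ∈ kface ∅ z, x ∉ B) : knu φ z B = 0 := by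
  refine Finset.sum_eq_zero fun t _ => ?_
  have : B ∩ kface t z = ∅ := by
    ext x
    simp only [mem_inter_iff, mem_empty_iff_false, iff_false, not_and]
    exact fun hx hx' => h x (kface_sub t z hx') hx
  rw [this, h0, mul_zero]

/-- points of the cell, rescaled, are close to `x` -/
lemma cell_close {k : ℕ} {m : ℝ} (hm : 0 < m) (x y : Fin k → ℝ)
    (hy : y ∈ kface ∅ (fun i => ⌊m * x i⌋)) : dist (m⁻¹ • y) x ≤ m⁻¹ := by
  refine (dist_pi_le_iff (by positivity)).2 fun i => ?_
  have h1 := (hy i).1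
  have h2 := (hy i).2.1
  have h3 := Int.floor_le (m * x i)
  have h4 := Int.lt_floor_add_one (m * x i)
  have e : (m⁻¹ • y) i - x i = m⁻¹ * (y i - m * x i) := by
    simp only [Pi.smul_apply, smul_eq_mul]; field_simp
  rw [Real.dist_eq, e, abs_mul, abs_of_pos (inv_pos.2 hm)]
  have : |y i - m * x i| ≤ 1 := abs_le.2 ⟨by linarith, by linarith⟩
  nlinarith [inv_pos.2 hm]

def KHom {k : ℕ} (φ : Set (Fin k → ℝ) → ℂ) : Prop :=
  ∀ (t : ℝ), 0 < t → ∀ A, CC A → φ (t • A) = (t : ℂ) ^ k * φ A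

def gfun {k : ℕ} (φ : Set (Fin k → ℝ) → ℂ) (A : Set (Fin k → ℝ)) (m : ℝ) (x : Fin k → ℝ) : ℂ :=
  knu φ (fun i => ⌊m * x i⌋) (m • A)

lemma gfun_meas {k : ℕ} (φ : Set (Fin k → ℝ) → ℂ) (A : Set (Fin k → ℝ)) (m : ℝ) :
    Measurable (gfun φ A m) := by
  have h1 : Measurable (fun z : Fin k → ℤ => knu φ z (m • A)) :=
    measurable_of_countable _
  have h2 : Measurable (fun x : Fin k → ℝ => fun i => ⌊m * x i⌋) := by
    refine measurable_pi_lambda _ fun i => ?_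
    exact Int.measurable_floor.comp (by fun_prop)
  exact h1.comp h2

def kcell {k : ℕ} (m : ℝ) (z : Fin k → ℤ) : Set (Fin k → ℝ) :=
  Set.pi univ fun i => Ico (m⁻¹ * z i) (m⁻¹ * (z i + 1))

lemma mem_kcell {k : ℕ} {m : ℝ} (hm : 0 < m) (z : Fin k → ℤ) (x : Fin k → ℝ) :
    x ∈ kcell m z ↔ (fun i => ⌊m * x i⌋) = z := by
  simp only [kcell, mem_univ_pi, funext_iff, Int.floor_eq_iff, mem_Ico]
  refine forall_congr' fun i => and_congr ?_ ?_
  · rw [inv_mul_le_iff₀ hm]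
  · rw [lt_inv_mul_iff₀ hm]

lemma kcell_vol {k : ℕ} {m : ℝ} (hm : 0 < m) (z : Fin k → ℤ) :
    (volume (kcell m z)).toReal = (m⁻¹) ^ k := by
  rw [kcell, Real.volume_pi_Ico_toReal]
  · simp only [mul_add, mul_one, add_sub_cancel_left]; simp
  · intro i
    have := inv_pos.2 hm
    simp only; nlinarith

lemma gfun_integral {k : ℕ} {φ : Set (Fin k → ℝ) → ℂ} (h0 : φ ∅ = 0) (hcut : KCut φ)
    (hhom : KHom φ) {A : Set (Fin k → ℝ)} (hA : CC A) {m : ℝ} (hm : 0 < m) :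
    ∫ x, gfun φ A m x = φ A := by
  have hmA : CC (m • A) := ⟨hA.1.smul m, hA.2.smul m⟩
  obtain ⟨R, hR⟩ := hmA.2.isBounded.subset_closedBall 0
  obtain ⟨N, hN'⟩ := exists_nat_gt R
  have hN : ∀ x ∈ m • A, ∀ i, (-(N : ℤ) : ℝ) < x i ∧ x i < (N : ℤ) := by
    intro x hx i
    have h1 := hR hx
    rw [mem_closedBall_zero_iff] at h1
    have h2 := (norm_le_pi_norm x i).trans h1
    rw [Real.norm_eq_abs, abs_le] at h2
    push_cast
    constructor <;> linarith [h2.1, h2.2]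
  set F := Fintype.piFinset (fun _ : Fin k => Finset.Ico (-(N : ℤ)) N) with hF
  have hg : gfun φ A m = fun x => ∑ z ∈ F, (kcell m z).indicator (fun _ => knu φ z (m • A)) x := by
    funext x
    by_cases hx : (fun i => ⌊m * x i⌋) ∈ F
    · rw [Finset.sum_eq_single_of_mem _ hx]
      · rw [indicator_of_mem ((mem_kcell hm _ x).2 rfl)]; rfl
      · intro z _ hz
        exact indicator_of_notMem (fun h => hz ((mem_kcell hm _ x).1 h).symm) _
    · rw [Finset.sum_eq_zero]
      · refine knu_out h0 fun y hy hyA => hx ?_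
        rw [hF, Fintype.mem_piFinset]
        intro i
        have h1 := (hy i).1
        have h2 := (hy i).2.1
        have h3 := hN y hyA i
        have h4 : (-(N : ℤ) : ℝ) < (⌊m * x i⌋ : ℝ) + 1 := h3.1.trans_le h2
        have h5 : (⌊m * x i⌋ : ℝ) < (N : ℤ) := h1.trans_lt h3.2
        have h6 : -(N : ℤ) < ⌊m * x i⌋ + 1 := by exact_mod_cast h4
        have h7 : ⌊m * x i⌋ < (N : ℤ) := by exact_mod_cast h5
        rw [Finset.mem_Ico]
        omega
      · intro z hz
        refine indicator_of_notMem (fun h => hx ?_) _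
        rw [(mem_kcell hm _ x).1 h]; exact hz
  have hms : ∀ z : Fin k → ℤ, MeasurableSet (kcell m z) := fun z =>
    MeasurableSet.univ_pi fun i => measurableSet_Ico
  have hfin : ∀ z : Fin k → ℤ, volume (kcell m z) ≠ ⊤ := fun z => by
    rw [kcell, Real.volume_pi_Ico]; exact ENNReal.prod_ne_top fun _ _ => ENNReal.ofReal_ne_top
  rw [hg, integral_finsetSum]
  · have : ∀ z ∈ F, ∫ x, (kcell m z).indicator (fun _ => knu φ z (m • A)) x
        = ((m : ℂ)⁻¹) ^ k * knu φ z (m • A) := by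
      intro z _
      rw [integral_indicator (hms z), setIntegral_const, Measure.real, kcell_vol hm]
      simp
    rw [Finset.sum_congr rfl this, ← Finset.mul_sum, ← sum_cells h0 hcut N hmA (fun x hx i => ⟨(hN x hx i).1.le, (hN x hx i).2⟩), hhom m hm A hA,
      ← mul_assoc, ← mul_pow, inv_mul_cancel₀ (by exact_mod_cast hm.ne'), one_pow, one_mul]
  · intro z _
    exact (integrable_indicator_iff (hms z)).2 (integrableOn_const (hfin z))

lemma klain_pi {k : ℕ} {φ : Set (Fin k → ℝ) → ℂ} (h0 : φ ∅ = 0) (hcut : KCut φ)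
    (htr : KTrans φ) (hhom : KHom φ) {C : ℝ}
    (hC : ∀ A, CC A → A ⊆ Icc 0 1 → ‖φ A‖ ≤ C) {A : Set (Fin k → ℝ)} (hA : CC A) :
    φ A = knu φ 0 univ * ((volume A).toReal : ℂ) := by
  obtain ⟨R, hR⟩ := hA.2.isBounded.subset_closedBall 0
  set m : ℕ → ℝ := fun n => (n : ℝ) + 1 with hm
  have mpos : ∀ n, 0 < m n := fun n => by positivity
  have minv : ∀ n, (m n)⁻¹ ≤ 1 := fun n => by
    apply inv_le_one_of_one_le₀; simp [hm]
  have mtend : Filter.Tendsto (fun n => (m n)⁻¹) Filter.atTop (nhds 0) :=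
    (tendsto_one_div_add_atTop_nhds_zero_nat (𝕜 := ℝ)).congr fun n => by simp [hm]
  have hlim := tendsto_integral_of_dominated_convergence
    (μ := (volume : Measure (Fin k → ℝ)))
    (F := fun n => gfun φ A (m n)) (f := A.indicator fun _ => knu φ 0 univ)
    ((closedBall 0 (R + 1)).indicator fun _ => 2 ^ k * C)
    (fun n => (gfun_meas φ A (m n)).aestronglyMeasurable)
    ((integrable_indicator_iff measurableSet_closedBall).2
      (integrableOn_const (isCompact_closedBall _ _).measure_lt_top.ne))
    (fun n => Filter.Eventually.of_forall fun x => by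
      by_cases hx : x ∈ closedBall (0 : Fin k → ℝ) (R + 1)
      · rw [indicator_of_mem hx]
        exact knu_bound htr hC _ ⟨hA.1.smul _, hA.2.smul _⟩
      · rw [indicator_of_notMem hx, gfun, knu_out h0, norm_zero]
        intro y hy hyA
        apply hx
        rw [mem_smul_set_iff_inv_smul_mem₀ (mpos n).ne'] at hyA
        have h1 := hR hyA
        have h2 := cell_close (mpos n) x y hy
        rw [mem_closedBall] at h1 ⊢
        have h3 := dist_triangle x ((m n)⁻¹ • y) 0
        rw [dist_comm] at h2
        linarith [minv n])
    (by
      have hfr := hA.1.addHaar_frontier (volume : Measure (Fin k → ℝ))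
      have : ∀ᵐ x : Fin k → ℝ, x ∉ frontier A := by
        rw [ae_iff]; simpa using hfr
      filter_upwards [this] with x hx
      refine tendsto_const_nhds.congr' ?_
      by_cases hxA : x ∈ A
      · have hxi : x ∈ interior A := by
          by_contra h
          exact hx ⟨subset_closure hxA, h⟩
        obtain ⟨ε, he, hball⟩ := Metric.mem_nhds_iff.1 (mem_interior_iff_mem_nhds.1 hxi)
        filter_upwards [mtend.eventually (gt_mem_nhds he)] with n hn
        rw [indicator_of_mem hxA, gfun]
        refine (knu_in htr ?_).symm
        intro y hy
        rw [mem_smul_set_iff_inv_smul_mem₀ (mpos n).ne']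
        exact hball ((cell_close (mpos n) x y hy).trans_lt hn)
      · obtain ⟨ε, he, hball⟩ := Metric.mem_nhds_iff.1 (hA.2.isClosed.isOpen_compl.mem_nhds hxA)
        filter_upwards [mtend.eventually (gt_mem_nhds he)] with n hn
        rw [indicator_of_notMem hxA, gfun, knu_out h0]
        intro y hy
        rw [mem_smul_set_iff_inv_smul_mem₀ (mpos n).ne']
        exact hball ((cell_close (mpos n) x y hy).trans_lt hn))
  simp only [gfun_integral h0 hcut hhom hA (mpos _)] at hlim
  rw [tendsto_nhds_unique tendsto_const_nhds hlim, integral_indicator hA.2.measurableSet,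
    setIntegral_const, Measure.real]
  simp [mul_comm]

def kbody {W : Type*} [NormedAddCommGroup W] [NormedSpace ℝ W] {k : ℕ}
    (T : (Fin k → ℝ) →L[ℝ] W) (A : Set (Fin k → ℝ)) (hA : CC A) (hn : A.Nonempty) :
    ConvexBody W :=
  ⟨T '' A, hA.1.linear_image T.toLinearMap, hA.2.image T.continuous, hn.image _⟩

open Classical in
def kphi {W : Type*} [NormedAddCommGroup W] [NormedSpace ℝ W] {k : ℕ}
    (μ : ConvexBody W → ℂ) (T : (Fin k → ℝ) →L[ℝ] W) (A : Set (Fin k → ℝ)) : ℂ :=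
  if h : CC A ∧ A.Nonempty then μ (kbody T A h.1 h.2) else 0

section
variable {W : Type*} [NormedAddCommGroup W] [NormedSpace ℝ W] {k : ℕ}
    {μ : ConvexBody W → ℂ} {T : (Fin k → ℝ) →L[ℝ] W}

lemma kphi_eq {A : Set (Fin k → ℝ)} (hA : CC A) (hn : A.Nonempty) :
    kphi μ T A = μ (kbody T A hA hn) := by
  rw [kphi, dif_pos ⟨hA, hn⟩]

lemma kphi_empty : kphi μ T ∅ = 0 := by
  rw [kphi, dif_neg]; rintro ⟨_, h⟩; exact not_nonempty_empty h

lemma kphi_cut (hval : IsValuationC μ) (hT : Function.Injective T) : KCut (kphi μ T) := by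
  intro A hA i a
  have hge : CC (A ∩ {x | a ≤ x i}) :=
    hA.inter (convex_ge i a) (isClosed_le (by fun_prop) (by fun_prop))
  have hle := hA.le i a
  have heq : A ∩ {x | x i = a} = (A ∩ {x | x i ≤ a}) ∩ (A ∩ {x | a ≤ x i}) := by
    ext x; simp only [mem_inter_iff, mem_ofPred_eq]
    constructor
    · rintro ⟨h, rfl⟩; exact ⟨⟨h, le_rfl⟩, h, le_rfl⟩
    · rintro ⟨⟨h, h1⟩, _, h2⟩; exact ⟨h, le_antisymm h1 h2⟩
  have hun : A = (A ∩ {x | x i ≤ a}) ∪ (A ∩ {x | a ≤ x i}) := by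
    ext x; simp only [mem_inter_iff, mem_union, mem_ofPred_eq]
    constructor
    · intro h; rcases le_total (x i) a with h' | h'
      · exact Or.inl ⟨h, h'⟩
      · exact Or.inr ⟨h, h'⟩
    · rintro (h | h) <;> exact h.1
  rcases (A ∩ {x | x i ≤ a}).eq_empty_or_nonempty with h1 | h1
  · rw [heq, h1, empty_inter, kphi_empty]
    rw [h1, empty_union] at hun
    rw [← hun]; ring
  rcases (A ∩ {x | a ≤ x i}).eq_empty_or_nonempty with h2 | h2
  · rw [heq, h2, inter_empty, kphi_empty]
    rw [h2, union_empty] at hun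
    rw [← hun]; ring
  have h3 : (A ∩ {x | x i = a}).Nonempty := by
    obtain ⟨x, hx, hxa⟩ := h1
    obtain ⟨y, hy, hya⟩ := h2
    have := hA.1.isPreconnected.intermediate_value hx hy
      (f := fun x => x i) (by fun_prop)
    obtain ⟨w, hw, hwa⟩ := this ⟨hxa, hya⟩
    exact ⟨w, hw, hwa⟩
  have hE : CC (A ∩ {x | x i = a}) := heq ▸ ⟨hle.1.inter hge.1, hle.2.inter hge.2⟩
  have hAn : A.Nonempty := h1.mono inter_subset_left
  rw [kphi_eq hA hAn, kphi_eq hle h1, kphi_eq hge h2, kphi_eq hE h3]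
  have := hval (kbody T _ hle h1) (kbody T _ hge h2) (kbody T _ hA hAn) (kbody T _ hE h3)
    (by
      change T '' A = T '' _ ∪ T '' _
      rw [← image_union, ← hun])
    (by
      change T '' _ = T '' _ ∩ T '' _
      rw [← image_inter hT, ← heq])
  rw [← this]; ring

lemma kphi_trans (htrans : IsTranslationInvariantC μ) : KTrans (kphi μ T) := by
  intro x A hA
  rcases A.eq_empty_or_nonempty with rfl | hn
  · simp
  rw [kphi_eq hA hn, kphi_eq (hA.vadd x) (hn.vadd_set)]
  refine htrans (T x) _ _ ?_
  change T '' _ = T x +ᵥ T '' _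
  ext y
  simp only [mem_image, mem_vadd_set]
  constructor
  · rintro ⟨_, ⟨w, hw, rfl⟩, rfl⟩
    exact ⟨T w, ⟨w, hw, rfl⟩, by simp⟩
  · rintro ⟨_, ⟨w, hw, rfl⟩, rfl⟩
    exact ⟨x +ᵥ w, ⟨w, hw, rfl⟩, by simp⟩

lemma kphi_hom (hhom : IsHomogeneousValC k μ) : KHom (kphi μ T) := by
  intro t ht A hA
  rcases A.eq_empty_or_nonempty with rfl | hn
  · simp [kphi_empty]
  rw [kphi_eq hA hn, kphi_eq (⟨hA.1.smul t, hA.2.smul t⟩ : CC (t • A)) (hn.smul_set)]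
  refine hhom t ht.le _ _ ?_
  change T '' _ = t • T '' _
  exact image_smul_set T t A

lemma kphi_bound (hcont : Continuous μ) (hhom : IsHomogeneousValC k μ) :
    ∃ C : ℝ, ∀ A, CC A → A ⊆ Icc 0 1 → ‖kphi μ T A‖ ≤ C := by
  obtain ⟨δ, hδ, hd⟩ := Metric.continuousAt_iff.1 (hcont.continuousAt (x := (0 : ConvexBody W)))
    1 one_pos
  obtain ⟨R, hR⟩ := ((isCompact_Icc (a := (0 : Fin k → ℝ)) (b := 1)).image
    T.continuous).isBounded.subset_closedBall 0
  have hR0 : 0 ≤ R := by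
    have : T 0 ∈ closedBall (0 : W) R := hR ⟨0, ⟨le_rfl, zero_le_one⟩, rfl⟩
    simpa using this
  set ε : ℝ := δ / (2 * (R + 1)) with hε
  have he : 0 < ε := by positivity
  have heR : ε * R < δ := by
    rw [hε, div_mul_eq_mul_div, div_lt_iff₀ (by positivity)]
    nlinarith
  refine ⟨(ε ^ k)⁻¹ * (1 + ‖μ 0‖), fun A hA hA1 => ?_⟩
  rcases A.eq_empty_or_nonempty with rfl | hn
  · rw [kphi_empty, norm_zero]; positivity
  have hA' : CC (ε • A) := ⟨hA.1.smul ε, hA.2.smul ε⟩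
  have h1 := kphi_hom (T := T) hhom ε he A hA
  have h2 : ‖kphi μ T (ε • A)‖ ≤ 1 + ‖μ 0‖ := by
    rw [kphi_eq hA' hn.smul_set]
    have : dist (kbody T _ hA' hn.smul_set) 0 < δ := by
      rw [← ConvexBody.hausdorffDist_coe]
      have key : ∀ x ∈ T '' (ε • A), dist x 0 ≤ ε * R := by
        rintro _ ⟨_, ⟨w, hw, rfl⟩, rfl⟩
        have := hR (mem_image_of_mem T (hA1 hw))
        rw [mem_closedBall_zero_iff] at this
        simp only [map_smul, dist_zero_right, norm_smul, Real.norm_eq_abs, abs_of_pos he]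
        gcongr
      refine (Metric.hausdorffDist_le_of_mem_dist (by positivity) ?_ ?_).trans_lt heR
      · intro x hx; exact ⟨0, by simp, key x hx⟩
      · intro x hx
        have hx0 : x = 0 := by simpa using hx
        obtain ⟨y, hy⟩ := (kbody T _ hA' hn.smul_set).nonempty
        exact ⟨y, hy, by rw [hx0, dist_comm]; exact key y hy⟩
    have h3 := hd this
    rw [dist_eq_norm] at h3
    have := norm_le_norm_add_norm_sub' (μ (kbody T _ hA' hn.smul_set)) (μ 0)
    linarith
  rw [h1, norm_mul, norm_pow, Complex.norm_real, Real.norm_eq_abs, abs_of_pos he] at h2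
  rw [le_inv_mul_iff₀ (by positivity)]
  exact h2

end
/-- existence of the Klain function: an even valuation of degree `k` restricts
to a multiple of the `k`-dimensional Hausdorff measure on every `k`-dimensional subspace. -/
theorem statement10 {V : Type*} [NormedAddCommGroup V] [InnerProductSpace ℝ V]
    [FiniteDimensional ℝ V] [MeasurableSpace V] [BorelSpace V]
    (n k : ℕ) (hV : Module.finrank ℝ V = n) (hk : k ≤ n)
    (μ : ConvexBody V → ℂ) (hval : IsValuationC μ) (hcont : Continuous μ)
    (htrans : IsTranslationInvariantC μ) (heven : IsEvenValC μ)
    (hhom : IsHomogeneousValC k μ) :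
    ∀ E : Submodule ℝ V, Module.finrank ℝ E = k →
      ∃ c : ℂ, ∀ K : ConvexBody V, (K : Set V) ⊆ (E : Set V) →
        μ K = c * ((μH[(k : ℝ)] (K : Set V)).toReal : ℂ) := by
  intro E hE
  let e : E ≃L[ℝ] (Fin k → ℝ) :=
    (Module.finBasisOfFinrankEq ℝ E hE).equivFun.toContinuousLinearEquiv
  let T : (Fin k → ℝ) →L[ℝ] V := E.subtypeL.comp (e.symm : (Fin k → ℝ) →L[ℝ] E)
  have hT : Function.Injective T := Subtype.val_injective.comp e.symm.injective
  obtain ⟨C, hC⟩ := kphi_bound (T := T) hcont hhom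
  have hmain := fun A (hA : CC A) => klain_pi (φ := kphi μ T) kphi_empty (kphi_cut hval hT)
    (kphi_trans htrans) (kphi_hom hhom) hC hA
  have hHaar : (μH[(k : ℝ)] : Measure E).IsAddHaarMeasure := by
    have := isAddHaarMeasure_hausdorffMeasure (E := E)
    rwa [hE] at this
  have hHaar' : (Measure.map e (μH[(k : ℝ)] : Measure E)).IsAddHaarMeasure :=
    e.isAddHaarMeasure_map _
  set a := Measure.addHaarScalarFactor (volume : Measure (Fin k → ℝ))
    (Measure.map e (μH[(k : ℝ)] : Measure E)) with ha
  have hvol : (volume : Measure (Fin k → ℝ)) = a • Measure.map e (μH[(k : ℝ)] : Measure E) :=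
    Measure.isAddLeftInvariant_eq_smul _ _
  refine ⟨knu (kphi μ T) 0 univ * (a : ℝ), fun K hK => ?_⟩
  set A : Set (Fin k → ℝ) := T ⁻¹' K with hAdef
  have hTA : T '' A = K := by
    rw [hAdef, image_preimage_eq_iff]
    intro x hx
    exact ⟨e ⟨x, hK hx⟩, by simp [T]⟩
  have hA : CC A := by
    refine ⟨K.convex.linear_preimage T.toLinearMap, ?_⟩
    have hemb : Topology.IsClosedEmbedding T :=
      LinearMap.isClosedEmbedding_of_injective (f := T.toLinearMap) (LinearMap.ker_eq_bot.2 hT)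
    exact hemb.isCompact_preimage K.isCompact
  have hAn : A.Nonempty := by
    have := K.nonempty
    rw [← hTA] at this
    exact this.of_image
  have h1 : kphi μ T A = μ K := by
    rw [kphi_eq hA hAn]
    congr 1
    exact ConvexBody.ext hTA
  have h2 : volume A = a • (μH[(k : ℝ)] (K : Set V)) := by
    conv_lhs => rw [hvol]
    rw [Measure.smul_apply, Measure.map_apply e.continuous.measurable hA.2.measurableSet]
    congr 1
    have h3 : e ⁻¹' A = Subtype.val ⁻¹' (K : Set V) := by
      ext x; simp [hAdef, T]
    have hiso : Isometry (Subtype.val : E → V) := isometry_subtype_coe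
    rw [h3, ← hiso.hausdorffMeasure_image (Or.inl (by positivity)), image_preimage_eq_iff.2]
    intro x hx
    exact ⟨⟨x, hK hx⟩, rfl⟩
  rw [← h1, hmain A hA, h2, ENNReal.toReal_smul]
  simp [NNReal.smul_def, mul_assoc]

end
end
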